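/- arXiv:1912.01154 — 2 statements merged into one kernel-verified Lean document; each statement's English description precedes it below -/
import Mathlib

section
/- Suppose the wall motion f satisfies f̈(t) > 0 for all t ∈ (0,1). Then the limit map F̃∞ is ergodic with respect to the normalized Lebesgue measure μ̃ on the torus 𝕋 = (ℝ/ℤ) × (ℝ/gℤ). -/
open MeasureTheory Filter Set

/-- The limit map `F̃∞` on the torus `(ℝ/ℤ) × (ℝ/gℤ)`, modeled on the fundamental
domain `[0,1) × [0,g)`:
`F̃∞(t̃, ṽ) = (t̃ + 2ṽ/g mod 1, ṽ + 2ḟ(t̃ + 2ṽ/g) mod g)`. -/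
noncomputable def limitTorusMap (f : ℝ → ℝ) (g : ℝ) : ℝ × ℝ → ℝ × ℝ :=
  fun p =>
    (Int.fract (p.1 + 2 * p.2 / g),
     g * Int.fract ((p.2 + 2 * deriv f (Int.fract (p.1 + 2 * p.2 / g))) / g))

/-- The normalized Lebesgue measure `μ̃ = dt̃ dṽ` on the torus, modeled as the
normalized restriction of Lebesgue measure to the fundamental domain `[0,1) × [0,g)`. -/
noncomputable def torusMeasure (g : ℝ) : Measure (ℝ × ℝ) :=
  (ENNReal.ofReal g)⁻¹ • (volume.restrict (Set.Ico (0 : ℝ) 1 ×ˢ Set.Ico (0 : ℝ) g))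

namespace LTM

structure Hyp (φ : ℝ → ℝ) : Prop where
  mono : Monotone φ
  smono : StrictMonoOn φ (Icc 0 1)
  lip : ∃ K, 0 ≤ K ∧ ∀ a b, |φ a - φ b| ≤ K * |a - b|
  slope : ∃ L, 0 ≤ L ∧ ∀ a b a' b', a ∈ Icc (0:ℝ) 1 → b ∈ Icc (0:ℝ) 1 → a' ∈ Icc (0:ℝ) 1 →
    b' ∈ Icc (0:ℝ) 1 → a < b → a' < b' →
    (φ b' - φ a') / (b' - a') ≤ (φ b - φ a) / (b - a) + L * (|a - a'| + |b - b'|)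
  low : ∀ ε > 0, ∃ c > 0, ∀ a b, ε ≤ a → a ≤ b → b ≤ 1 - ε → c * (b - a) ≤ φ b - φ a

lemma Hyp.cont {φ : ℝ → ℝ} (h : Hyp φ) : Continuous φ := by
  obtain ⟨K, hK, hl⟩ := h.lip
  have : LipschitzWith ⟨K, hK⟩ φ := LipschitzWith.of_dist_le_mul (fun a b => by
    rw [Real.dist_eq, Real.dist_eq]; exact hl a b)
  exact this.continuous

noncomputable def T (φ : ℝ → ℝ) (p : ℝ × ℝ) : ℝ × ℝ :=
  (Int.fract (p.1 + 2 * p.2), p.2 + φ (Int.fract (p.1 + 2 * p.2)))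

noncomputable def R (φ : ℝ → ℝ) (p : ℝ × ℝ) : ℝ × ℝ := (p.1, φ p.1 - p.2)

noncomputable def tt (φ : ℝ → ℝ) (n : ℕ) (x : ℝ × ℝ) : ℝ := ((T φ)^[n] x).1
noncomputable def ww (φ : ℝ → ℝ) (n : ℕ) (x : ℝ × ℝ) : ℝ := ((T φ)^[n] x).2

variable {φ : ℝ → ℝ}

@[simp] lemma tt_zero (x) : tt φ 0 x = x.1 := rfl
@[simp] lemma ww_zero (x) : ww φ 0 x = x.2 := rfl
lemma tt_succ (n x) : tt φ (n+1) x = Int.fract (tt φ n x + 2 * ww φ n x) := by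
  simp only [tt, ww, Function.iterate_succ_apply']; rfl
lemma ww_succ (n x) : ww φ (n+1) x = ww φ n x + φ (tt φ (n+1) x) := by
  rw [tt_succ]; simp only [tt, ww, Function.iterate_succ_apply']; rfl
lemma tt_add (n m x) : tt φ (n+m) x = tt φ n ((T φ)^[m] x) := by
  simp only [tt, Function.iterate_add_apply]
lemma tt_nonneg (n x) : 0 ≤ tt φ (n+1) x := by rw [tt_succ]; exact Int.fract_nonneg _
lemma tt_lt (n x) : tt φ (n+1) x < 1 := by rw [tt_succ]; exact Int.fract_lt_one _

lemma R_R (x) : R φ (R φ x) = x := by simp [R]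
lemma R_fst (x) : (R φ x).1 = x.1 := rfl

lemma TRT (x : ℝ × ℝ) (h : x.1 ∈ Ico (0:ℝ) 1) : T φ (R φ (T φ x)) = R φ x := by
  have : Int.fract (Int.fract (x.1 + 2 * x.2) + 2 * (φ (Int.fract (x.1 + 2 * x.2)) -
      (x.2 + φ (Int.fract (x.1 + 2 * x.2))))) = x.1 := by
    rw [Int.fract_eq_iff]
    refine ⟨h.1, h.2, -⌊x.1 + 2 * x.2⌋, ?_⟩
    rw [← Int.self_sub_floor]; push_cast; ring
  simp only [T, R, this]
  ext
  · rfl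
  · simp only; ring

lemma iter_mem (n : ℕ) (x : ℝ × ℝ) (h : x.1 ∈ Ico (0:ℝ) 1) : ((T φ)^[n] x).1 ∈ Ico (0:ℝ) 1 := by
  cases n with
  | zero => exact h
  | succ n => exact ⟨tt_nonneg n x, tt_lt n x⟩

lemma rev_iter (n : ℕ) : ∀ (j : ℕ) (x : ℝ × ℝ), x.1 ∈ Ico (0:ℝ) 1 →
    (T φ)^[j] (R φ ((T φ)^[n+j] x)) = R φ ((T φ)^[n] x) := by
  intro j
  induction j with
  | zero => intro x _; rfl
  | succ j ih =>
    intro x hx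
    rw [Function.iterate_succ_apply, ← add_assoc, Function.iterate_succ_apply' (T φ) (n+j),
      TRT _ (iter_mem _ _ hx), ih x hx]

lemma tt_rev (n j : ℕ) (x : ℝ × ℝ) (hx : x.1 ∈ Ico (0:ℝ) 1) :
    tt φ j (R φ ((T φ)^[n+j] x)) = tt φ n x := by
  unfold tt; rw [rev_iter n j x hx, R_fst]

/-- growth of discretely convex sequences -/
lemma grow (e : ℕ → ℝ) (N : ℕ) (hp : ∀ j, j + 2 ≤ N → 0 ≤ e (j+1) → 2 * e (j+1) ≤ e (j+2) + e j)
    (s : ℝ) (hs : 0 ≤ s) (h0 : 0 ≤ e 0) (h1 : e 0 + s ≤ e 1) :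
    ∀ j, j + 1 ≤ N → e j + s ≤ e (j+1) ∧ e 0 + j * s ≤ e j := by
  intro j
  induction j with
  | zero => intro _; exact ⟨h1, by simp⟩
  | succ j ih =>
    intro hj
    obtain ⟨h2, h3⟩ := ih (by omega)
    have hjs : 0 ≤ (j:ℝ) * s := by positivity
    have := hp j (by omega) (by linarith)
    refine ⟨by linarith, ?_⟩
    push_cast; linarith

lemma grow' (e : ℕ → ℝ) (hp : ∀ j, 0 ≤ e (j+1) → 2 * e (j+1) ≤ e (j+2) + e j)
    (s : ℝ) (hs : 0 ≤ s) (h0 : 0 ≤ e 0) (h1 : e 0 + s ≤ e 1) (j : ℕ) :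
    e j + s ≤ e (j+1) ∧ e 0 + j * s ≤ e j :=
  grow e (j+1) (fun i _ h => hp i h) s hs h0 h1 j le_rfl

noncomputable def sh (ψ : ℕ → ℝ → ℝ) (τ q : ℝ) : ℕ → ℝ
  | 0 => τ
  | 1 => q
  | (n+2) => 2 * sh ψ τ q (n+1) - sh ψ τ q n + ψ (n+1) (sh ψ τ q (n+1))

lemma sh_cont (ψ : ℕ → ℝ → ℝ) (hc : ∀ j, Continuous (ψ j)) (τ : ℝ) (n : ℕ) :
    Continuous (fun q => sh ψ τ q n) ∧ Continuous (fun q => sh ψ τ q (n+1)) := by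
  induction n with
  | zero => exact ⟨by simpa [sh] using continuous_const, by simp only [sh]; exact continuous_id⟩
  | succ n ih =>
    refine ⟨ih.2, ?_⟩
    simp only [sh]
    exact ((continuous_const.mul ih.2).sub ih.1).add ((hc (n+1)).comp ih.2)

lemma sh_fin (ψ : ℕ → ℝ → ℝ) (hc : ∀ j, Continuous (ψ j)) (hm : ∀ j, Monotone (ψ j))
    (h0 : ∀ j, ψ j 0 = 0) (τ : ℝ) (hτ : 0 ≤ τ) (N : ℕ) :
    ∃ q ∈ Icc 0 τ, ∀ j < N, 0 ≤ sh ψ τ q (j+1) ∧ sh ψ τ q (j+1) ≤ sh ψ τ q j := by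
  have hpos : ∀ q j, 0 ≤ sh ψ τ q (j+1) → 2 * sh ψ τ q (j+1) ≤ sh ψ τ q (j+2) + sh ψ τ q j := by
    intro q j h
    have : 0 ≤ ψ (j+1) (sh ψ τ q (j+1)) := by rw [← h0 (j+1)]; exact hm _ h
    simp only [sh] at *; linarith
  have hneg : ∀ q j, 0 ≤ - sh ψ τ q (j+1) →
      2 * (-sh ψ τ q (j+1)) ≤ -sh ψ τ q (j+2) + -sh ψ τ q j := by
    intro q j h
    have : ψ (j+1) (sh ψ τ q (j+1)) ≤ 0 := by rw [← h0 (j+1)]; exact hm _ (by linarith)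
    simp only [sh] at *; linarith
  have hcN := (sh_cont ψ hc τ (N+1)).1
  have e1 : 0 ≤ sh ψ τ τ (N+1) := by
    have := (grow' (sh ψ τ τ) (hpos τ) 0 le_rfl (by simpa [sh]) (by simp [sh]) (N+1)).2
    simp [sh] at this; linarith
  have e2 : sh ψ τ 0 (N+1) ≤ 0 := by
    have := (grow' (fun j => - sh ψ τ 0 (j+1)) (fun j => hneg 0 (j+1)) 0 le_rfl (by simp [sh])
      (by simp [sh, h0]; linarith) N).2
    simp [sh] at this; linarith
  obtain ⟨q, hq, hq0⟩ := intermediate_value_Icc hτ hcN.continuousOn ⟨e2, e1⟩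
  simp only at hq0
  have nn : ∀ j ≤ N + 1, 0 ≤ sh ψ τ q j := by
    intro j
    induction j with
    | zero => intro _; simpa [sh]
    | succ j ih =>
      intro hj
      by_contra hlt
      push Not at hlt
      have hj0 := ih (by omega)
      have hjN : j + 1 < N + 1 := by
        rcases Nat.lt_or_ge (j+1) (N+1) with h | h
        · exact h
        · have : j + 1 = N + 1 := by omega
          rw [this, hq0] at hlt; exact absurd hlt (lt_irrefl _)
      have h2 := hneg q j (by linarith)
      have := (grow' (fun i => - sh ψ τ q (i+(j+1)))
        (fun i => by simpa only [add_right_comm] using hneg q (i+(j+1))) 0 le_rfl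
        (by simp; linarith) (by
          have : 1 + (j+1) = j + 2 := by omega
          simp only [zero_add, this]; linarith) (N - j)).2
      have h3 : N - j + (j + 1) = N + 1 := by omega
      simp only [h3, hq0, zero_add] at this
      simp at this; linarith
  refine ⟨q, hq, fun j hj => ⟨nn _ (by omega), ?_⟩⟩
  by_contra hlt
  push Not at hlt
  have := (grow' (fun i => sh ψ τ q (i+j))
        (fun i => by simpa only [add_right_comm] using hpos q (i+j))
        (sh ψ τ q (j+1) - sh ψ τ q j) (by linarith)
        (by simpa using nn j (by omega)) (by
          have : 1 + j = j + 1 := by omega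
          simp only [zero_add, this]; linarith) (N + 1 - j)).2
  have h3 : N + 1 - j + j = N + 1 := by omega
  simp only [h3, hq0, zero_add] at this
  have h4 : (0:ℝ) < ((N + 1 - j : ℕ) : ℝ) := by exact_mod_cast (by omega : 0 < N + 1 - j)
  have := mul_pos h4 (sub_pos.2 hlt)
  have := nn j (by omega)
  linarith

structure Dec (ψ : ℕ → ℝ → ℝ) (τ : ℝ) (d : ℕ → ℝ) : Prop where
  zero : d 0 = τ
  rc : ∀ j, d (j+2) - 2 * d (j+1) + d j = ψ (j+1) (d (j+1))
  anti : ∀ j, d (j+1) ≤ d j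
  nonneg : ∀ j, 0 ≤ d j

lemma exists_dec (ψ : ℕ → ℝ → ℝ) (hc : ∀ j, Continuous (ψ j)) (hm : ∀ j, Monotone (ψ j))
    (h0 : ∀ j, ψ j 0 = 0) (τ : ℝ) (hτ : 0 ≤ τ) : ∃ d, Dec ψ τ d := by
  let K : ℕ → Set ℝ := fun N => {q | q ∈ Icc 0 τ ∧ ∀ j < N, 0 ≤ sh ψ τ q (j+1) ∧
    sh ψ τ q (j+1) ≤ sh ψ τ q j}
  have hcl : ∀ N, IsClosed (K N) := by
    intro N
    have : K N = Icc 0 τ ∩ ⋂ j, ⋂ (_ : j < N), ({q | 0 ≤ sh ψ τ q (j+1)} ∩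
      {q | sh ψ τ q (j+1) ≤ sh ψ τ q j}) := by
      ext q; simp [K]
    rw [this]
    refine isClosed_Icc.inter (isClosed_iInter fun j => isClosed_iInter fun _ => ?_)
    have := sh_cont ψ hc τ j
    exact (isClosed_le continuous_const this.2).inter (isClosed_le this.2 this.1)
  have hcomp : IsCompact (K 0) := isCompact_Icc.of_isClosed_subset (hcl 0) (fun q h => h.1)
  obtain ⟨q, hq⟩ := IsCompact.nonempty_iInter_of_sequence_nonempty_isCompact_isClosed K
    (fun N q h => ⟨h.1, fun j hj => h.2 j (by omega)⟩)
    (fun N => by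
      obtain ⟨q, h1, h2⟩ := sh_fin ψ hc hm h0 τ hτ N
      exact ⟨q, h1, h2⟩) hcomp hcl
  simp only [mem_iInter] at hq
  refine ⟨sh ψ τ q, ⟨rfl, fun j => by simp only [sh]; ring, fun j => ((hq (j+1)).2 j (by omega)).2,
    fun j => ?_⟩⟩
  cases j with
  | zero => simpa [sh]
  | succ j => exact ((hq (j+1)).2 j (by omega)).1

/-- comparison of two decreasing solutions -/
lemma dec_compare (ψ : ℕ → ℝ → ℝ) (hm : ∀ j, Monotone (ψ j)) {τ τ' : ℝ} {d d' : ℕ → ℝ}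
    (h : Dec ψ τ d) (h' : Dec ψ τ' d') (hle : τ ≤ τ') :
    d 1 ≤ d' 1 ∧ d' 1 - d 1 ≤ τ' - τ := by
  have bd : ∀ {τ} {d : ℕ → ℝ}, Dec ψ τ d → ∀ j, d j ≤ τ := by
    intro τ d h j
    induction j with
    | zero => exact h.zero.le
    | succ j ih => exact (h.anti j).trans ih
  constructor
  · by_contra hlt
    push Not at hlt
    have := fun j => (grow' (fun j => d (j+1) - d' (j+1)) (fun j hj => by
      have h1 := h.rc (j+1)
      have h2 := h'.rc (j+1)
      have h3 : ψ (j+2) (d' (j+2)) ≤ ψ (j+2) (d (j+2)) := hm _ (by simpa using hj)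
      simp only [add_assoc] at *; norm_num at *; linarith) (d 1 - d' 1) (by linarith) (by simp; linarith)
      (by
        have h1 := h.rc 0
        have h2 := h'.rc 0
        have h3 : ψ 1 (d' 1) ≤ ψ 1 (d 1) := hm _ hlt.le
        simp only [h.zero, h'.zero, zero_add] at *; norm_num at *; linarith) j).2
    obtain ⟨n, hn⟩ := exists_nat_gt (τ / (d 1 - d' 1))
    rw [div_lt_iff₀ (by linarith)] at hn
    have h1 := this n
    have h2 := bd h (n+1)
    have h3 := h'.nonneg (n+1)
    norm_num at h1
    linarith
  · by_contra hlt
    push Not at hlt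
    have := fun j => (grow' (fun j => d' j - d j) (fun j hj => by
      have h1 := h.rc j
      have h2 := h'.rc j
      have h3 : ψ (j+1) (d (j+1)) ≤ ψ (j+1) (d' (j+1)) := hm _ (by simpa using hj)
      linarith) (d' 1 - d 1 - (τ' - τ)) (by linarith) (by simp [h.zero, h'.zero]; linarith)
      (by simp [h.zero, h'.zero]) j).2
    obtain ⟨n, hn⟩ := exists_nat_gt (τ' / (d' 1 - d 1 - (τ' - τ)))
    rw [div_lt_iff₀ (by linarith)] at hn
    have h1 := this n
    have h2 := bd h' n
    have h3 := h.nonneg n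
    simp only [h.zero, h'.zero] at h1
    linarith

end LTM

namespace LTM
variable {φ : ℝ → ℝ}

structure Cst (φ : ℝ → ℝ) (ε c q : ℝ) : Prop where
  εpos : 0 < ε
  εlt : ε < 1/2
  cpos : 0 < c
  low : ∀ a b, ε/2 ≤ a → a ≤ b → b ≤ 1 - ε/2 → c * (b - a) ≤ φ b - φ a
  qd : q * (1 + 2 * c) = 1

lemma Cst.qpos {ε c q} (h : Cst φ ε c q) : 0 < q := by
  have := h.cpos
  by_contra hq
  push Not at hq
  nlinarith [h.qd, mul_nonneg (neg_nonneg.2 hq) (by linarith : 0 ≤ 1 + 2 * c)]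

lemma Cst.qlt {ε c q} (h : Cst φ ε c q) : q < 1 := by
  have := h.cpos
  nlinarith [h.qd, mul_pos h.qpos this]

open Classical in
noncomputable def vis (φ : ℝ → ℝ) (ε : ℝ) : ℕ → ℝ × ℝ → ℕ
  | 0, _ => 0
  | (n+1), x => vis φ ε n x + if tt φ (n+1) x ∈ Icc ε (1-ε) then 1 else 0

def good (φ : ℝ → ℝ) (ε q σ r : ℝ) (x : ℝ × ℝ) : Prop :=
  ∀ n, tt φ (n+1) x + σ * (r * q ^ vis φ ε (n+1) x) ∈ Ioo (0:ℝ) 1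

noncomputable def psi (φ : ℝ → ℝ) (σ : ℝ) (x : ℝ × ℝ) (j : ℕ) (d : ℝ) : ℝ :=
  2 * σ * (φ (tt φ j x + σ * d) - φ (tt φ j x))

lemma psi_mono (h : Hyp φ) {σ : ℝ} (hσ : σ = 1 ∨ σ = -1) (x : ℝ × ℝ) (j : ℕ) : Monotone (psi φ σ x j) := by
  intro a b hab
  unfold psi
  rcases hσ with rfl | rfl
  · have := h.mono (by linarith : tt φ j x + 1 * a ≤ tt φ j x + 1 * b); linarith
  · have := h.mono (by linarith : tt φ j x + -1 * b ≤ tt φ j x + -1 * a); linarith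

lemma exists_leaf (h : Hyp φ) {σ : ℝ} (hσ : σ = 1 ∨ σ = -1) (x : ℝ × ℝ) {τ : ℝ} (hτ : 0 ≤ τ) :
    ∃ d, Dec (psi φ σ x) τ d := by
  refine exists_dec _ (fun j => ?_) (psi_mono h hσ x) (fun j => by simp [psi]) τ hτ
  unfold psi
  have := h.cont
  fun_prop

lemma leaf_slope {σ : ℝ} {x : ℝ × ℝ} {τ : ℝ} {d : ℕ → ℝ}
    (hd : Dec (psi φ σ x) τ d) (j : ℕ) : psi φ σ x (j+1) (d (j+1)) ≤ d j - d (j+1) := by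
  have := hd.rc j; have := hd.anti (j+1); linarith

lemma dec_le {ψ : ℕ → ℝ → ℝ} {τ : ℝ} {d : ℕ → ℝ} (hd : Dec ψ τ d) (j : ℕ) : d j ≤ τ := by
  induction j with
  | zero => exact hd.zero.le
  | succ j ih => exact (hd.anti j).trans ih

lemma contr {ε c q : ℝ} (hc : Cst φ ε c q) {σ : ℝ} (hσ : σ = 1 ∨ σ = -1)
    {x : ℝ × ℝ} {τ : ℝ} {d : ℕ → ℝ} (hd : Dec (psi φ σ x) τ d) (hτ : τ ≤ ε / 2) (n : ℕ) :
    d n ≤ τ * q ^ vis φ ε n x := by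
  induction n with
  | zero => simp [vis, hd.zero]
  | succ n ih =>
    rw [vis]
    split_ifs with hU
    · have h1 := leaf_slope hd n
      have h2 := (dec_le hd (n+1)).trans hτ
      have h3 := hd.nonneg (n+1)
      have h4 : 2 * c * d (n+1) ≤ psi φ σ x (n+1) (d (n+1)) := by
        unfold psi
        rcases hσ with rfl | rfl
        · have := hc.low (tt φ (n+1) x) (tt φ (n+1) x + 1 * d (n+1)) (by linarith [hU.1, hc.εpos])
            (by linarith) (by linarith [hU.2])
          nlinarith
        · have := hc.low (tt φ (n+1) x + -1 * d (n+1)) (tt φ (n+1) x) (by linarith [hU.1])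
            (by linarith) (by linarith [hU.2, hc.εpos])
          nlinarith
      have h5 : d (n+1) = q * ((1 + 2 * c) * d (n+1)) := by rw [← mul_assoc, hc.qd, one_mul]
      calc d (n+1) = q * ((1 + 2 * c) * d (n+1)) := h5
        _ ≤ q * (τ * q ^ vis φ ε n x) := mul_le_mul_of_nonneg_left (by linarith) hc.qpos.le
        _ = _ := by ring
    · exact (hd.anti n).trans ih

lemma good_mem {ε c q : ℝ} (hc : Cst φ ε c q) {σ : ℝ} (hσ : σ = 1 ∨ σ = -1) {r : ℝ} (hr : r ≤ ε / 2)
    {x : ℝ × ℝ} (hg : good φ ε q σ r x) {τ : ℝ} {d : ℕ → ℝ} (hd : Dec (psi φ σ x) τ d) (hτ : τ ≤ r)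
    (n : ℕ) : tt φ (n+1) x + σ * d (n+1) ∈ Ico (0:ℝ) 1 := by
  have h1 := contr hc hσ hd (hτ.trans hr) (n+1)
  have h2 := hd.nonneg (n+1)
  have h3 := hg n
  have h4 := tt_nonneg (φ := φ) n x
  have h5 := tt_lt (φ := φ) n x
  have h6 : d (n+1) ≤ r * q ^ vis φ ε (n+1) x :=
    h1.trans (mul_le_mul_of_nonneg_right hτ (pow_nonneg hc.qpos.le _))
  rcases hσ with rfl | rfl
  · exact ⟨by linarith, by linarith [h3.2]⟩
  · exact ⟨by linarith [h3.1], by linarith⟩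

noncomputable def lpt (σ : ℝ) (x : ℝ × ℝ) (τ d1 : ℝ) : ℝ × ℝ := (x.1 + σ * τ, x.2 - σ * (τ - d1) / 2)

lemma leaf_orbit {σ : ℝ} (hσ : σ = 1 ∨ σ = -1)
    {x : ℝ × ℝ} {τ : ℝ} {d : ℕ → ℝ} (hd : Dec (psi φ σ x) τ d)
    (hm : ∀ n, tt φ (n+1) x + σ * d (n+1) ∈ Ico (0:ℝ) 1) (n : ℕ) :
    tt φ n (lpt σ x τ (d 1)) = tt φ n x + σ * d n ∧
    ww φ n (lpt σ x τ (d 1)) = ww φ n x - σ * (d n - d (n+1)) / 2 := by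
  induction n with
  | zero => simp [lpt, hd.zero]
  | succ n ih =>
    have hσ2 : σ * σ = 1 := by rcases hσ with rfl | rfl <;> norm_num
    have e1 : tt φ (n+1) (lpt σ x τ (d 1)) = tt φ (n+1) x + σ * d (n+1) := by
      rw [tt_succ, ih.1, ih.2, Int.fract_eq_iff]
      refine ⟨(hm n).1, (hm n).2, ⌊tt φ n x + 2 * ww φ n x⌋, ?_⟩
      rw [tt_succ, ← Int.self_sub_floor]; ring
    refine ⟨e1, ?_⟩
    rw [ww_succ, e1, ih.2, ww_succ]
    have h1 := hd.rc n
    unfold psi at h1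
    have : σ * (d (n+2) - 2 * d (n+1) + d n) / 2 = φ (tt φ (n+1) x + σ * d (n+1)) - φ (tt φ (n+1) x) := by
      rw [h1]; linear_combination (φ (tt φ (n+1) x + σ * d (n+1)) - φ (tt φ (n+1) x)) * hσ2
    linear_combination -this

lemma incr (h : Hyp φ) {η : ℝ} (hη : 0 < η) : ∃ κ > 0, ∀ a b, a ∈ Icc (0:ℝ) 1 → b ∈ Icc (0:ℝ) 1 →
    η ≤ b - a → κ ≤ φ b - φ a := by
  obtain ⟨c, hc, hl⟩ := h.low (η/4) (by linarith)
  refine ⟨c * (η / 2), by positivity, fun a b ha hb hab => ?_⟩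
  have h1 := hl (max a (η/4)) (min b (1 - η/4)) (le_max_right _ _) (by
    have := ha.1; have := ha.2; have := hb.1; have := hb.2
    refine max_le (le_min ?_ ?_) (le_min ?_ ?_) <;> linarith) (min_le_right _ _)
  have h2 := h.mono (min_le_left b (1-η/4))
  have h3 := h.mono (le_max_left a (η/4))
  have h4 : η / 2 ≤ min b (1 - η/4) - max a (η/4) := by
    have := ha.1; have := ha.2; have := hb.1; have := hb.2
    rcases max_cases a (η/4) with ⟨e, _⟩ | ⟨e, _⟩ <;> rcases min_cases b (1-η/4) with ⟨e', _⟩ | ⟨e', _⟩ <;>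
      rw [e, e'] <;> linarith
  have := mul_le_mul_of_nonneg_left h4 hc.le
  linarith

lemma unif_rate (h : Hyp φ) {η : ℝ} (hη : 0 < η) : ∃ m : ℕ, ∀ (σ : ℝ) (x : ℝ × ℝ) (τ : ℝ) (d : ℕ → ℝ),
    (σ = 1 ∨ σ = -1) → τ ≤ 1 → Dec (psi φ σ x) τ d →
    (∀ n, tt φ (n+1) x + σ * d (n+1) ∈ Ico (0:ℝ) 1) → ∀ n, m ≤ n → d n < η := by
  obtain ⟨κ, hκ, hi⟩ := incr h hη
  obtain ⟨m, hm⟩ := exists_nat_gt (1 / κ)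
  rw [div_lt_iff₀ hκ] at hm
  refine ⟨m, fun σ x τ d hσ hτ hd hmem n hn => ?_⟩
  by_contra hlt
  push Not at hlt
  have ha : Antitone d := antitone_nat_of_succ_le hd.anti
  have hψ : ∀ j, j < m → κ ≤ psi φ σ x (j+1) (d (j+1)) := by
    intro j hj
    have h1 : η ≤ d (j+1) := hlt.trans (ha (by omega))
    have h2 := hmem j
    have h3 := tt_nonneg (φ := φ) j x
    have h4 := tt_lt (φ := φ) j x
    unfold psi
    rcases hσ with rfl | rfl
    · have := hi _ _ ⟨h3, h4.le⟩ ⟨h2.1, h2.2.le⟩ (by linarith); linarith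
    · have := hi _ _ ⟨h2.1, h2.2.le⟩ ⟨h3, h4.le⟩ (by linarith); linarith
  have key : ∀ j, j ≤ m → j * κ + (d j - d (j+1)) ≤ d 0 - d 1 := by
    intro j
    induction j with
    | zero => intro _; simp
    | succ j ih =>
      intro hj
      have := ih (by omega)
      have := hψ j (by omega)
      have := hd.rc j
      push_cast; linarith
  have := key m le_rfl
  have := hd.anti m
  have := hd.nonneg 1
  have := hd.zero
  linarith

/-- abstract distortion estimate -/
lemma distort (u v c c' ε : ℕ → ℝ) (n : ℕ) (hu0 : u 0 = 0) (hv0 : v 0 = 0) (hu1 : u 1 = 1) (hv1 : v 1 = 1)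
    (hc : ∀ j, 0 ≤ c j) (hε : ∀ j, 0 ≤ ε j)
    (hcc : ∀ j, j + 1 < n → c' (j+1) ≤ c (j+1) + ε (j+1))
    (hu : ∀ j, j + 1 < n → u (j+2) - 2 * u (j+1) + u j = c (j+1) * u (j+1))
    (hv : ∀ j, j + 1 < n → v (j+2) - 2 * v (j+1) + v j = c' (j+1) * v (j+1))
    (hvp : ∀ j, j + 1 ≤ n → 0 ≤ v (j+1)) :
    ∀ k, k + 1 ≤ n → v (k+1) ≤ (∏ i ∈ Finset.range k, (1 + (i+1) * ε (i+1))) * u (k+1) ∧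
      v (k+1) - v k ≤ (∏ i ∈ Finset.range k, (1 + (i+1) * ε (i+1))) * (u (k+1) - u k) ∧
      u (k+1) ≤ (k+1) * (u (k+1) - u k) ∧ 0 < u (k+1) := by
  intro k
  induction k with
  | zero => intro _; simp [hu0, hv0, hu1, hv1]
  | succ k ih =>
    intro hk
    obtain ⟨h1, h2, h3, h4⟩ := ih (by omega)
    set P := ∏ i ∈ Finset.range k, (1 + ((i:ℝ)+1) * ε (i+1)) with hP
    have hPp : 0 ≤ P := Finset.prod_nonneg fun i _ => by have := hε (i+1); positivity
    rw [Finset.prod_range_succ, ← hP]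
    have e1 := hu k (by omega)
    have e2 := hv k (by omega)
    have e3 := hcc k (by omega)
    have hk0 := hε (k+1)
    have hD : u (k+1) - u k ≤ u (k+2) - u (k+1) := by
      have := mul_nonneg (hc (k+1)) h4.le; linarith
    have hDp : 0 < u (k+2) - u (k+1) := by
      have : 0 < u (k+1) - u k := by
        by_contra hh; push Not at hh
        have : ((k:ℝ)+1) * (u (k+1) - u k) ≤ 0 := mul_nonpos_of_nonneg_of_nonpos (by positivity) hh
        linarith
      linarith
    have hu' : u (k+1) ≤ (k+1) * (u (k+2) - u (k+1)) :=
      h3.trans (mul_le_mul_of_nonneg_left hD (by positivity))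
    have hPP : P ≤ P * (1 + ((k:ℝ)+1) * ε (k+1)) := by
      have : 0 ≤ P * (((k:ℝ)+1) * ε (k+1)) := by positivity
      linarith
    have hDv : v (k+2) - v (k+1) ≤ P * (1 + ((k:ℝ)+1) * ε (k+1)) * (u (k+2) - u (k+1)) := by
      have a1 : c' (k+1) * v (k+1) ≤ (c (k+1) + ε (k+1)) * (P * u (k+1)) :=
        (mul_le_mul_of_nonneg_right e3 (hvp k (by omega))).trans
          (mul_le_mul_of_nonneg_left h1 (add_nonneg (hc _) hk0))
      have a2 : P * (ε (k+1) * u (k+1)) ≤ P * (ε (k+1) * ((k+1) * (u (k+2) - u (k+1)))) := by gcongr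
      calc v (k+2) - v (k+1) = (v (k+1) - v k) + c' (k+1) * v (k+1) := by linarith
        _ ≤ P * (u (k+1) - u k) + (c (k+1) + ε (k+1)) * (P * u (k+1)) := by linarith
        _ = P * (u (k+2) - u (k+1)) + P * (ε (k+1) * u (k+1)) := by linear_combination -P * e1
        _ ≤ P * (u (k+2) - u (k+1)) + P * (ε (k+1) * ((k+1) * (u (k+2) - u (k+1)))) := by linarith
        _ = _ := by ring
    refine ⟨?_, hDv, ?_, by linarith⟩
    · have := mul_le_mul_of_nonneg_right hPP h4.le
      have e : k + 1 + 1 = k + 2 := rfl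
      rw [e]; linarith
    · have e : k + 1 + 1 = k + 2 := rfl
      rw [e]; push_cast; linarith

end LTM

namespace LTM
variable {φ : ℝ → ℝ}

noncomputable def bb (φ : ℝ → ℝ) (n : ℕ) (x : ℝ × ℝ) : ℝ := tt φ n x + 2 * ww φ n x
noncomputable def ee (φ : ℝ → ℝ) (x y : ℝ × ℝ) : ℕ → ℝ
  | 0 => y.1 - x.1
  | (n+1) => bb φ n y - bb φ n x

lemma tt_bb (n : ℕ) (x : ℝ × ℝ) : tt φ (n+1) x = bb φ n x - ⌊bb φ n x⌋ := by
  rw [tt_succ, ← Int.self_sub_floor]; rfl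
lemma bb_succ (n : ℕ) (x : ℝ × ℝ) :
    bb φ (n+1) x = tt φ (n+1) x + bb φ n x - tt φ n x + 2 * φ (tt φ (n+1) x) := by
  unfold bb; rw [ww_succ]; ring
lemma ee_rec {x y : ℝ × ℝ} {j : ℕ} (h0 : tt φ j y - tt φ j x = ee φ x y j)
    (h1 : tt φ (j+1) y - tt φ (j+1) x = ee φ x y (j+1)) :
    ee φ x y (j+2) - 2 * ee φ x y (j+1) + ee φ x y j = 2 * (φ (tt φ (j+1) y) - φ (tt φ (j+1) x)) := by
  have : ee φ x y (j+2) = bb φ (j+1) y - bb φ (j+1) x := rfl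
  rw [this, bb_succ, bb_succ]
  have : ee φ x y (j+1) = bb φ j y - bb φ j x := rfl
  linarith
lemma ee_tt (x y : ℝ × ℝ) (j : ℕ) : tt φ (j+1) y - tt φ (j+1) x =
    ee φ x y (j+1) - ((⌊bb φ j y⌋ - ⌊bb φ j x⌋ : ℤ) : ℝ) := by
  rw [tt_bb, tt_bb]; push_cast; simp only [ee]; ring

/-- growth while the itineraries agree -/
lemma ee_grow (h : Hyp φ) {x y : ℝ × ℝ} (hx : x.1 = y.1) (hw : x.2 ≤ y.2) (n : ℕ)
    (hs : ∀ j < n, tt φ j y - tt φ j x = ee φ x y j) :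
    ∀ j, j + 1 ≤ n → ee φ x y j + 2 * (y.2 - x.2) ≤ ee φ x y (j+1) ∧ j * (2 * (y.2 - x.2)) ≤ ee φ x y j := by
  intro j hj
  have := grow (ee φ x y) n (fun j hj hp => by
    have := ee_rec (hs j (by omega)) (hs (j+1) (by omega))
    have h2 : φ (tt φ (j+1) x) ≤ φ (tt φ (j+1) y) := h.mono (by have := hs (j+1) (by omega); linarith)
    linarith) (2 * (y.2 - x.2)) (by linarith) (by simp [ee, hx]) (by simp [ee, bb, hx]; linarith) j hj
  have e0 : ee φ x y 0 = 0 := by simp [ee, hx]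
  rw [e0] at this
  exact ⟨this.1, by linarith [this.2]⟩

lemma exists_sep (h : Hyp φ) {x y : ℝ × ℝ} (hx : x.1 = y.1) (hw : x.2 < y.2) :
    ∃ n, tt φ n y - tt φ n x ≠ ee φ x y n := by
  by_contra hcon
  push Not at hcon
  obtain ⟨n, hn⟩ := exists_nat_gt (1 / (2 * (y.2 - x.2)))
  rw [div_lt_iff₀ (by linarith)] at hn
  have h1 := (ee_grow h hx hw.le (n+2) (fun j _ => hcon j) (n+1) (by omega)).2
  have h2 := hcon (n+1)
  have h3 := tt_nonneg (φ := φ) n x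
  have h4 := tt_lt (φ := φ) n y
  push_cast at h1
  nlinarith

/-- first separation time -/
lemma first_sep (h : Hyp φ) {x y : ℝ × ℝ} (hx : x.1 = y.1) (hw : x.2 < y.2) :
    ∃ n : ℕ, (∀ j < n + 1, tt φ j y - tt φ j x = ee φ x y j) ∧
      2 * (y.2 - x.2) ≤ ee φ x y (n+1) ∧
      tt φ (n+1) y - tt φ (n+1) x ≤ ee φ x y (n+1) - 1 := by
  classical
  have hex := exists_sep h hx hw
  obtain ⟨m, hm, hmin⟩ : ∃ m, tt φ m y - tt φ m x ≠ ee φ x y m ∧ ∀ j < m, tt φ j y - tt φ j x = ee φ x y j :=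
    ⟨Nat.find hex, Nat.find_spec hex, fun j hj => not_not.1 (Nat.find_min hex hj)⟩
  cases m with
  | zero => simp [ee, hx] at hm
  | succ n =>
    have hg := ee_grow h hx hw.le (n+1) hmin n le_rfl
    have hp : 0 ≤ (n:ℝ) * (2 * (y.2 - x.2)) := by
      have : 0 < y.2 - x.2 := by linarith
      positivity
    refine ⟨n, hmin, by linarith, ?_⟩
    rw [ee_tt] at hm ⊢
    have hne : ⌊bb φ n y⌋ - ⌊bb φ n x⌋ ≠ 0 := fun h0 => hm (by rw [h0]; simp)
    have hle : ⌊bb φ n x⌋ ≤ ⌊bb φ n y⌋ := Int.floor_mono (by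
      have : ee φ x y (n+1) = bb φ n y - bb φ n x := rfl
      linarith)
    have : (1:ℤ) ≤ ⌊bb φ n y⌋ - ⌊bb φ n x⌋ := by omega
    have : (1:ℝ) ≤ ((⌊bb φ n y⌋ - ⌊bb φ n x⌋ : ℤ) : ℝ) := by exact_mod_cast this
    linarith

/-- absolute continuity (gap lemma) -/
lemma gap {ε c q : ℝ} (h : Hyp φ) (hc : Cst φ ε c q) {L : ℝ} (hL0 : 0 ≤ L)
    (hL : ∀ a b a' b', a ∈ Icc (0:ℝ) 1 → b ∈ Icc (0:ℝ) 1 → a' ∈ Icc (0:ℝ) 1 →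
      b' ∈ Icc (0:ℝ) 1 → a < b → a' < b' →
      (φ b' - φ a') / (b' - a') ≤ (φ b - φ a) / (b - a) + L * (|a - a'| + |b - b'|))
    {σ : ℝ} (hσ : σ = 1 ∨ σ = -1) {r : ℝ} (hr0 : 0 < r) (hr : r ≤ ε / 2) {κ : ℝ}
    {x y : ℝ × ℝ} (hxy : x.1 = y.1) (hw : x.2 < y.2)
    (gx : good φ ε q σ r x) (gy : good φ ε q σ r y)
    (Dx : ∀ n : ℕ, ∑ j ∈ Finset.range n, (j:ℝ) * q ^ vis φ ε j x ≤ κ)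
    (Dy : ∀ n : ℕ, ∑ j ∈ Finset.range n, (j:ℝ) * q ^ vis φ ε j y ≤ κ)
    {τ : ℝ} (hτ : τ ≤ r / 2) {d d' : ℕ → ℝ} (hd : Dec (psi φ σ x) τ d) (hd' : Dec (psi φ σ y) τ d') :
    y.2 - x.2 ≤ 2 * Real.exp (2 * L * κ) * ((lpt σ y τ (d' 1)).2 - (lpt σ x τ (d 1)).2) := by
  have hτ0 : 0 ≤ τ := hd.zero ▸ hd.nonneg 0
  obtain ⟨n, hsame, hpos1, hsep⟩ := first_sep h hxy hw
  set e := ee φ x y with he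
  set e' : ℕ → ℝ := fun j => e j + σ * (d' j - d j) with he'
  have hmx := good_mem hc hσ hr gx hd (by linarith)
  have hmy := good_mem hc hσ hr gy hd' (by linarith)
  have hqn : ∀ k : ℕ, 0 < q ^ k := fun k => pow_pos hc.qpos k
  -- room at time n+1
  have hroom : e (n+1) ≤ 2 * e' (n+1) := by
    have h1 := contr hc hσ hd (by linarith) (n+1)
    have h2 := contr hc hσ hd' (by linarith) (n+1)
    have h1' := mul_le_mul_of_nonneg_right hτ (hqn (vis φ ε (n+1) x)).le
    have h2' := mul_le_mul_of_nonneg_right hτ (hqn (vis φ ε (n+1) y)).le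
    have h3 := hd.nonneg (n+1)
    have h4 := hd'.nonneg (n+1)
    have h5 := gx n
    have h6 := gy n
    have h7 := tt_nonneg (φ := φ) n y
    have h8 := tt_lt (φ := φ) n x
    simp only [he']
    rcases hσ with rfl | rfl
    · have := h5.2; linarith
    · have := h6.1; linarith
  have hen : 0 < e (n+1) := by linarith
  have e0 : e 0 = 0 := by simp [he, ee, hxy]
  have e0' : e' 0 = 0 := by simp [he', e0, hd.zero, hd'.zero]
  have e1 : e 1 = 2 * (y.2 - x.2) := by simp [he, ee, bb, hxy]; ring
  have e1' : e' 1 = 2 * ((lpt σ y τ (d' 1)).2 - (lpt σ x τ (d 1)).2) := by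
    simp only [he', e1, lpt]; ring
  have hrec : ∀ j, j < n → e (j+2) - 2 * e (j+1) + e j = 2 * (φ (tt φ (j+1) y) - φ (tt φ (j+1) x)) :=
    fun j hj => ee_rec (hsame j (by omega)) (hsame (j+1) (by omega))
  have hσ2 : σ * σ = 1 := by rcases hσ with rfl | rfl <;> norm_num
  have hrec' : ∀ j, j < n → e' (j+2) - 2 * e' (j+1) + e' j =
      2 * (φ (tt φ (j+1) y + σ * d' (j+1)) - φ (tt φ (j+1) x + σ * d (j+1))) := by
    intro j hj
    have a1 := hrec j hj
    have a2 := hd.rc j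
    have a3 := hd'.rc j
    unfold psi at a2 a3
    simp only [he']
    linear_combination a1 + σ * a3 - σ * a2 + (2 * (φ (tt φ (j+1) y + σ * d' (j+1)) - φ (tt φ (j+1) y))
      - 2 * (φ (tt φ (j+1) x + σ * d (j+1)) - φ (tt φ (j+1) x))) * hσ2
  have hdiff : ∀ j, j < n → (tt φ (j+1) y + σ * d' (j+1)) - (tt φ (j+1) x + σ * d (j+1)) = e' (j+1) := by
    intro j hj
    have := hsame (j+1) (by omega)
    simp only [he']; linarith
  have epos : ∀ j, j ≤ n → 0 < e (j+1) := by
    intro j hj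
    have h1 := ee_grow h hxy hw.le (n+1) hsame j (by omega)
    have hp : 0 ≤ (j:ℝ) * (2 * (y.2 - x.2)) := by
      have : 0 < y.2 - x.2 := by linarith
      positivity
    linarith [h1.1, h1.2]
  have e1pos' : 0 < e' 1 := by
    by_contra hneg
    push Not at hneg
    have := grow (fun j => - e' j) (n+2) (fun j hj hp => by
      rcases Nat.lt_or_ge j n with hjn | hjn
      · have a1 := hrec' j hjn
        have a2 := h.mono (by have := hdiff j hjn; linarith :
          (tt φ (j+1) y + σ * d' (j+1)) ≤ (tt φ (j+1) x + σ * d (j+1)))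
        linarith
      · have : j = n := by omega
        subst this; linarith) 0 le_rfl (by simp [e0']) (by simp [e0']; linarith) (n+1) (by omega)
    have := this.2
    rw [e0'] at this
    linarith
  have epos' : ∀ j, j ≤ n → 0 < e' (j+1) := by
    intro j hj
    have := grow e' (n+1) (fun j hj hp => by
      have a1 := hrec' j (by omega)
      have a2 := h.mono (by have := hdiff j (by omega); linarith :
          (tt φ (j+1) x + σ * d (j+1)) ≤ (tt φ (j+1) y + σ * d' (j+1)))
      linarith) (e' 1) e1pos'.le (by simp [e0']) (by simp [e0']) j (by omega)
    have hp : 0 ≤ (j:ℝ) * e' 1 := by positivity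
    linarith [this.1, this.2]
  have e1pos : 0 < e 1 := epos 0 (by omega)
  let C : ℕ → ℝ := fun j => max 0 (2 * (φ (tt φ j y) - φ (tt φ j x)) / e j)
  let C' : ℕ → ℝ := fun j => 2 * (φ (tt φ j y + σ * d' j) - φ (tt φ j x + σ * d j)) / e' j
  let E : ℕ → ℝ := fun j => 2 * L * (d j + d' j)
  have hE0 : ∀ j, 0 ≤ E j := fun j => by
    have := hd.nonneg j; have := hd'.nonneg j
    simp only [E]; positivity
  have hCe : ∀ j, j < n → C (j+1) = 2 * (φ (tt φ (j+1) y) - φ (tt φ (j+1) x)) / e (j+1) := by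
    intro j hj
    refine max_eq_right (div_nonneg ?_ (epos j hj.le).le)
    have := h.mono (by have := hsame (j+1) (by omega); have := epos j hj.le; linarith :
      tt φ (j+1) x ≤ tt φ (j+1) y)
    linarith
  have main := (distort (fun j => e j / e 1) (fun j => e' j / e' 1) C C' E (n+1) (by simp [e0]) (by simp [e0'])
    (div_self e1pos.ne') (div_self e1pos'.ne') (fun j => le_max_left _ _) hE0 (by
      intro j hj
      rw [hCe j (by omega)]
      have a1 := hsame (j+1) (by omega)
      have a2 := hdiff j (by omega)
      have a3 := epos j (by omega)
      have a4 := epos' j (by omega)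
      have := hL (tt φ (j+1) x) (tt φ (j+1) y) (tt φ (j+1) x + σ * d (j+1)) (tt φ (j+1) y + σ * d' (j+1))
        ⟨tt_nonneg _ _, (tt_lt _ _).le⟩ ⟨tt_nonneg _ _, (tt_lt _ _).le⟩
        ⟨(hmx j).1, (hmx j).2.le⟩ ⟨(hmy j).1, (hmy j).2.le⟩ (by linarith) (by linarith)
      rw [a1, a2] at this
      have b1 : |tt φ (j+1) x - (tt φ (j+1) x + σ * d (j+1))| = d (j+1) := by
        have : tt φ (j+1) x - (tt φ (j+1) x + σ * d (j+1)) = -(σ * d (j+1)) := by ring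
        rw [this, abs_neg, abs_mul, abs_of_nonneg (hd.nonneg (j+1))]
        rcases hσ with rfl | rfl <;> norm_num
      have b2 : |tt φ (j+1) y - (tt φ (j+1) y + σ * d' (j+1))| = d' (j+1) := by
        have : tt φ (j+1) y - (tt φ (j+1) y + σ * d' (j+1)) = -(σ * d' (j+1)) := by ring
        rw [this, abs_neg, abs_mul, abs_of_nonneg (hd'.nonneg (j+1))]
        rcases hσ with rfl | rfl <;> norm_num
      rw [b1, b2] at this
      simp only [C', E, mul_div_assoc]
      linarith) (by
      intro j hj
      have a3 := epos j (by omega)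
      rw [hCe j (by omega)]
      have := hrec j (by omega)
      field_simp
      linarith) (by
      intro j hj
      have a3 := epos' j (by omega)
      have := hrec' j (by omega)
      simp only [C']
      field_simp
      linarith) (by
      intro j hj
      exact div_nonneg (epos' j (by omega)).le e1pos'.le) n le_rfl).1
  -- bound product
  have hP : (∏ i ∈ Finset.range n, (1 + ((i:ℝ)+1) * E (i+1))) ≤ Real.exp (2 * L * κ) := by
    calc (∏ i ∈ Finset.range n, (1 + ((i:ℝ)+1) * E (i+1)))
        ≤ ∏ i ∈ Finset.range n, Real.exp (((i:ℝ)+1) * E (i+1)) := by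
          refine Finset.prod_le_prod (fun i _ => ?_) (fun i _ => ?_)
          · have := hE0 (i+1); positivity
          · rw [add_comm]; exact Real.add_one_le_exp _
      _ = Real.exp (∑ i ∈ Finset.range n, ((i:ℝ)+1) * E (i+1)) := (Real.exp_sum _ _).symm
      _ ≤ _ := by
        rw [Real.exp_le_exp]
        have hb : ∀ i ∈ Finset.range n, ((i:ℝ)+1) * E (i+1) ≤
            L * (((i+1 : ℕ):ℝ) * q ^ vis φ ε (i+1) x) + L * (((i+1 : ℕ):ℝ) * q ^ vis φ ε (i+1) y) := by
          intro i _
          have h1 := contr hc hσ hd (by linarith) (i+1)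
          have h2 := contr hc hσ hd' (by linarith) (i+1)
          have ht : τ ≤ 1/2 := by linarith [hc.εlt]
          have h3 := mul_le_mul_of_nonneg_right ht (hqn (vis φ ε (i+1) x)).le
          have h4 := mul_le_mul_of_nonneg_right ht (hqn (vis φ ε (i+1) y)).le
          have h5 : 2 * (d (i+1) + d' (i+1)) ≤ q ^ vis φ ε (i+1) x + q ^ vis φ ε (i+1) y := by linarith
          have := mul_le_mul_of_nonneg_left h5 (by positivity : 0 ≤ L * ((i:ℝ)+1))
          simp only [E]; push_cast
          linarith
        refine (Finset.sum_le_sum hb).trans ?_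
        rw [Finset.sum_add_distrib, ← Finset.mul_sum, ← Finset.mul_sum]
        have f1 := Dx (n+1)
        have f2 := Dy (n+1)
        rw [Finset.sum_range_succ'] at f1 f2
        simp only [Nat.cast_zero, zero_mul, add_zero] at f1 f2
        have := mul_le_mul_of_nonneg_left f1 hL0
        have := mul_le_mul_of_nonneg_left f2 hL0
        linarith
  have hfin : e 1 ≤ 2 * Real.exp (2 * L * κ) * e' 1 := by
    have h1 : e' (n+1) / e' 1 ≤ Real.exp (2 * L * κ) * (e (n+1) / e 1) :=
      main.trans (mul_le_mul_of_nonneg_right hP (div_nonneg hen.le e1pos.le))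
    have h2 : Real.exp (2 * L * κ) * (e (n+1) / e 1) ≤ Real.exp (2 * L * κ) * ((2 * e' (n+1)) / e 1) := by
      gcongr
    have h3 := h1.trans h2
    have h4 := epos' n le_rfl
    rw [← mul_div_assoc, div_le_div_iff₀ e1pos' e1pos] at h3
    have : e' (n+1) * e 1 ≤ e' (n+1) * (2 * Real.exp (2 * L * κ) * e' 1) := by linarith
    exact le_of_mul_le_mul_left this h4
  rw [e1, e1'] at hfin
  linarith

end LTM

open scoped ENNReal

namespace LTM
variable {φ : ℝ → ℝ}

noncomputable def nu : Measure ℝ := volume.restrict (Ico (0:ℝ) 1)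
noncomputable def mu : Measure (ℝ × ℝ) := nu.prod nu

instance : IsProbabilityMeasure nu := ⟨by simp [nu]⟩
instance : IsProbabilityMeasure mu := by unfold mu; infer_instance

lemma nu_Ioc : nu = volume.restrict (Ioc (0:ℝ) (0+1)) := by
  rw [nu, zero_add]; exact Measure.restrict_congr_set Ico_ae_eq_Ioc

lemma per_Ioc (f : ℝ → ℝ≥0∞) (hp : ∀ x, f (x+1) = f x) (a b : ℝ) :
    ∫⁻ x in Ioc a (a+1), f x = ∫⁻ x in Ioc b (b+1), f x := by
  refine (isAddFundamentalDomain_Ioc (one_pos : (0:ℝ) < 1) a).setLIntegral_eq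
    (isAddFundamentalDomain_Ioc one_pos b) f ?_
  rintro ⟨g, hg⟩ x
  obtain ⟨n, rfl⟩ := AddSubgroup.mem_zmultiples_iff.1 hg
  have : Function.Periodic f 1 := hp
  have h2 := (this.int_mul n) x
  simp only [mul_one] at h2
  change f (n • (1:ℝ) + x) = f x
  rw [zsmul_one, add_comm, h2]

lemma nu_shift (f : ℝ → ℝ≥0∞) (hp : ∀ x, f (x+1) = f x) (a : ℝ) :
    ∫⁻ x, f (x + a) ∂nu = ∫⁻ x, f x ∂nu := by
  rw [nu_Ioc]
  have h1 : ∫⁻ x in Ioc (0:ℝ) (0+1), f (x + a) = ∫⁻ x in Ioc a (a+1), f x := by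
    rw [← lintegral_indicator measurableSet_Ioc, ← lintegral_indicator measurableSet_Ioc,
      ← lintegral_add_right_eq_self (fun x => (Ioc a (a+1)).indicator f x) a]
    congr 1; ext x
    simp only [indicator, mem_Ioc]
    congr 1
    simp only [eq_iff_iff]
    constructor <;> rintro ⟨h1, h2⟩ <;> constructor <;> linarith
  rw [h1, per_Ioc f hp a 0]

lemma nu_refl (f : ℝ → ℝ≥0∞) (hp : ∀ x, f (x+1) = f x) (a : ℝ) :
    ∫⁻ x, f (a - x) ∂nu = ∫⁻ x, f x ∂nu := by
  have h1 : ∫⁻ x, f (a - x) ∂nu = ∫⁻ x in Ioc (a-1) (a-1+1), f x := by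
    rw [nu, ← lintegral_indicator measurableSet_Ico, ← lintegral_indicator measurableSet_Ioc,
      ← lintegral_sub_left_eq_self (fun x => (Ioc (a-1) (a-1+1)).indicator f x) a]
    congr 1; ext x
    simp only [indicator, mem_Ioc, mem_Ico]
    congr 1
    simp only [eq_iff_iff]
    constructor <;> rintro ⟨h1, h2⟩ <;> constructor <;> linarith
  rw [h1, nu_Ioc, per_Ioc f hp (a-1) 0]

def WPer {β : Type*} (F : ℝ × ℝ → β) : Prop := ∀ t w, F (t, w + 1) = F (t, w)

lemma T_wper (t w : ℝ) : T φ (t, w+1) = ((T φ (t,w)).1, (T φ (t,w)).2 + 1) := by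
  have : Int.fract (t + 2 * (w + 1)) = Int.fract (t + 2 * w) := by
    have : t + 2 * (w+1) = t + 2 * w + (2:ℤ) := by push_cast; ring
    rw [this, Int.fract_add_intCast]
  simp only [T, this]; ext <;> simp; ring

lemma WPer.comp_T {β : Type*} {F : ℝ × ℝ → β} (hF : WPer F) : WPer (fun x => F (T φ x)) := by
  intro t w; simp only [T_wper]; exact hF _ _

lemma WPer.comp_R {β : Type*} {F : ℝ × ℝ → β} (hF : WPer F) : WPer (fun x => F (R φ x)) := by
  intro t w; simp only [R]
  have := hF t (φ t - (w+1)); rw [← this]; congr 2; ring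

lemma WPer.comp_iter {β : Type*} {F : ℝ × ℝ → β} (hF : WPer F) (n : ℕ) :
    WPer (fun x => F ((T φ)^[n] x)) := by
  induction n with
  | zero => exact hF
  | succ n ih => simpa only [Function.iterate_succ_apply] using ih.comp_T

lemma wper_tt (n : ℕ) : WPer (tt φ n) := WPer.comp_iter (F := Prod.fst) (fun _ _ => rfl) n

lemma wper_vis (ε : ℝ) (n : ℕ) : WPer (vis φ ε n) := by
  intro t w
  induction n with
  | zero => rfl
  | succ n ih => rw [vis, vis, ih, wper_tt]

lemma wper_good (ε q σ r : ℝ) : WPer (good φ ε q σ r) := by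
  intro t w
  simp only [good, wper_tt _ t w, wper_vis _ _ t w]

lemma meas_T (h : Hyp φ) : Measurable (T φ) := by
  have := h.cont.measurable
  unfold T
  refine Measurable.prodMk ?_ ?_
  · exact measurable_fract.comp (by fun_prop)
  · exact measurable_snd.add (this.comp (measurable_fract.comp (by fun_prop)))
lemma meas_R (h : Hyp φ) : Measurable (R φ) := by
  have := h.cont.measurable
  unfold R
  fun_prop
lemma meas_iter (h : Hyp φ) (n : ℕ) : Measurable ((T φ)^[n]) := (meas_T h).iterate n
lemma meas_tt (h : Hyp φ) (n : ℕ) : Measurable (tt φ n) := measurable_fst.comp (meas_iter h n)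
lemma meas_ww (h : Hyp φ) (n : ℕ) : Measurable (ww φ n) := measurable_snd.comp (meas_iter h n)
lemma meas_vis (h : Hyp φ) (ε : ℝ) (n : ℕ) : Measurable (vis φ ε n) := by
  induction n with
  | zero => exact measurable_const
  | succ n ih =>
    simp only [vis]
    exact ih.add (Measurable.ite ((meas_tt h (n+1)) measurableSet_Icc) measurable_const measurable_const)
lemma meas_good (h : Hyp φ) (ε q σ r : ℝ) : MeasurableSet {x | good φ ε q σ r x} := by
  simp only [good, ofPred_forall]
  refine MeasurableSet.iInter fun n => ?_
  have h1 := meas_tt h (n+1)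
  have h2 : Measurable (fun x => q ^ vis φ ε (n+1) x) := (measurable_from_nat (f := fun k => q ^ k)).comp (meas_vis h ε (n+1))
  exact (h1.add ((h2.const_mul r).const_mul σ)) measurableSet_Ioo

lemma mu_eq (F : ℝ × ℝ → ℝ≥0∞) (hF : Measurable F) : ∫⁻ x, F x ∂mu = ∫⁻ t, ∫⁻ w, F (t,w) ∂nu ∂nu :=
  lintegral_prod _ hF.aemeasurable
lemma mu_eq' (F : ℝ × ℝ → ℝ≥0∞) (hF : Measurable F) : ∫⁻ x, F x ∂mu = ∫⁻ w, ∫⁻ t, F (t,w) ∂nu ∂nu :=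
  lintegral_prod_symm _ hF.aemeasurable

lemma fract_nu : ∀ᵐ t ∂nu, Int.fract t = t := by
  rw [nu, ae_restrict_iff' measurableSet_Ico]
  exact ae_of_all _ fun t ht => Int.fract_eq_self.2 ht

lemma int_R (h : Hyp φ) (F : ℝ × ℝ → ℝ≥0∞) (hF : Measurable F) (hp : WPer F) :
    ∫⁻ x, F (R φ x) ∂mu = ∫⁻ x, F x ∂mu := by
  rw [mu_eq (fun x => F (R φ x)) (hF.comp (meas_R h)), mu_eq _ hF]
  congr 1; ext t
  exact nu_refl (fun w => F (t, w)) (hp t) (φ t)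

lemma int_T (h : Hyp φ) (F : ℝ × ℝ → ℝ≥0∞) (hF : Measurable F) (hp : WPer F) :
    ∫⁻ x, F (T φ x) ∂mu = ∫⁻ x, F x ∂mu := by
  let G : ℝ × ℝ → ℝ≥0∞ := fun x => F (x.1, x.2 + φ x.1)
  have hφ := h.cont.measurable
  have hG : Measurable G := hF.comp (by fun_prop)
  have e1 : ∫⁻ x, G x ∂mu = ∫⁻ x, F x ∂mu := by
    rw [mu_eq _ hG, mu_eq _ hF]
    congr 1; ext t
    exact nu_shift (fun w => F (t, w)) (hp t) (φ t)
  rw [← e1, mu_eq' _ hG, mu_eq' (fun x => F (T φ x)) (hF.comp (meas_T h))]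
  congr 1; ext w
  have := nu_shift (fun t => G (Int.fract t, w)) (fun t => by simp) (2 * w)
  rw [show (∫⁻ t, F (T φ (t, w)) ∂nu) = ∫⁻ t, G (Int.fract (t + 2 * w), w) ∂nu from rfl, this]
  refine lintegral_congr_ae ?_
  filter_upwards [fract_nu] with t ht
  rw [ht]

lemma int_iter (h : Hyp φ) (n : ℕ) : ∀ (F : ℝ × ℝ → ℝ≥0∞), Measurable F → WPer F →
    ∫⁻ x, F ((T φ)^[n] x) ∂mu = ∫⁻ x, F x ∂mu := by
  induction n with
  | zero => intro F _ _; rfl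
  | succ n ih =>
    intro F hF hp
    simp only [Function.iterate_succ_apply']
    rw [ih (fun x => F (T φ x)) (hF.comp (meas_T h)) hp.comp_T, int_T h F hF hp]

lemma ind_set (A : Set (ℝ × ℝ)) (hA : MeasurableSet A) : mu A = ∫⁻ x, A.indicator 1 x ∂mu :=
  (lintegral_indicator_one hA).symm

lemma wper_ind {A : Set (ℝ × ℝ)} (hp : WPer (· ∈ A)) : WPer (A.indicator (1 : ℝ × ℝ → ℝ≥0∞)) := by
  classical
  intro t w
  have : ((t, w+1) ∈ A) = ((t,w) ∈ A) := hp t w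
  simp only [indicator, this, Pi.one_apply]

lemma mu_iter (h : Hyp φ) (n : ℕ) {A : Set (ℝ × ℝ)} (hA : MeasurableSet A) (hp : WPer (· ∈ A)) :
    mu ((T φ)^[n] ⁻¹' A) = mu A := by
  rw [ind_set _ (meas_iter h n hA), ind_set _ hA, ← int_iter h n _ (measurable_one.indicator hA) (wper_ind hp)]
  rfl

lemma mu_R (h : Hyp φ) {A : Set (ℝ × ℝ)} (hA : MeasurableSet A) (hp : WPer (· ∈ A)) :
    mu (R φ ⁻¹' A) = mu A := by
  rw [ind_set _ (meas_R h hA), ind_set _ hA, ← int_R h _ (measurable_one.indicator hA) (wper_ind hp)]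
  rfl

lemma mu_sect {A : Set (ℝ × ℝ)} (hA : MeasurableSet A) : mu A = ∫⁻ t, nu {w | (t,w) ∈ A} ∂nu :=
  Measure.prod_apply hA

lemma ae_mem : ∀ᵐ x ∂mu, x.1 ∈ Ico (0:ℝ) 1 ∧ x.2 ∈ Ico (0:ℝ) 1 := by
  unfold mu nu
  rw [Measure.prod_restrict, ae_restrict_iff' (measurableSet_Ico.prod measurableSet_Ico)]
  exact ae_of_all _ fun x hx => hx

def SS (θ : ℝ) : Set ℝ := {t | t ≤ θ ∨ 1 - θ ≤ t}

lemma meas_SS (θ : ℝ) : MeasurableSet (SS θ) :=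
  (measurableSet_le measurable_id measurable_const).union (measurableSet_le measurable_const measurable_id)

lemma nu_SS (θ : ℝ) : nu (SS θ) ≤ ENNReal.ofReal (2 * θ) := by
  rw [nu, Measure.restrict_apply (meas_SS θ)]
  calc volume (SS θ ∩ Ico 0 1) ≤ volume (Icc 0 θ ∪ Icc (1-θ) 1) := by
        refine measure_mono ?_
        rintro t ⟨h1 | h1, h2⟩
        · exact Or.inl ⟨h2.1, h1⟩
        · exact Or.inr ⟨h1, h2.2.le⟩
    _ ≤ volume (Icc 0 θ) + volume (Icc (1-θ) 1) := measure_union_le _ _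
    _ = ENNReal.ofReal θ + ENNReal.ofReal θ := by
        rw [Real.volume_Icc, Real.volume_Icc]; congr 2 <;> ring
    _ = ENNReal.ofReal (2 * θ) := by
        rw [← two_mul, ENNReal.ofReal_mul (by norm_num)]; norm_num

/-- covering bound -/
lemma vol_le {ι : Type*} (E : Set ℝ) (c : ℝ → ι) (s : Finset ι) (hc : ∀ w ∈ E, c w ∈ s) (δ : ℝ)
    (hδ : ∀ w ∈ E, ∀ w' ∈ E, c w = c w' → w < w' → w' - w ≤ δ) (hδ0 : 0 ≤ δ) :
    volume E ≤ ENNReal.ofReal (s.card * δ) := by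
  have h1 : E ⊆ ⋃ i ∈ s, {w ∈ E | c w = i} := by
    intro w hw; simp only [mem_iUnion]; exact ⟨c w, hc w hw, hw, rfl⟩
  have h2 : ∀ i ∈ s, volume {w ∈ E | c w = i} ≤ ENNReal.ofReal δ := by
    intro i _
    refine (Real.volume_le_diam _).trans (Metric.ediam_le ?_)
    rintro w ⟨hw, e1⟩ w' ⟨hw', e2⟩
    rw [edist_dist, Real.dist_eq]
    refine ENNReal.ofReal_le_ofReal ?_
    rcases lt_trichotomy w w' with hlt | rfl | hlt
    · have := hδ w hw w' hw' (e1.trans e2.symm) hlt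
      rw [abs_le]; constructor <;> linarith
    · simpa
    · have := hδ w' hw' w hw (e2.trans e1.symm) hlt
      rw [abs_le]; constructor <;> linarith
  calc volume E ≤ volume (⋃ i ∈ s, {w ∈ E | c w = i}) := measure_mono h1
    _ ≤ ∑ i ∈ s, volume {w ∈ E | c w = i} := measure_biUnion_finset_le _ _
    _ ≤ ∑ i ∈ s, ENNReal.ofReal δ := Finset.sum_le_sum h2
    _ = _ := by
      rw [Finset.sum_const, nsmul_eq_mul, ENNReal.ofReal_mul (by positivity), ENNReal.ofReal_natCast]

end LTM

open scoped ENNReal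

namespace LTM
variable {φ : ℝ → ℝ}

lemma phi_bdd (h : Hyp φ) {t : ℝ} (h0 : 0 ≤ t) (h1 : t ≤ 1) : |φ t| ≤ |φ 0| + |φ 1| := by
  have a := h.mono h0
  have b := h.mono h1
  rw [abs_le]
  constructor
  · linarith [neg_abs_le (φ 0), abs_nonneg (φ 1)]
  · linarith [le_abs_self (φ 1), abs_nonneg (φ 0)]

lemma tt_Icc (n : ℕ) {x : ℝ × ℝ} (hx : x.1 ∈ Ico (0:ℝ) 1) : tt φ n x ∈ Ico (0:ℝ) 1 := iter_mem n x hx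

lemma ww_bdd (h : Hyp φ) (n : ℕ) (x : ℝ × ℝ) (hw : x.2 ∈ Ico (0:ℝ) 1) :
    |ww φ n x| ≤ 1 + n * (|φ 0| + |φ 1|) := by
  induction n with
  | zero => simp only [ww_zero]; rw [abs_of_nonneg hw.1]; have := hw.2; simp; linarith
  | succ n ih =>
    rw [ww_succ]
    have := phi_bdd h (tt_nonneg (φ := φ) n x) (tt_lt (φ := φ) n x).le
    push_cast
    linarith [abs_add_le (ww φ n x) (φ (tt φ (n+1) x))]

lemma floor_bdd (h : Hyp φ) (n : ℕ) : ∃ B : ℤ, ∀ x : ℝ × ℝ, x.1 ∈ Ico (0:ℝ) 1 → x.2 ∈ Ico (0:ℝ) 1 →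
    ⌊bb φ n x⌋ ∈ Finset.Icc (-B) B := by
  obtain ⟨N, hN⟩ := exists_nat_gt (1 + 2 * (1 + n * (|φ 0| + |φ 1|)))
  refine ⟨N, fun x hx hw => ?_⟩
  have h1 := ww_bdd h n x hw
  have h2 := tt_Icc (φ := φ) n hx
  rw [abs_le] at h1
  rw [Finset.mem_Icc, Int.le_floor]
  have h3 := h2.1
  have h4 := h2.2
  constructor
  · unfold bb; push_cast; linarith
  · refine Int.cast_le.1 ((Int.floor_le (bb φ n x)).trans ?_ : (⌊bb φ n x⌋ : ℝ) ≤ ((N:ℤ) : ℝ))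
    unfold bb; push_cast; linarith

lemma exists_classes (h : Hyp φ) (k : ℕ) : ∃ s : Finset (Fin k → ℤ), ∀ x : ℝ × ℝ, x.1 ∈ Ico (0:ℝ) 1 →
    x.2 ∈ Ico (0:ℝ) 1 → (fun i : Fin k => ⌊bb φ i x⌋) ∈ s := by
  classical
  choose B hB using floor_bdd h
  exact ⟨Fintype.piFinset (fun i : Fin k => Finset.Icc (-(B i)) (B i)), fun x hx hw =>
    Fintype.mem_piFinset.2 fun i => hB i x hx hw⟩

lemma same_tt {x y : ℝ × ℝ} (hx : x.1 = y.1) {k : ℕ} (hf : ∀ i < k, ⌊bb φ i x⌋ = ⌊bb φ i y⌋) :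
    ∀ j < k + 1, tt φ j y - tt φ j x = ee φ x y j := by
  intro j hj
  cases j with
  | zero => simp [ee]
  | succ j => rw [ee_tt, hf j (by omega)]; simp

lemma vert_S (h : Hyp φ) (k : ℕ) (hk : 1 ≤ k) : ∃ C : ℝ, 0 ≤ C ∧ ∀ t ∈ Ico (0:ℝ) 1, ∀ θ, 0 ≤ θ →
    nu {w | tt φ k (t, w) ∈ SS θ} ≤ ENNReal.ofReal (C * θ) := by
  classical
  obtain ⟨s, hs⟩ := exists_classes h k
  refine ⟨(s ×ˢ (Finset.univ : Finset Prop)).card, by positivity, fun t ht θ hθ => ?_⟩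
  have hm : MeasurableSet {w | tt φ k (t, w) ∈ SS θ} :=
    ((meas_tt h k).comp measurable_prodMk_left) (meas_SS θ)
  rw [nu, Measure.restrict_apply hm]
  refine vol_le _ (fun w => ((fun i : Fin k => ⌊bb φ i (t,w)⌋), tt φ k (t,w) ≤ θ)) _ ?_ _ ?_ hθ
  · intro w hw
    exact Finset.mem_product.2 ⟨hs (t,w) ht hw.2, Finset.mem_univ _⟩
  · intro w hw w' hw' hcl hlt
    simp only [Prod.mk.injEq] at hcl
    have hss := same_tt (φ := φ) (x := (t,w)) (y := (t,w')) rfl (k := k)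
      (fun i hi => congrFun hcl.1 ⟨i, hi⟩)
    have hg := (ee_grow h (x := (t,w)) (y := (t,w')) rfl hlt.le (k+1) hss k le_rfl).2
    have he := hss k (by omega)
    have b1 := tt_Icc (φ := φ) k (x := (t,w)) ht
    have b2 := tt_Icc (φ := φ) k (x := (t,w')) ht
    have hd : tt φ k (t,w') - tt φ k (t,w) ≤ θ := by
      by_cases hc : tt φ k (t,w) ≤ θ
      · have := hcl.2.mp hc; linarith [b1.1]
      · have h2 := hw.1.resolve_left hc
        linarith [b2.2]
    have hk' : (1:ℝ) ≤ k := by exact_mod_cast hk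
    have : 2 * (w' - w) ≤ k * (2 * (w' - w)) := by nlinarith
    simp only at hg
    linarith

lemma two_time (h : Hyp φ) (i k : ℕ) (hk : 1 ≤ k) : ∃ C : ℝ, 0 ≤ C ∧ ∀ θ, 0 ≤ θ →
    mu {x | tt φ i x ∈ SS θ ∧ tt φ (k+i) x ∈ SS θ} ≤ ENNReal.ofReal (C * θ^2) := by
  obtain ⟨C, hC, hv⟩ := vert_S h k hk
  refine ⟨2 * C, by positivity, fun θ hθ => ?_⟩
  have hmA : MeasurableSet {x | x.1 ∈ SS θ ∧ tt φ k x ∈ SS θ} :=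
    (measurable_fst (meas_SS θ)).inter ((meas_tt h k) (meas_SS θ))
  have e : {x | tt φ i x ∈ SS θ ∧ tt φ (k+i) x ∈ SS θ} = (T φ)^[i] ⁻¹' {x | x.1 ∈ SS θ ∧ tt φ k x ∈ SS θ} := by
    ext x; simp only [mem_preimage, mem_ofPred_eq, tt_add k i]; rfl
  rw [e, mu_iter h i hmA (fun t w => by simp only [mem_ofPred_eq, wper_tt k t w]), mu_sect hmA]
  calc ∫⁻ t, nu {w | (t, w) ∈ {x : ℝ × ℝ | x.1 ∈ SS θ ∧ tt φ k x ∈ SS θ}} ∂nu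
      ≤ ∫⁻ t, (SS θ).indicator (fun _ => ENNReal.ofReal (C * θ)) t ∂nu := by
        refine lintegral_mono_ae ?_
        have : ∀ᵐ t ∂nu, t ∈ Ico (0:ℝ) 1 := ae_restrict_mem measurableSet_Ico
        filter_upwards [this] with t ht
        by_cases hs : t ∈ SS θ
        · simp only [indicator_of_mem hs, mem_ofPred_eq, hs, true_and]; exact hv t ht θ hθ
        · simp [hs]
    _ = ENNReal.ofReal (C * θ) * nu (SS θ) := by
        rw [lintegral_indicator (meas_SS θ), setLIntegral_const]
    _ ≤ ENNReal.ofReal (C * θ) * ENNReal.ofReal (2 * θ) := by gcongr; exact nu_SS θ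
    _ = _ := by rw [← ENNReal.ofReal_mul (by positivity)]; congr 1; ring

structure Sm (φ : ℝ → ℝ) (ε : ℝ) : Prop where
  pos : 0 < ε
  lt : ε < 1/4
  lip : ∃ K, 0 ≤ K ∧ (∀ a b, |φ a - φ b| ≤ K * |a - b|) ∧
    (∀ n : ℤ, |2 * φ 0 - n| < (4 + 2 * K) * ε → 2 * φ 0 = n) ∧
    (∀ n : ℤ, |2 * φ 1 - n| < (4 + 2 * K) * ε → 2 * φ 1 = n)

lemma int_sep (a : ℝ) : ∃ δ > 0, ∀ n : ℤ, |a - n| < δ → a = n := by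
  by_cases ha : Int.fract a = 0
  · refine ⟨1, one_pos, fun n hn => ?_⟩
    have : a = ⌊a⌋ := by rw [← Int.self_sub_floor] at ha; linarith
    rw [this] at hn ⊢
    have h2 : |⌊a⌋ - n| < 1 := by exact_mod_cast hn
    rw [Int.abs_lt_one_iff] at h2
    have : ⌊a⌋ = n := by omega
    exact_mod_cast this
  · have h0 : 0 < Int.fract a := lt_of_le_of_ne (Int.fract_nonneg a) (Ne.symm ha)
    have h1 := Int.fract_lt_one a
    refine ⟨min (Int.fract a) (1 - Int.fract a), lt_min h0 (by linarith), fun n hn => ?_⟩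
    exfalso
    rw [lt_min_iff, abs_lt, abs_lt] at hn
    have e := Int.self_sub_floor a
    have a1 : (⌊a⌋:ℝ) < n := by linarith [hn.1.2]
    have a2 : (n:ℝ) < ⌊a⌋ + 1 := by linarith [hn.2.1]
    have a1' : ⌊a⌋ < n := by exact_mod_cast a1
    have a2' : n < ⌊a⌋ + 1 := by exact_mod_cast a2
    omega

lemma exists_Sm (h : Hyp φ) : ∃ ε₀ > 0, ∀ ε, 0 < ε → ε ≤ ε₀ → Sm φ ε := by
  obtain ⟨K, hK, hl⟩ := h.lip
  obtain ⟨δ, hδ, h0⟩ := int_sep (2 * φ 0)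
  obtain ⟨δ', hδ', h1⟩ := int_sep (2 * φ 1)
  have hp : 0 < 4 + 2 * K := by linarith
  refine ⟨min (1/8) (min (δ / (4 + 2 * K)) (δ' / (4 + 2 * K))), by positivity, fun ε hε hle => ?_⟩
  rw [le_min_iff, le_min_iff, le_div_iff₀ hp, le_div_iff₀ hp] at hle
  refine ⟨hε, by linarith, K, hK, hl, fun n hn => h0 n (by linarith), fun n hn => h1 n (by linarith)⟩

noncomputable def dv (ε t : ℝ) : ℝ := if t < ε then t else t - 1
noncomputable def Psi (φ : ℝ → ℝ) (s : ℝ) : ℝ := if 0 ≤ s then 2 * (φ s - φ 0) else 2 * (φ (1+s) - φ 1)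

lemma Psi_mono (h : Hyp φ) : Monotone (Psi φ) := by
  intro a b hab
  unfold Psi
  split_ifs with h1 h2 h2
  · have := h.mono hab; linarith
  · linarith
  · have := h.mono (by linarith : 1 + a ≤ 1); have := h.mono h2; linarith
  · have := h.mono (by linarith : 1 + a ≤ 1 + b); linarith

lemma int_rec (j : ℕ) (x : ℝ × ℝ) : ∃ n : ℤ,
    tt φ (j+2) x - 2 * tt φ (j+1) x + tt φ j x = 2 * φ (tt φ (j+1) x) + n := by
  refine ⟨⌊bb φ j x⌋ - ⌊bb φ (j+1) x⌋, ?_⟩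
  have h1 := tt_bb (φ := φ) j x
  have h2 := tt_bb (φ := φ) (j+1) x
  rw [bb_succ] at h2
  have h3 := bb_succ (φ := φ) j x
  push_cast
  have : tt φ (j+2) x = tt φ (j+1+1) x := rfl
  rw [this, tt_bb, h3]; rw [← h3]; linarith

lemma dv_rec {ε : ℝ} (hS : Sm φ ε) {j : ℕ} {x : ℝ × ℝ} (hx : x.1 ∈ Ico (0:ℝ) 1)
    (h0 : tt φ j x ∉ Icc ε (1-ε)) (h1 : tt φ (j+1) x ∉ Icc ε (1-ε)) (h2 : tt φ (j+2) x ∉ Icc ε (1-ε)) :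
    dv ε (tt φ (j+2) x) - 2 * dv ε (tt φ (j+1) x) + dv ε (tt φ j x) = Psi φ (dv ε (tt φ (j+1) x)) := by
  obtain ⟨n, hn⟩ := int_rec (φ := φ) j x
  obtain ⟨K, hK, hl, hz, ho⟩ := hS.lip
  have hε := hS.pos
  have hε' := hS.lt
  have key : ∀ t ∈ Ico (0:ℝ) 1, t ∉ Icc ε (1-ε) → |dv ε t| ≤ ε ∧ (dv ε t < ε) ∧ -ε < dv ε t ∧
      ∃ m : ℤ, dv ε t = t + m := by
    intro t ht hnt
    unfold dv
    split_ifs with hh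
    · refine ⟨?_, hh, by linarith [ht.1], 0, by simp⟩
      rw [abs_le]; constructor <;> linarith [ht.1]
    · have : 1 - ε < t := by
        by_contra hc; push Not at hc hh; exact hnt ⟨hh, hc⟩
      have := ht.2
      refine ⟨?_, by linarith, by linarith, -1, by push_cast; ring⟩
      rw [abs_le]; constructor <;> linarith
  obtain ⟨_, a0, a0', m0, e0⟩ := key _ (tt_Icc j hx) h0
  obtain ⟨_, a1, a1', m1, e1⟩ := key _ (tt_Icc (j+1) hx) h1
  obtain ⟨_, a2, a2', m2, e2⟩ := key _ (tt_Icc (j+2) hx) h2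
  set X := dv ε (tt φ (j+2) x) - 2 * dv ε (tt φ (j+1) x) + dv ε (tt φ j x) with hX
  have hXb : |X| < 4 * ε := by rw [abs_lt]; constructor <;> linarith
  have hXe : X = 2 * φ (tt φ (j+1) x) - ((-(n + m2 - 2 * m1 + m0) : ℤ) : ℝ) := by
    push_cast; linarith
  set N : ℤ := -(n + m2 - 2 * m1 + m0) with hN
  have hb := tt_Icc (φ := φ) (j+1) hx
  rw [abs_lt] at hXb
  by_cases hh : tt φ (j+1) x < ε
  · have hl' := hl (tt φ (j+1) x) 0
    rw [sub_zero, abs_of_nonneg hb.1] at hl'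
    have hl2 : |φ (tt φ (j+1) x) - φ 0| ≤ K * ε := hl'.trans (mul_le_mul_of_nonneg_left hh.le hK)
    rw [abs_le] at hl2
    have := hz N (by rw [abs_lt]; constructor <;> nlinarith)
    have hd : dv ε (tt φ (j+1) x) = tt φ (j+1) x := if_pos hh
    rw [hd, Psi, if_pos hb.1]; linarith
  · have h4 : 1 - ε < tt φ (j+1) x := by
      by_contra hc; push Not at hc hh; exact h1 ⟨hh, hc⟩
    have hl' := hl (tt φ (j+1) x) 1
    have : |tt φ (j+1) x - 1| ≤ ε := by rw [abs_le]; constructor <;> linarith [hb.2]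
    have hl2 : |φ (tt φ (j+1) x) - φ 1| ≤ K * ε := hl'.trans (mul_le_mul_of_nonneg_left this hK)
    rw [abs_le] at hl2
    have := ho N (by rw [abs_lt]; constructor <;> nlinarith)
    have hd : dv ε (tt φ (j+1) x) = tt φ (j+1) x - 1 := if_neg hh
    rw [hd, Psi, if_neg (by linarith [hb.2])]
    have e : 1 + (tt φ (j+1) x - 1) = tt φ (j+1) x := by ring
    rw [e]; linarith

lemma lemX (h : Hyp φ) {ε : ℝ} (hS : Sm φ ε) (i : ℕ) {η : ℝ} (hη : 0 < η) : ∃ m : ℕ, ∀ t ∈ Ico (0:ℝ) 1,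
    nu {w | ∀ j < m, tt φ (i+1+j) (t,w) ∉ Icc ε (1-ε)} ≤ ENNReal.ofReal η := by
  classical
  obtain ⟨s, hs⟩ := exists_classes h (i+2)
  set N : ℝ := ((s ×ˢ (Finset.univ : Finset (Prop × Prop))).card : ℝ) with hN
  have hN0 : 0 ≤ N := by positivity
  obtain ⟨m, hm⟩ := exists_nat_gt (N / η)
  rw [div_lt_iff₀ hη] at hm
  refine ⟨m+3, fun t ht => ?_⟩
  have hmm : MeasurableSet {w | ∀ j < m+3, tt φ (i+1+j) (t,w) ∉ Icc ε (1-ε)} := by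
    simp only [ofPred_forall]
    refine MeasurableSet.iInter fun j => MeasurableSet.iInter fun _ => ?_
    exact (((meas_tt h (i+1+j)).comp measurable_prodMk_left) measurableSet_Icc).compl
  have hm0 : (0:ℝ) < m := by
    rcases Nat.eq_zero_or_pos m with rfl | h
    · simp at hm; linarith
    · exact_mod_cast h
  rw [nu, Measure.restrict_apply hmm]
  refine (vol_le _ (fun w => ((fun i : Fin (i+2) => ⌊bb φ i (t,w)⌋), (tt φ (i+1) (t,w) < ε, tt φ (i+2) (t,w) < ε)))
    (s ×ˢ (Finset.univ : Finset (Prop × Prop))) ?_ (1/m) ?_ (by positivity)).trans ?_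
  · intro w hw
    exact Finset.mem_product.2 ⟨hs (t,w) ht hw.2, Finset.mem_univ _⟩
  · intro w hw w' hw' hcl hlt
    simp only [Prod.mk.injEq] at hcl
    have hss := same_tt (φ := φ) (x := (t,w)) (y := (t,w')) rfl (k := i+2)
      (fun i hi => congrFun hcl.1 ⟨i, hi⟩)
    have hg := ee_grow h (x := (t,w)) (y := (t,w')) rfl hlt.le (i+3) hss (i+1) (by omega)
    have s1 := hss (i+1) (by omega)
    have s2 := hss (i+2) (by omega)
    have hdv : ∀ a b : ℝ, (a < ε ↔ b < ε) → dv ε a - dv ε b = a - b := by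
      intro a b hab; unfold dv
      by_cases ha : a < ε
      · rw [if_pos ha, if_pos (hab.1 ha)]
      · rw [if_neg ha, if_neg (fun hb => ha (hab.2 hb))]; ring
    let x : ℝ × ℝ := (t,w)
    let y : ℝ × ℝ := (t,w')
    let Δ : ℕ → ℝ := fun j => dv ε (tt φ (i+1+j) y) - dv ε (tt φ (i+1+j) x)
    have d0 : Δ 0 = ee φ x y (i+1) := by
      rw [← s1]; exact hdv _ _ (iff_of_eq hcl.2.1.symm)
    have d1 : Δ 1 = ee φ x y (i+2) := by
      rw [← s2]; exact hdv _ _ (iff_of_eq hcl.2.2.symm)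
    have hww : 0 < w' - w := by linarith
    have hpos : 0 ≤ ((i+1 : ℕ):ℝ) * (2 * (w' - w)) := by positivity
    simp only at hg
    have hgr := (grow Δ (m+2) (fun j hj hp => by
      have r1 := dv_rec hS (j := i+1+j) (x := x) ht (hw.1 j (by omega)) (hw.1 (j+1) (by omega)) (hw.1 (j+2) (by omega))
      have r2 := dv_rec hS (j := i+1+j) (x := y) ht (hw'.1 j (by omega)) (hw'.1 (j+1) (by omega)) (hw'.1 (j+2) (by omega))
      have := Psi_mono h (by simp only [Δ] at hp; linarith :
        dv ε (tt φ (i+1+(j+1)) x) ≤ dv ε (tt φ (i+1+(j+1)) y))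
      simp only [Δ]
      have e1 : i + 1 + j + 1 = i + 1 + (j+1) := by omega
      have e2 : i + 1 + j + 2 = i + 1 + (j+2) := by omega
      rw [e1, e2] at r1 r2
      linarith) (2 * (w' - w)) (by linarith) (by rw [d0]; linarith [hg.2]) (by
        rw [d0, d1]; linarith [hg.1]) (m+1) (by omega)).2
    have hb : Δ (m+1) ≤ 1 := by
      have hk : ∀ z : ℝ × ℝ, z.1 ∈ Ico (0:ℝ) 1 → tt φ (i+1+(m+1)) z ∉ Icc ε (1-ε) →
          dv ε (tt φ (i+1+(m+1)) z) < ε ∧ -ε < dv ε (tt φ (i+1+(m+1)) z) := by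
        intro z hz hz'
        have b := tt_Icc (φ := φ) (i+1+(m+1)) hz
        unfold dv
        have := hS.pos
        split_ifs with hh
        · exact ⟨hh, by linarith [b.1]⟩
        · have : 1 - ε < tt φ (i+1+(m+1)) z := by
            by_contra hc; push Not at hc hh; exact hz' ⟨hh, hc⟩
          exact ⟨by linarith [b.2], by linarith⟩
      have k1 := hk y ht (hw'.1 (m+1) (by omega))
      have k2 := hk x ht (hw.1 (m+1) (by omega))
      have := hS.lt
      simp only [Δ]; linarith [k1.1, k2.2]
    rw [le_div_iff₀ hm0]
    have : 0 ≤ Δ 0 := by rw [d0]; linarith [hg.2]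
    push_cast at hgr
    nlinarith
  · refine ENNReal.ofReal_le_ofReal ?_
    rw [mul_one_div, div_le_iff₀ hm0, mul_comm]; exact hm.le

lemma vis_mono (ε : ℝ) (x : ℝ × ℝ) : Monotone (fun n => vis φ ε n x) :=
  monotone_nat_of_le_succ fun n => by simp only [vis]; omega

lemma vis_bound (h : Hyp φ) {ε : ℝ} (hS : Sm φ ε) (k0 : ℕ) : ∀ {η : ℝ}, 0 < η → ∃ M : ℕ, ∀ t ∈ Ico (0:ℝ) 1,
    nu {w | vis φ ε M (t,w) < k0} ≤ ENNReal.ofReal η := by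
  induction k0 with
  | zero => intro η hη; exact ⟨0, fun t _ => by simp⟩
  | succ k0 ih =>
    intro η hη
    obtain ⟨M, hM⟩ := ih (half_pos hη)
    obtain ⟨m, hm⟩ := lemX h hS M (half_pos hη)
    refine ⟨M + m, fun t ht => ?_⟩
    calc nu {w | vis φ ε (M+m) (t,w) < k0 + 1}
        ≤ nu ({w | vis φ ε M (t,w) < k0} ∪ {w | ∀ j < m, tt φ (M+1+j) (t,w) ∉ Icc ε (1-ε)}) := by
          refine measure_mono fun w hw => ?_
          by_contra hcon
          simp only [mem_union, mem_ofPred_eq, not_or, not_lt, not_forall, not_not] at hcon hw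
          obtain ⟨h1, j, hj, h2⟩ := hcon
          have h3 : vis φ ε (M+j) (t,w) + 1 ≤ vis φ ε (M+m) (t,w) := by
            have : vis φ ε (M+j+1) (t,w) = vis φ ε (M+j) (t,w) + 1 := by
              rw [vis, if_pos]
              have e : M + j + 1 = M + 1 + j := by omega
              rw [e]; exact h2
            rw [← this]; exact vis_mono ε (t,w) (by omega)
          have h4 := vis_mono (φ := φ) ε (t,w) (by omega : M ≤ M + j)
          simp only at h4
          omega
      _ ≤ ENNReal.ofReal (η/2) + ENNReal.ofReal (η/2) := (measure_union_le _ _).trans (add_le_add (hM t ht) (hm t ht))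
      _ = ENNReal.ofReal η := by rw [← ENNReal.ofReal_add (by positivity) (by positivity)]; congr 1; ring

end LTM

open scoped ENNReal

namespace LTM
variable {φ : ℝ → ℝ}

open Classical in
noncomputable def vpr (φ : ℝ → ℝ) (ε : ℝ) : ℕ → ℝ × ℝ → ℕ
  | 0, _ => 0
  | (n+1), x => vpr φ ε n x + if tt φ n x ∈ Icc ε (1-ε) then 1 else 0

lemma vpr_mono (ε : ℝ) (x : ℝ × ℝ) : Monotone (fun n => vpr φ ε n x) :=
  monotone_nat_of_le_succ fun n => by simp only [vpr]; omega

lemma wper_vpr (ε : ℝ) (n : ℕ) : WPer (vpr φ ε n) := by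
  intro t w
  induction n with
  | zero => rfl
  | succ n ih => rw [vpr, vpr, ih, wper_tt]

lemma meas_vpr (h : Hyp φ) (ε : ℝ) (n : ℕ) : Measurable (vpr φ ε n) := by
  induction n with
  | zero => exact measurable_const
  | succ n ih =>
    simp only [vpr]
    exact ih.add (Measurable.ite ((meas_tt h n) measurableSet_Icc) measurable_const measurable_const)

lemma vis_le_vpr (ε : ℝ) (n : ℕ) (x : ℝ × ℝ) : vis φ ε n x ≤ vpr φ ε (n+1) x := by
  induction n with
  | zero => simp [vis]
  | succ n ih => rw [vis, vpr]; omega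

lemma vpr_rev (ε : ℝ) (n : ℕ) (x : ℝ × ℝ) (hx : x.1 ∈ Ico (0:ℝ) 1) :
    vpr φ ε n (R φ ((T φ)^[n] x)) = vis φ ε n x := by
  have : ∀ j m, m + j = n → vpr φ ε j (R φ ((T φ)^[n] x)) + vis φ ε m x = vis φ ε n x := by
    intro j
    induction j with
    | zero => intro m hm; simp at hm; simp [vpr, hm]
    | succ j ih =>
      intro m hm
      have h1 := ih (m+1) (by omega)
      have h2 : tt φ j (R φ ((T φ)^[n] x)) = tt φ (m+1) x := by
        have e : n = (m+1) + j := by omega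
        rw [e]; exact tt_rev (m+1) j x hx
      rw [vis] at h1
      rw [vpr, h2]; omega
  simpa [vis] using this n 0 (by omega)

lemma rev_sum (h : Hyp φ) {ε : ℝ} (hε : 0 < ε) {S : Set ℝ} (hS : MeasurableSet S) (k M : ℕ) :
    ∑' n, mu {x | x.1 ∈ Icc ε (1-ε) ∧ vis φ ε (M+n) x = k ∧ tt φ (M+n) x ∈ S} ≤
      mu {y | y.1 ∈ S ∧ vpr φ ε M y ≤ k} := by
  let B : ℕ → Set (ℝ × ℝ) := fun n => {y | y.1 ∈ S ∧ tt φ (M+n) y ∈ Icc ε (1-ε) ∧ vpr φ ε (M+n) y = k}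
  have hBm : ∀ n, MeasurableSet (B n) := fun n =>
    (measurable_fst hS).inter (((meas_tt h _) measurableSet_Icc).inter ((meas_vpr h ε _) (measurableSet_singleton k)))
  have hBp : ∀ n, WPer (· ∈ B n) := fun n t w => by
    simp only [B, mem_ofPred_eq, wper_tt _ t w, wper_vpr _ _ t w]
  have hle : ∀ n, mu {x | x.1 ∈ Icc ε (1-ε) ∧ vis φ ε (M+n) x = k ∧ tt φ (M+n) x ∈ S} ≤ mu (B n) := by
    intro n
    have e1 : mu ((T φ)^[M+n] ⁻¹' (R φ ⁻¹' B n)) = mu (B n) := by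
      rw [mu_iter h _ (meas_R h (hBm n)) (WPer.comp_R (F := (· ∈ B n)) (hBp n)), mu_R h (hBm n) (hBp n)]
    rw [← e1]
    refine measure_mono fun x hx => ?_
    have hx0 : x.1 ∈ Ico (0:ℝ) 1 := ⟨by linarith [hx.1.1], by linarith [hx.1.2]⟩
    refine ⟨hx.2.2, ?_, ?_⟩
    · have := tt_rev (φ := φ) 0 (M+n) x hx0
      rw [zero_add] at this
      rw [this]; exact hx.1
    · rw [vpr_rev ε _ x hx0]; exact hx.2.1
  have hdisj : Pairwise (Function.onFun Disjoint B) := by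
    have : ∀ i j, i < j → Disjoint (B i) (B j) := by
      intro i j hij
      rw [Set.disjoint_left]
      rintro y ⟨_, h2, h3⟩ ⟨_, _, h6⟩
      have h7 : vpr φ ε (M+i+1) y = vpr φ ε (M+i) y + 1 := by rw [vpr, if_pos h2]
      have h8 := vpr_mono (φ := φ) ε y (by omega : M+i+1 ≤ M+j)
      simp only at h8
      omega
    intro i j hij
    rcases lt_or_gt_of_ne hij with hlt | hlt
    · exact this i j hlt
    · exact (this j i hlt).symm
  calc _ ≤ ∑' n, mu (B n) := ENNReal.tsum_le_tsum hle
    _ = mu (⋃ n, B n) := (measure_iUnion hdisj hBm).symm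
    _ ≤ _ := by
      refine measure_mono (iUnion_subset fun n y hy => ⟨hy.1, ?_⟩)
      have := vpr_mono (φ := φ) ε y (by omega : M ≤ M+n)
      simp only at this
      exact this.trans hy.2.2.le

def Dle (φ : ℝ → ℝ) (ε q κ : ℝ) (x : ℝ × ℝ) : Prop :=
  ∀ n : ℕ, ∑ j ∈ Finset.range n, (j:ℝ) * q ^ vis φ ε j x ≤ κ

lemma wper_Dle (ε q κ : ℝ) : WPer (Dle φ ε q κ) := by
  intro t w; simp only [Dle, wper_vis _ _ t w]

lemma meas_Dle (h : Hyp φ) (ε q κ : ℝ) : MeasurableSet {x | Dle φ ε q κ x} := by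
  simp only [Dle, ofPred_forall]
  refine MeasurableSet.iInter fun n => ?_
  refine measurableSet_le (Finset.measurable_sum _ fun j _ => ?_) measurable_const
  exact ((measurable_from_nat (f := fun k => q ^ k)).comp (meas_vis h ε j)).const_mul _

lemma geo_ne_top {p : ℝ} (h0 : 0 ≤ p) (h1 : p < 1) : ∑' k : ℕ, ENNReal.ofReal (p ^ k) ≠ ⊤ := by
  rw [← ENNReal.ofReal_tsum_of_nonneg (fun k => pow_nonneg h0 k) (summable_geometric_of_lt_one h0 h1)]
  exact ENNReal.ofReal_ne_top

lemma ae_D (h : Hyp φ) {ε : ℝ} (hε : 0 < ε) {p : ℝ} (hp0 : 0 ≤ p) (hp1 : p < 1) :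
    ∀ᵐ x ∂mu, x.1 ∈ Icc ε (1-ε) → ∃ κ : ℕ, Dle φ ε (p^2) κ x := by
  let Y : ℝ × ℝ → ℝ≥0∞ := fun x => ∑' n, {x : ℝ × ℝ | x.1 ∈ Icc ε (1-ε)}.indicator (fun x => ENNReal.ofReal (p ^ vis φ ε n x)) x
  let A : ℕ → ℕ → Set (ℝ × ℝ) := fun n k => {x | x.1 ∈ Icc ε (1-ε) ∧ vis φ ε (0+n) x = k ∧ tt φ (0+n) x ∈ univ}
  have hAm : ∀ n k, MeasurableSet (A n k) := fun n k =>
    (measurable_fst measurableSet_Icc).inter (((meas_vis h ε _) (measurableSet_singleton k)).inter ((meas_tt h (0+n)) MeasurableSet.univ))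
  have hUm : MeasurableSet {x : ℝ × ℝ | x.1 ∈ Icc ε (1-ε)} := measurable_fst measurableSet_Icc
  have hvm : ∀ n, Measurable (fun x => ENNReal.ofReal (p ^ vis φ ε n x)) := fun n =>
    (measurable_from_nat (f := fun k => ENNReal.ofReal (p ^ k))).comp (meas_vis h ε n)
  have hYm : Measurable Y := Measurable.ennreal_tsum fun n => (hvm n).indicator hUm
  have hYint : ∫⁻ x, Y x ∂mu ≠ ⊤ := by
    have e : ∀ n x, {x : ℝ × ℝ | x.1 ∈ Icc ε (1-ε)}.indicator (fun x => ENNReal.ofReal (p ^ vis φ ε n x)) x =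
        ∑' k, ENNReal.ofReal (p^k) * (A n k).indicator 1 x := by
      intro n x
      by_cases hx : x.1 ∈ Icc ε (1-ε)
      · rw [indicator_of_mem (show x ∈ {x : ℝ × ℝ | x.1 ∈ Icc ε (1-ε)} from hx), tsum_eq_single (vis φ ε n x)]
        · rw [indicator_of_mem (show x ∈ A n (vis φ ε n x) from ⟨hx, by rw [zero_add], trivial⟩)]; simp
        · intro k hk
          rw [indicator_of_notMem (fun hx' : x ∈ A n k => hk (by rw [← hx'.2.1, zero_add])), mul_zero]
      · rw [indicator_of_notMem (show x ∉ {x : ℝ × ℝ | x.1 ∈ Icc ε (1-ε)} from hx)]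
        symm
        simp only [ENNReal.tsum_eq_zero]
        intro k
        rw [indicator_of_notMem (fun hx' : x ∈ A n k => hx hx'.1), mul_zero]
    have : ∫⁻ x, Y x ∂mu ≤ ∑' k : ℕ, ENNReal.ofReal (p ^ k) := by
      calc ∫⁻ x, Y x ∂mu = ∑' n, ∫⁻ x, {x : ℝ × ℝ | x.1 ∈ Icc ε (1-ε)}.indicator (fun x => ENNReal.ofReal (p ^ vis φ ε n x)) x ∂mu :=
            lintegral_tsum fun n => ((hvm n).indicator hUm).aemeasurable
        _ = ∑' n, ∑' k, ENNReal.ofReal (p^k) * mu (A n k) := by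
            congr 1; ext n
            simp only [e]
            rw [lintegral_tsum fun k => ((measurable_one.indicator (hAm n k)).const_mul _).aemeasurable]
            congr 1; ext k
            rw [lintegral_const_mul _ (measurable_one.indicator (hAm n k)), lintegral_indicator_one (hAm n k)]
        _ = ∑' k, ENNReal.ofReal (p^k) * ∑' n, mu (A n k) := by
            rw [ENNReal.tsum_comm]; congr 1; ext k; rw [ENNReal.tsum_mul_left]
        _ ≤ _ := by
            refine ENNReal.tsum_le_tsum fun k => ?_
            calc _ ≤ ENNReal.ofReal (p^k) * 1 := by
                  gcongr
                  exact (rev_sum h hε MeasurableSet.univ k 0).trans prob_le_one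
              _ = _ := mul_one _
    exact ne_top_of_le_ne_top (geo_ne_top hp0 hp1) this
  filter_upwards [ae_lt_top hYm hYint] with x hx hxU
  have hYx : ∑' n, ENNReal.ofReal (p ^ vis φ ε n x) ≠ ⊤ := by
    have : Y x = ∑' n, ENNReal.ofReal (p ^ vis φ ε n x) := by
      simp only [Y]; congr 1; ext n
      exact indicator_of_mem (show x ∈ {x : ℝ × ℝ | x.1 ∈ Icc ε (1-ε)} from hxU) _
    rw [← this]; exact hx.ne
  have hsum : Summable (fun n => p ^ vis φ ε n x) := by
    have := ENNReal.summable_toReal hYx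
    simpa only [ENNReal.toReal_ofReal (pow_nonneg hp0 _)] using this
  set Yr := ∑' n, p ^ vis φ ε n x with hYr
  have hYr0 : 0 ≤ Yr := tsum_nonneg fun n => pow_nonneg hp0 _
  obtain ⟨κ, hκ⟩ := exists_nat_gt (Yr * Yr)
  refine ⟨κ, fun n => ?_⟩
  have hj : ∀ j : ℕ, (j:ℝ) * p ^ vis φ ε j x ≤ Yr := by
    intro j
    calc (j:ℝ) * p ^ vis φ ε j x = ∑ i ∈ Finset.range j, p ^ vis φ ε j x := by simp
      _ ≤ ∑ i ∈ Finset.range j, p ^ vis φ ε i x := by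
        refine Finset.sum_le_sum fun i hi => ?_
        exact pow_le_pow_of_le_one hp0 hp1.le (vis_mono ε x (Finset.mem_range.1 hi).le)
      _ ≤ Yr := hsum.sum_le_tsum _ fun i _ => pow_nonneg hp0 _
  calc ∑ j ∈ Finset.range n, (j:ℝ) * (p^2) ^ vis φ ε j x
      ≤ ∑ j ∈ Finset.range n, Yr * p ^ vis φ ε j x := by
        refine Finset.sum_le_sum fun j _ => ?_
        have : (j:ℝ) * (p^2) ^ vis φ ε j x = ((j:ℝ) * p ^ vis φ ε j x) * p ^ vis φ ε j x := by
          rw [← pow_mul, mul_comm 2, pow_mul, sq]; ring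
        rw [this]
        exact mul_le_mul_of_nonneg_right (hj j) (pow_nonneg hp0 _)
    _ = Yr * ∑ j ∈ Finset.range n, p ^ vis φ ε j x := by rw [Finset.mul_sum]
    _ ≤ Yr * Yr := mul_le_mul_of_nonneg_left (hsum.sum_le_tsum _ fun i _ => pow_nonneg hp0 _) hYr0
    _ ≤ κ := hκ.le

lemma mu_S_vis (h : Hyp φ) {ε : ℝ} {S : Set ℝ} (hS : MeasurableSet S) {k0 M : ℕ} {η : ℝ≥0∞}
    (hM : ∀ t ∈ Ico (0:ℝ) 1, nu {w | vis φ ε M (t,w) < k0} ≤ η) :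
    mu {y | y.1 ∈ S ∧ vis φ ε M y < k0} ≤ η * nu S := by
  have hm : MeasurableSet {y : ℝ × ℝ | y.1 ∈ S ∧ vis φ ε M y < k0} :=
    (measurable_fst hS).inter ((meas_vis h ε M) measurableSet_Iio)
  rw [mu_sect hm]
  calc _ ≤ ∫⁻ t, S.indicator (fun _ => η) t ∂nu := by
        refine lintegral_mono_ae ?_
        have : ∀ᵐ t ∂nu, t ∈ Ico (0:ℝ) 1 := ae_restrict_mem measurableSet_Ico
        filter_upwards [this] with t ht
        by_cases hs : t ∈ S
        · simp only [indicator_of_mem hs, mem_ofPred_eq, hs, true_and]; exact hM t ht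
        · simp [hs]
    _ = _ := by rw [lintegral_indicator hS, setLIntegral_const]

def Late (φ : ℝ → ℝ) (ε q : ℝ) (M : ℕ) (r : ℝ) : Set (ℝ × ℝ) :=
  {x | x.1 ∈ Icc ε (1-ε) ∧ ∃ n, M ≤ n ∧ tt φ n x ∈ SS (r * q ^ vis φ ε n x)}

lemma late (h : Hyp φ) {ε : ℝ} (hSm : Sm φ ε) {p : ℝ} (hp0 : 0 < p) (hp1 : p < 1) {δ : ℝ} (hδ : 0 < δ) :
    ∃ M : ℕ, ∀ r, 0 ≤ r → mu (Late φ ε (p^2) M r) ≤ ENNReal.ofReal (δ * r) := by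
  obtain ⟨k0, hk0⟩ := exists_pow_lt_of_lt_one (show 0 < δ * (1 - p) / 2 by nlinarith) hp1
  obtain ⟨M, hM⟩ := vis_bound h hSm k0 (pow_pos hp0 k0)
  refine ⟨M+1, fun r hr => ?_⟩
  let A : ℕ → ℕ → Set (ℝ × ℝ) := fun k n => {x | x.1 ∈ Icc ε (1-ε) ∧ vis φ ε (M+1+n) x = k ∧
    tt φ (M+1+n) x ∈ SS (r * (p^2)^k)}
  have hb : ∀ k, ∑' n, mu (A k n) ≤ ENNReal.ofReal (2 * r * p^k0 * p^k) := by
    intro k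
    refine (rev_sum h hSm.pos (meas_SS _) k (M+1)).trans ?_
    have hnu := nu_SS (r * (p^2)^k)
    rcases Nat.lt_or_ge k k0 with hk | hk
    · calc _ ≤ mu {y | y.1 ∈ SS (r * (p^2)^k) ∧ vis φ ε M y < k0} := by
            refine measure_mono fun y hy => ⟨hy.1, ?_⟩
            have := vis_le_vpr (φ := φ) ε M y
            have := hy.2
            omega
        _ ≤ ENNReal.ofReal (p^k0) * ENNReal.ofReal (2 * (r * (p^2)^k)) := by
            refine (mu_S_vis h (meas_SS _) hM).trans ?_
            gcongr
        _ ≤ _ := by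
            rw [← ENNReal.ofReal_mul (by positivity)]
            refine ENNReal.ofReal_le_ofReal ?_
            have h1 : p^k ≤ 1 := pow_le_one₀ hp0.le hp1.le
            have h2 : (p^2)^k = p^k * p^k := by rw [← pow_mul, mul_comm 2, pow_mul, sq]
            rw [h2]
            have : 0 ≤ 2 * r * p^k0 * p^k := by positivity
            nlinarith
    · calc _ ≤ mu {y : ℝ × ℝ | y.1 ∈ SS (r * (p^2)^k)} := measure_mono fun y hy => hy.1
        _ = nu (SS (r * (p^2)^k)) := by
            have : {y : ℝ × ℝ | y.1 ∈ SS (r * (p^2)^k)} = SS (r * (p^2)^k) ×ˢ univ := by ext; simp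
            rw [this, mu, Measure.prod_prod]; simp
        _ ≤ _ := hnu
        _ ≤ _ := by
            refine ENNReal.ofReal_le_ofReal ?_
            have h1 : p^k ≤ p^k0 := pow_le_pow_of_le_one hp0.le hp1.le hk
            have h2 : (p^2)^k = p^k * p^k := by rw [← pow_mul, mul_comm 2, pow_mul, sq]
            rw [h2]
            have := mul_le_mul_of_nonneg_left h1 (by positivity : 0 ≤ 2 * r * p^k)
            linarith
  have hsub : Late φ ε (p^2) (M+1) r ⊆ ⋃ k, ⋃ n, A k n := by
    rintro x ⟨hU, n, hn, hs⟩
    obtain ⟨m, rfl⟩ := Nat.exists_eq_add_of_le hn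
    exact mem_iUnion.2 ⟨vis φ ε (M+1+m) x, mem_iUnion.2 ⟨m, hU, rfl, hs⟩⟩
  calc mu (Late φ ε (p^2) (M+1) r) ≤ mu (⋃ k, ⋃ n, A k n) := measure_mono hsub
    _ ≤ ∑' k, ∑' n, mu (A k n) := (measure_iUnion_le _).trans (ENNReal.tsum_le_tsum fun k => measure_iUnion_le _)
    _ ≤ ∑' k, ENNReal.ofReal (2 * r * p^k0 * p^k) := ENNReal.tsum_le_tsum hb
    _ = ENNReal.ofReal (2 * r * p^k0 * (1-p)⁻¹) := by
        rw [← tsum_geometric_of_lt_one hp0.le hp1, ← tsum_mul_left, ENNReal.ofReal_tsum_of_nonneg]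
        · intro k; positivity
        · exact (summable_geometric_of_lt_one hp0.le hp1).mul_left _
    _ ≤ _ := by
        refine ENNReal.ofReal_le_ofReal ?_
        have h1 : 0 < 1 - p := by linarith
        rw [← div_eq_mul_inv, div_le_iff₀ h1]
        nlinarith

end LTM

open scoped ENNReal

namespace LTM
variable {φ : ℝ → ℝ}

noncomputable def up (s : ℝ) (x : ℝ × ℝ) : ℝ × ℝ := (x.1, x.2 + s)

lemma meas_up (s : ℝ) : Measurable (up s) := by unfold up; fun_prop

lemma WPer.comp_up {β : Type*} {F : ℝ × ℝ → β} (hF : WPer F) (s : ℝ) : WPer (fun x => F (up s x)) := by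
  intro t w; simp only [up]
  rw [← hF t (w+s)]; congr 2; ring

lemma mu_up (s : ℝ) {A : Set (ℝ × ℝ)} (hA : MeasurableSet A) (hp : WPer (· ∈ A)) :
    mu (up s ⁻¹' A) = mu A := by
  have hF : Measurable (A.indicator (1 : ℝ × ℝ → ℝ≥0∞)) := measurable_one.indicator hA
  rw [ind_set _ (meas_up s hA), ind_set _ hA, mu_eq _ hF,
    mu_eq _ (measurable_one.indicator (meas_up s hA))]
  congr 1; ext t
  exact nu_shift (fun w => A.indicator 1 (t, w)) (wper_ind hp t) s

lemma not_good_pos {ε q r : ℝ} (hq : 0 < q) (hr : 0 < r) {x : ℝ × ℝ} (h : ¬ good φ ε q 1 r x) :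
    ∃ n, 1 ≤ n ∧ 1 - r * q ^ vis φ ε n x ≤ tt φ n x := by
  unfold good at h
  push Not at h
  obtain ⟨n, hn⟩ := h
  refine ⟨n+1, by omega, ?_⟩
  by_contra hc
  push Not at hc
  have := tt_nonneg (φ := φ) n x
  have : 0 < r * q ^ vis φ ε (n+1) x := by positivity
  exact hn ⟨by linarith, by linarith⟩

lemma not_good_neg {ε q r : ℝ} (hq : 0 < q) (hr : 0 < r) {x : ℝ × ℝ} (h : ¬ good φ ε q (-1) r x) :
    ∃ n, 1 ≤ n ∧ tt φ n x ≤ r * q ^ vis φ ε n x := by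
  unfold good at h
  push Not at h
  obtain ⟨n, hn⟩ := h
  refine ⟨n+1, by omega, ?_⟩
  by_contra hc
  push Not at hc
  have := tt_lt (φ := φ) n x
  have : 0 < r * q ^ vis φ ε (n+1) x := by positivity
  exact hn ⟨by linarith, by linarith⟩

def E2 (φ : ℝ → ℝ) (M : ℕ) (θ : ℝ) : Set (ℝ × ℝ) :=
  ⋃ i ∈ Finset.range M, ⋃ k ∈ Finset.range M, {x | tt φ i x ∈ SS θ ∧ tt φ (k+1+i) x ∈ SS θ}

lemma mem_E2 {M : ℕ} {θ : ℝ} {x : ℝ × ℝ} {i j : ℕ} (hij : i < j) (hj : j < M) (h1 : tt φ i x ∈ SS θ)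
    (h2 : tt φ j x ∈ SS θ) : x ∈ E2 φ M θ := by
  simp only [E2, mem_iUnion]
  refine ⟨i, Finset.mem_range.2 (by omega), j - i - 1, Finset.mem_range.2 (by omega), h1, ?_⟩
  have : j - i - 1 + 1 + i = j := by omega
  rw [this]; exact h2

lemma meas_E2 (h : Hyp φ) (M : ℕ) (θ : ℝ) : MeasurableSet (E2 φ M θ) :=
  Finset.measurableSet_biUnion _ fun i _ => Finset.measurableSet_biUnion _ fun k _ =>
    ((meas_tt h _) (meas_SS θ)).inter ((meas_tt h _) (meas_SS θ))

lemma wper_E2 (M : ℕ) (θ : ℝ) : WPer (· ∈ E2 φ M θ) := by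
  intro t w
  simp only [E2, mem_iUnion, mem_ofPred_eq, wper_tt _ t w]

lemma mu_E2 (h : Hyp φ) (M : ℕ) : ∃ C : ℝ, 0 ≤ C ∧ ∀ θ, 0 ≤ θ → mu (E2 φ M θ) ≤ ENNReal.ofReal (C * θ^2) := by
  choose C hC hb using fun i k : ℕ => two_time h i (k+1) (by omega)
  refine ⟨∑ i ∈ Finset.range M, ∑ k ∈ Finset.range M, C i k,
    Finset.sum_nonneg fun i _ => Finset.sum_nonneg fun k _ => hC i k, fun θ hθ => ?_⟩
  refine (measure_biUnion_finset_le _ _).trans ?_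
  rw [Finset.sum_mul, ENNReal.ofReal_sum_of_nonneg (fun i _ => mul_nonneg (Finset.sum_nonneg fun k _ => hC i k) (sq_nonneg θ))]
  refine Finset.sum_le_sum fun i _ => ?_
  refine (measure_biUnion_finset_le _ _).trans ?_
  rw [Finset.sum_mul, ENNReal.ofReal_sum_of_nonneg (fun k _ => mul_nonneg (hC i k) (sq_nonneg θ))]
  exact Finset.sum_le_sum fun k _ => hb i k θ hθ

lemma meas_Late (h : Hyp φ) (ε q : ℝ) (M : ℕ) (r : ℝ) : MeasurableSet (Late φ ε q M r) := by
  have : Late φ ε q M r = {x : ℝ × ℝ | x.1 ∈ Icc ε (1-ε)} ∩ ⋃ n, ⋃ (_ : M ≤ n),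
      ({x | tt φ n x ≤ r * q ^ vis φ ε n x} ∪ {x | 1 - r * q ^ vis φ ε n x ≤ tt φ n x}) := by
    ext x; simp [Late, SS]
  rw [this]
  refine (measurable_fst measurableSet_Icc).inter (MeasurableSet.iUnion fun n => MeasurableSet.iUnion fun _ => ?_)
  have h1 := meas_tt h n
  have h2 : Measurable (fun x => r * q ^ vis φ ε n x) :=
    ((measurable_from_nat (f := fun k => q ^ k)).comp (meas_vis h ε n)).const_mul _
  exact (measurableSet_le h1 h2).union (measurableSet_le (measurable_const.sub h2) h1)

lemma wper_Late (ε q : ℝ) (M : ℕ) (r : ℝ) : WPer (· ∈ Late φ ε q M r) := by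
  intro t w
  simp only [Late, mem_ofPred_eq, wper_tt _ t w, wper_vis _ _ t w]

lemma early1 (h : Hyp φ) {K : ℝ} (hK : 0 ≤ K) (hl : ∀ a b, |φ a - φ b| ≤ K * |a - b|)
    {M : ℕ} {r s θ : ℝ} (hr : 0 < r) (hs : 0 < s) (hθ : r + (2 + 2 * K)^M * s ≤ θ) (hθ1 : 2 * θ < 1)
    {x : ℝ × ℝ} {n m : ℕ} (hn : n < M) (hm : m < M)
    (h1 : 1 - r ≤ tt φ n (up s x)) (h2 : tt φ m x ≤ r) : x ∈ E2 φ M θ ∨ up s x ∈ E2 φ M θ := by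
  obtain ⟨N, hsame, hpos, hsep⟩ := first_sep h (x := x) (y := up s x) rfl (by simp [up]; exact hs)
  set e := ee φ x (up s x) with he
  have hgr := ee_grow h (x := x) (y := up s x) rfl (by simp [up]; exact hs.le) (N+1) hsame
  have hw : (up s x).2 - x.2 = s := by simp [up]
  rw [hw] at hgr
  have hnn : ∀ j, j ≤ N + 1 → 0 ≤ e j := by
    intro j hj
    cases j with
    | zero => simp [he, ee, up]
    | succ j =>
      have := hgr j (by omega)
      have hp : 0 ≤ (j:ℝ) * (2 * s) := by positivity
      linarith [this.1, this.2]
  have hup : ∀ j, j ≤ N → e j ≤ (2 + 2*K)^j * s ∧ e (j+1) ≤ (2 + 2 * K)^(j+1) * s := by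
    intro j
    induction j with
    | zero =>
      intro _
      refine ⟨by simp [he, ee, up]; exact hs.le, ?_⟩
      simp only [he, ee, bb, tt_zero, ww_zero, up, zero_add, pow_one]
      nlinarith
    | succ j ih =>
      intro hj
      have hh := ih (by omega)
      refine ⟨hh.2, ?_⟩
      have r1 := ee_rec (hsame j (by omega)) (hsame (j+1) (by omega))
      have r2 := hl (tt φ (j+1) (up s x)) (tt φ (j+1) x)
      rw [hsame (j+1) (by omega), abs_of_nonneg (hnn (j+1) (by omega))] at r2
      have r3 := (abs_le.1 r2).2
      have r4 := hnn j (by omega)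
      have : e (j+2) ≤ (2 + 2 * K) * e (j+1) := by linarith
      calc e (j+1+1) ≤ (2 + 2 * K) * e (j+1) := this
        _ ≤ (2 + 2*K) * ((2 + 2 * K)^(j+1) * s) := mul_le_mul_of_nonneg_left hh.2 (by linarith)
        _ = _ := by ring
  have hupM : ∀ j, j < M → j ≤ N + 1 → e j ≤ θ - r := by
    intro j hj hjN
    have h3 : e j ≤ (2 + 2*K)^j * s := by
      cases j with
      | zero => exact (hup 0 (by omega)).1
      | succ j => exact (hup j (by omega)).2
    have : (2 + 2*K)^j ≤ (2+2*K)^M := pow_le_pow_right₀ (by linarith) hj.le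
    nlinarith
  have hJ : N + 1 < M → tt φ (N+1) x ∈ SS θ ∧ tt φ (N+1) (up s x) ∈ SS θ ∧ 1 - θ ≤ tt φ (N+1) x ∧
      tt φ (N+1) (up s x) ≤ θ - r := by
    intro hJM
    have := hupM (N+1) hJM le_rfl
    have a1 := tt_nonneg (φ := φ) N (up s x)
    have a2 := tt_lt (φ := φ) N x
    have b1 : 1 - θ ≤ tt φ (N+1) x := by linarith
    have b2 : tt φ (N+1) (up s x) ≤ θ - r := by linarith
    exact ⟨Or.inr b1, Or.inl (by linarith), b1, b2⟩
  have hpM : 0 < (2 + 2*K)^M * s := by positivity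
  rcases lt_trichotomy (N+1) m with c1 | c1 | c1
  · left
    exact mem_E2 c1 hm (hJ (by omega)).1 (Or.inl (by linarith))
  · subst c1
    have := (hJ hm).2.2.1; exfalso; linarith
  · rcases lt_trichotomy (N+1) n with c2 | c2 | c2
    · right
      exact mem_E2 c2 hn (hJ (by omega)).2.1 (Or.inr (by linarith))
    · subst c2
      have := (hJ hn).2.2.2; exfalso; linarith
    · left
      have a1 := hsame n c2
      have a2 := hupM n hn (by omega)
      have a3 : 1 - θ ≤ tt φ n x := by linarith
      rcases lt_trichotomy n m with d | d | d
      · exact mem_E2 d hm (Or.inr a3) (Or.inl (by linarith))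
      · subst d; exfalso; linarith
      · exact mem_E2 d hn (Or.inl (by linarith)) (Or.inr a3)

lemma TRTn (m : ℕ) (y : ℝ × ℝ) (hy : y.1 ∈ Ico (0:ℝ) 1) :
    (T φ)^[m] (R φ ((T φ)^[m] (R φ y))) = y := by
  have := rev_iter (φ := φ) 0 m (R φ y) hy
  rw [zero_add] at this
  rw [this]; exact R_R y

lemma early2 {M : ℕ} {θ : ℝ} {y : ℝ × ℝ} (hy : y.1 ∈ Ico (0:ℝ) 1) {n m : ℕ} (hn : n < M) (hn1 : 1 ≤ n) (hm : m < M)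
    (h1 : tt φ n y ∈ SS θ) (h2 : tt φ m (R φ y) ∈ SS θ) :
    R φ ((T φ)^[m] (R φ y)) ∈ E2 φ (2*M) θ := by
  refine mem_E2 (i := 0) (j := n + m) (by omega) (by omega) h2 ?_
  rw [tt_add, TRTn m y hy]; exact h1

def Bad (φ : ℝ → ℝ) (ε q r s : ℝ) : Set (ℝ × ℝ) :=
  {x | x.1 ∈ Icc ε (1-ε) ∧ (¬ good φ ε q 1 r (up s x) ∨ ¬ good φ ε q 1 r (R φ x)) ∧
    (¬ good φ ε q (-1) r x ∨ ¬ good φ ε q (-1) r (R φ (up s x)))}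

lemma bad_small (h : Hyp φ) {ε : ℝ} (hSm : Sm φ ε) {p : ℝ} (hp0 : 0 < p) (hp1 : p < 1) {A : ℝ} (hA : 0 ≤ A)
    {δ : ℝ} (hδ : 0 < δ) : ∃ r₀ > 0, ∀ r, 0 < r → r ≤ r₀ → ∀ s, 0 < s → s ≤ A * r →
      mu (Bad φ ε (p^2) r s) ≤ ENNReal.ofReal (δ * r) := by
  obtain ⟨M, hM⟩ := late h hSm hp0 hp1 (show 0 < δ / 8 by linarith)
  obtain ⟨K, hK, hl⟩ := h.lip
  obtain ⟨C, hC, hE⟩ := mu_E2 h (2*M)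
  set B : ℝ := 1 + (2+2*K)^M * A with hB
  have hB1 : 1 ≤ B := by
    have : 0 ≤ (2+2*K)^M * A := by positivity
    linarith
  refine ⟨min (1/(4*B)) (δ / (8 * (5 + M) * (C * B^2 + 1))), by positivity, fun r hr hr0 s hs hsr => ?_⟩
  rw [le_min_iff, le_div_iff₀ (by positivity), le_div_iff₀ (by positivity)] at hr0
  set θ := B * r with hθ
  have hθ0 : 0 < θ := by positivity
  have hq : 0 < p^2 := by positivity
  have hq1 : p^2 ≤ 1 := pow_le_one₀ hp0.le hp1.le
  have hrθ : r ≤ θ := by nlinarith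
  have hθs : r + (2+2*K)^M * s ≤ θ := by
    have : (2+2*K)^M * s ≤ (2+2*K)^M * (A * r) := by gcongr
    rw [hθ, hB]; linarith
  have hE2mono : E2 φ M θ ⊆ E2 φ (2*M) θ := by
    intro x hx
    simp only [E2, mem_iUnion, Finset.mem_range] at hx ⊢
    obtain ⟨i, hi, k, hk, hh⟩ := hx
    exact ⟨i, by omega, k, by omega, hh⟩
  let LL := Late φ ε (p^2) M r
  let EE := E2 φ (2*M) θ
  have hLm : MeasurableSet LL := meas_Late h _ _ _ _
  have hLp : WPer (· ∈ LL) := wper_Late _ _ _ _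
  have hEm : MeasurableSet EE := meas_E2 h _ _
  have hEp : WPer (· ∈ EE) := wper_E2 _ _
  let G : ℕ → Set (ℝ × ℝ) := fun m => {y | R φ ((T φ)^[m] (R φ y)) ∈ EE}
  have hGm : ∀ m, MeasurableSet (G m) := fun m => (meas_R h).comp ((meas_iter h m).comp (meas_R h)) hEm
  have hGp : ∀ m, WPer (· ∈ G m) := fun m =>
    (((hEp.comp_R (φ := φ)).comp_iter (φ := φ) m).comp_R (φ := φ))
  have hGmu : ∀ m, mu (G m) = mu EE := by
    intro m
    have : G m = R φ ⁻¹' ((T φ)^[m] ⁻¹' (R φ ⁻¹' EE)) := rfl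
    rw [this, mu_R h (meas_iter h m (meas_R h hEm)) ((hEp.comp_R (φ := φ)).comp_iter (φ := φ) m),
      mu_iter h m (meas_R h hEm) (hEp.comp_R (φ := φ)), mu_R h hEm hEp]
  let GG := ⋃ m ∈ Finset.range M, G m
  have hGGm : MeasurableSet GG := Finset.measurableSet_biUnion _ fun m _ => hGm m
  have hGGp : WPer (· ∈ GG) := by
    intro t w
    simp only [GG, mem_iUnion]
    have : ∀ m, ((t, w+1) ∈ G m) = ((t,w) ∈ G m) := fun m => hGp m t w
    simp only [this]
  have hGGmu : mu GG ≤ M * mu EE := by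
    refine (measure_biUnion_finset_le _ _).trans ?_
    simp only [hGmu, Finset.sum_const, Finset.card_range, nsmul_eq_mul, le_refl]
  -- inclusion
  have hsub : Bad φ ε (p^2) r s ⊆ (((LL ∪ up s ⁻¹' LL) ∪ (R φ ⁻¹' LL ∪ up s ⁻¹' (R φ ⁻¹' LL))) ∪
      ((EE ∪ up s ⁻¹' EE) ∪ (R φ ⁻¹' EE ∪ up s ⁻¹' (R φ ⁻¹' EE)))) ∪ (GG ∪ up s ⁻¹' GG) := by
    rintro x ⟨hU, hP, hN⟩
    by_contra hcon
    simp only [mem_union, mem_preimage, not_or] at hcon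
    obtain ⟨⟨⟨⟨l1, l2⟩, l3, l4⟩, ⟨e1, e2⟩, e3, e4⟩, g1, g2⟩ := hcon
    have hU0 : x.1 ∈ Ico (0:ℝ) 1 := ⟨by linarith [hU.1, hSm.pos], by linarith [hU.2, hSm.pos]⟩
    have earlyP : ∀ y : ℝ × ℝ, y.1 ∈ Icc ε (1-ε) → y ∉ LL → ¬ good φ ε (p^2) 1 r y →
        ∃ n, 1 ≤ n ∧ n < M ∧ 1 - r ≤ tt φ n y := by
      intro y hy hyL hg
      obtain ⟨n, hn1, hn⟩ := not_good_pos hq hr hg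
      refine ⟨n, hn1, ?_, ?_⟩
      · by_contra hc
        exact hyL ⟨hy, n, by omega, Or.inr hn⟩
      · have : (p^2)^vis φ ε n y ≤ 1 := pow_le_one₀ hq.le hq1
        nlinarith
    have earlyN : ∀ y : ℝ × ℝ, y.1 ∈ Icc ε (1-ε) → y ∉ LL → ¬ good φ ε (p^2) (-1) r y →
        ∃ n, 1 ≤ n ∧ n < M ∧ tt φ n y ≤ r := by
      intro y hy hyL hg
      obtain ⟨n, hn1, hn⟩ := not_good_neg hq hr hg
      refine ⟨n, hn1, ?_, ?_⟩
      · by_contra hc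
        exact hyL ⟨hy, n, by omega, Or.inl hn⟩
      · have : (p^2)^vis φ ε n y ≤ 1 := pow_le_one₀ hq.le hq1
        nlinarith
    have hGG : ∀ (y : ℝ × ℝ) (m : ℕ), m < M → R φ ((T φ)^[m] (R φ y)) ∈ EE → y ∈ GG := by
      intro y m hm hy
      simp only [GG, mem_iUnion]
      exact ⟨m, Finset.mem_range.2 hm, hy⟩
    have hθ1 : 2 * θ < 1 := by rw [hθ]; nlinarith
    rcases hP with hP | hP <;> rcases hN with hN | hN
    · obtain ⟨n, hn1, hn, hh⟩ := earlyP (up s x) hU l2 hP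
      obtain ⟨m, hm1, hm, hh'⟩ := earlyN x hU l1 hN
      rcases early1 h hK hl hr hs hθs hθ1 hn hm hh hh' with hx | hx
      · exact e1 (hE2mono hx)
      · exact e2 (hE2mono hx)
    · obtain ⟨n, hn1, hn, hh⟩ := earlyP (up s x) hU l2 hP
      obtain ⟨m, hm1, hm, hh'⟩ := earlyN (R φ (up s x)) hU l4 hN
      exact g2 (hGG (up s x) m hm (early2 (y := up s x) hU0 hn hn1 hm (Or.inr (by linarith)) (Or.inl (by linarith))))
    · obtain ⟨n, hn1, hn, hh⟩ := earlyP (R φ x) hU l3 hP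
      obtain ⟨m, hm1, hm, hh'⟩ := earlyN x hU l1 hN
      exact g1 (hGG x n hn (early2 (y := x) hU0 hm hm1 hn (Or.inl (by linarith)) (Or.inr (by linarith))))
    · obtain ⟨n, hn1, hn, hh⟩ := earlyP (R φ x) hU l3 hP
      obtain ⟨m, hm1, hm, hh'⟩ := earlyN (R φ (up s x)) hU l4 hN
      have ex : up s (R φ (up s x)) = R φ x := by simp [up, R]; ring
      rw [← ex] at hh
      rcases early1 h hK hl hr hs hθs hθ1 hn hm hh hh' with hx | hx
      · exact e4 (hE2mono hx)
      · rw [ex] at hx; exact e3 (hE2mono hx)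
  have hLmu : mu LL ≤ ENNReal.ofReal (δ / 8 * r) := hM r hr.le
  have hEmu : mu EE ≤ ENNReal.ofReal (C * θ^2) := hE θ hθ0.le
  have hRL := hLp.comp_R (φ := φ)
  have hRE := hEp.comp_R (φ := φ)
  calc mu (Bad φ ε (p^2) r s) ≤ _ := measure_mono hsub
    _ ≤ (((mu LL + mu (up s ⁻¹' LL)) + (mu (R φ ⁻¹' LL) + mu (up s ⁻¹' (R φ ⁻¹' LL)))) +
      ((mu EE + mu (up s ⁻¹' EE)) + (mu (R φ ⁻¹' EE) + mu (up s ⁻¹' (R φ ⁻¹' EE))))) + (mu GG + mu (up s ⁻¹' GG)) := by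
        refine (measure_union_le _ _).trans (add_le_add ((measure_union_le _ _).trans (add_le_add
          ((measure_union_le _ _).trans (add_le_add (measure_union_le _ _) (measure_union_le _ _)))
          ((measure_union_le _ _).trans (add_le_add (measure_union_le _ _) (measure_union_le _ _))))) (measure_union_le _ _))
    _ = 4 * mu LL + 4 * mu EE + 2 * mu GG := by
        rw [mu_up s hLm hLp, mu_up s (meas_R h hLm) hRL, mu_R h hLm hLp, mu_up s hEm hEp,
          mu_up s (meas_R h hEm) hRE, mu_R h hEm hEp, mu_up s hGGm hGGp]
        ring
    _ ≤ 4 * ENNReal.ofReal (δ / 8 * r) + 4 * ENNReal.ofReal (C * θ^2) + 2 * (M * ENNReal.ofReal (C * θ^2)) := by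
        gcongr
        exact hGGmu.trans (by gcongr)
    _ = ENNReal.ofReal (4 * (δ / 8 * r) + 4 * (C * θ^2) + 2 * (M * (C * θ^2))) := by
        rw [ENNReal.ofReal_add (by positivity) (by positivity), ENNReal.ofReal_add (by positivity) (by positivity),
          ENNReal.ofReal_mul (p := 4) (by norm_num), ENNReal.ofReal_mul (p := 4) (by norm_num), ENNReal.ofReal_mul (p := 2) (by norm_num),
          ENNReal.ofReal_mul (p := (M:ℝ)) (by positivity), ENNReal.ofReal_natCast]
        norm_num
    _ ≤ _ := by
        refine ENNReal.ofReal_le_ofReal ?_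
        have h1 := mul_le_mul_of_nonneg_left hr0.2 hr.le
        have h2 : 0 ≤ C * B^2 := by positivity
        have h3 : C * θ^2 = (C * B^2) * r * r := by rw [hθ]; ring
        rw [h3]
        have h4 : 0 ≤ (M:ℝ) := by positivity
        set X := C * B^2 with hX
        have h5 : 0 ≤ X * r * r := by positivity
        have h6 : 0 ≤ X * r * r * M := by positivity
        have h7 : 0 ≤ r * r * M := by positivity
        have h8 : 0 ≤ r * r := by positivity
        nlinarith

end LTM

open scoped ENNReal

namespace LTM
variable {φ : ℝ → ℝ}

noncomputable def PP (x : ℝ × ℝ) : ℝ × AddCircle (1:ℝ) := (x.1, (x.2 : AddCircle (1:ℝ)))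

lemma PP_cont : Continuous PP := by
  unfold PP
  exact continuous_fst.prodMk ((AddCircle.continuous_mk' (1:ℝ)).comp continuous_snd)

lemma PP_dist (x y : ℝ × ℝ) : dist (PP x) (PP y) ≤ dist x y := by
  rw [Prod.dist_eq, Prod.dist_eq]
  refine max_le_max le_rfl ?_
  rw [dist_eq_norm, dist_eq_norm]
  simp only [PP, ← AddCircle.coe_sub]
  exact QuotientAddGroup.norm_mk_le_norm

lemma approx {u : ℝ × ℝ → ℝ} (hu : Measurable u) (hb : ∀ x, |u x| ≤ 1) (hp : WPer u) {η : ℝ≥0∞} (hη : η ≠ 0) :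
    ∃ F : ℝ × ℝ → ℝ, Continuous F ∧ UniformContinuous F ∧ WPer F ∧ ∫⁻ x, ‖u x - F x‖ₑ ∂mu ≤ η := by
  haveI : Fact ((0:ℝ) < 1) := ⟨one_pos⟩
  let m : Measure (ℝ × AddCircle (1:ℝ)) := mu.map PP
  haveI : IsProbabilityMeasure m := Measure.isProbabilityMeasure_map PP_cont.measurable.aemeasurable
  let H : ℝ × AddCircle (1:ℝ) → ℝ := fun y => u (y.1, (AddCircle.equivIco (1:ℝ) 0 y.2 : ℝ))
  have hH : Measurable H := by
    refine hu.comp (measurable_fst.prodMk ?_)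
    exact measurable_subtype_coe.comp ((AddCircle.measurableEquivIco (1:ℝ) 0).measurable.comp measurable_snd)
  have hHi : Integrable H m := by
    refine Integrable.of_bound hH.aestronglyMeasurable 1 (ae_of_all _ fun y => ?_)
    exact hb _
  obtain ⟨F, hF1, hF2, hF3, -⟩ := hHi.exists_hasCompactSupport_lintegral_sub_le hη
  have hUF : UniformContinuous F := hF1.uniformContinuous_of_continuous hF3
  refine ⟨fun x => F (PP x), hF3.comp PP_cont, ?_, ?_, ?_⟩
  · exact hUF.comp (LipschitzWith.uniformContinuous (K := 1) (LipschitzWith.of_dist_le_mul fun x y => by simpa using PP_dist x y))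
  · intro t w
    simp [PP]
  · rw [lintegral_map (by have := hF3.measurable; fun_prop) PP_cont.measurable] at hF2
    refine le_trans (le_of_eq ?_) hF2
    refine lintegral_congr_ae ?_
    filter_upwards [ae_mem] with x hx
    have : H (PP x) = u x := by
      simp only [H, PP]
      rw [AddCircle.equivIco_coe_of_mem (by simpa using hx.2)]
    simp only [this]

lemma inv_iter (h : Hyp φ) {u : ℝ × ℝ → ℝ} (hu : Measurable u) (hp : WPer u)
    (hinv : ∀ᵐ x ∂mu, u (T φ x) = u x) (n : ℕ) : ∀ᵐ x ∂mu, u ((T φ)^[n] x) = u x := by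
  induction n with
  | zero => exact ae_of_all _ fun x => rfl
  | succ n ih =>
    have hN : MeasurableSet {x | u (T φ x) ≠ u x} := (measurableSet_eq_fun (hu.comp (meas_T h)) hu).compl
    have hw : WPer (· ∈ {x | u (T φ x) ≠ u x}) := by
      intro t w
      have h1 := hp t w
      have h2 := (hp.comp_T (φ := φ)) t w
      simp only [mem_ofPred_eq, h1, h2]
    have : mu ((T φ)^[n] ⁻¹' {x | u (T φ x) ≠ u x}) = 0 := by
      rw [mu_iter h n hN hw]; exact hinv
    have h3 : ∀ᵐ x ∂mu, ¬ (x ∈ (T φ)^[n] ⁻¹' {x | u (T φ x) ≠ u x}) := measure_eq_zero_iff_ae_notMem.1 this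
    filter_upwards [ih, h3] with x h1 h2
    simp only [mem_preimage, mem_ofPred_eq, not_not] at h2
    rw [Function.iterate_succ_apply', h2, h1]

lemma inv_R (h : Hyp φ) {u : ℝ × ℝ → ℝ} (hu : Measurable u) (hp : WPer u)
    (hinv : ∀ᵐ x ∂mu, u (T φ x) = u x) : ∀ᵐ x ∂mu, u (R φ (T φ x)) = u (R φ x) := by
  have hN : MeasurableSet {x | u (T φ x) ≠ u x} := (measurableSet_eq_fun (hu.comp (meas_T h)) hu).compl
  have hw : WPer (· ∈ {x | u (T φ x) ≠ u x}) := by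
    intro t w
    have h1 := hp t w
    have h2 := (hp.comp_T (φ := φ)) t w
    simp only [mem_ofPred_eq, h1, h2]
  have : mu ((T φ)^[1] ⁻¹' (R φ ⁻¹' {x | u (T φ x) ≠ u x})) = 0 := by
    rw [mu_iter h 1 (meas_R h hN) (hw.comp_R (φ := φ)), mu_R h hN hw]; exact hinv
  have h3 : ∀ᵐ x ∂mu, ¬ (x ∈ (T φ)^[1] ⁻¹' (R φ ⁻¹' {x | u (T φ x) ≠ u x})) := measure_eq_zero_iff_ae_notMem.1 this
  filter_upwards [ae_mem, h3] with x h1 h2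
  simp only [mem_preimage, mem_ofPred_eq, not_not, Function.iterate_one] at h2
  rw [← h2, TRT x h1.1]

lemma hopf (h : Hyp φ) {u : ℝ × ℝ → ℝ} (hu : Measurable u) (hb : ∀ x, |u x| ≤ 1) (hp : WPer u)
    (hinv : ∀ᵐ x ∂mu, u (T φ x) = u x) :
    ∃ G : Set (ℝ × ℝ), MeasurableSet G ∧ WPer (· ∈ G) ∧ mu Gᶜ = 0 ∧
      ∀ (σ : ℝ) (x : ℝ × ℝ) (τ : ℝ) (d : ℕ → ℝ), (σ = 1 ∨ σ = -1) → τ ≤ 1 → Dec (psi φ σ x) τ d →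
        (∀ n, tt φ (n+1) x + σ * d (n+1) ∈ Ico (0:ℝ) 1) → x ∈ G → lpt σ x τ (d 1) ∈ G →
        u x = u (lpt σ x τ (d 1)) := by
  choose F hFc hFu hFp hFi using fun k : ℕ => approx hu hb hp (η := (2⁻¹ : ℝ≥0∞) ^ k) (by simp)
  choose δ hδ hδF using fun k : ℕ => (Metric.uniformContinuous_iff.1 (hFu k)) (1 / ((k:ℝ) + 1)) (by positivity)
  choose m hm using fun k : ℕ => unif_rate h (hδ k)
  let D : ℕ → ℝ × ℝ → ℝ := fun k x => F k ((T φ)^[m k] x) - u x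
  have hDm : ∀ k, Measurable (D k) := fun k => ((hFc k).measurable.comp (meas_iter h _)).sub hu
  refine ⟨{x | Tendsto (fun k => D k x) atTop (nhds 0)}, ?_, ?_, ?_, ?_⟩
  · exact measurableSet_tendsto _ hDm
  · intro t w
    have h1 : ∀ k, D k (t, w+1) = D k (t, w) := by
      intro k
      have h1 := hp t w
      have h2 := ((hFp k).comp_iter (φ := φ) (m k)) t w
      simp only [D, h1, h2]
    simp only [mem_ofPred_eq, h1]
  · have h1 : ∀ k, ∫⁻ x, ‖D k x‖ₑ ∂mu ≤ (2⁻¹ : ℝ≥0∞)^k := by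
      intro k
      refine le_trans (le_of_eq ?_) (hFi k)
      have h2 : WPer (fun x => ‖u x - F k x‖ₑ) := by
        intro t w
        have h1 := hp t w
        have h2 := (hFp k) t w
        simp only [h1, h2]
      rw [← int_iter h (m k) _ (by have := (hFc k).measurable; fun_prop) h2]
      refine lintegral_congr_ae ?_
      filter_upwards [inv_iter h hu hp hinv (m k)] with x hx
      simp only [D, hx]
      rw [← enorm_neg]; congr 1; ring
    have h2 : ∫⁻ x, ∑' k, ‖D k x‖ₑ ∂mu ≠ ∞ := by
      rw [lintegral_tsum fun k => (hDm k).enorm.aemeasurable]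
      refine ne_top_of_le_ne_top ?_ (ENNReal.tsum_le_tsum h1)
      rw [ENNReal.tsum_geometric]
      simp
    have h3 := ae_lt_top (Measurable.ennreal_tsum fun k => (hDm k).enorm) h2
    have h4 : ∀ᵐ x ∂mu, x ∈ {x | Tendsto (fun k => D k x) atTop (nhds 0)} := by
      filter_upwards [h3] with x hx
      have := ENNReal.tendsto_atTop_zero_of_tsum_ne_top hx.ne
      rw [tendsto_zero_iff_enorm_tendsto_zero]
      exact this
    exact h4
  · intro σ x τ d hσ hτ hd hmem hx hy
    set y := lpt σ x τ (d 1) with hyd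
    have h1 : Tendsto (fun k => D k x - D k y) atTop (nhds 0) := by simpa using hx.sub hy
    have h2 : Tendsto (fun k => F k ((T φ)^[m k] x) - F k ((T φ)^[m k] y)) atTop (nhds 0) := by
      refine squeeze_zero_norm (fun k => ?_) tendsto_one_div_add_atTop_nhds_zero_nat
      have ho := leaf_orbit hσ hd hmem (m k)
      have hr := hm k σ x τ d hσ hτ hd hmem (m k) le_rfl
      have h0 := hd.nonneg (m k)
      have h0' := hd.nonneg (m k + 1)
      have h0'' := hd.anti (m k)
      have hσa : |σ| = 1 := by rcases hσ with rfl | rfl <;> simp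
      have hdist : dist ((T φ)^[m k] x) ((T φ)^[m k] y) < δ k := by
        rw [Prod.dist_eq]
        refine max_lt ?_ ?_
        · rw [Real.dist_eq]
          have : ((T φ)^[m k] y).1 = ((T φ)^[m k] x).1 + σ * d (m k) := ho.1
          rw [this, sub_add_cancel_left, abs_neg, abs_mul, hσa, one_mul, abs_of_nonneg h0]; exact hr
        · rw [Real.dist_eq]
          have : ((T φ)^[m k] y).2 = ((T φ)^[m k] x).2 - σ * (d (m k) - d (m k + 1)) / 2 := ho.2
          rw [this, sub_sub_cancel, mul_div_assoc, abs_mul, hσa, one_mul, abs_of_nonneg (by linarith)]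
          linarith
      have := hδF k hdist
      rw [Real.dist_eq] at this
      exact this.le
    have h3 := h2.sub h1
    have h4 : (fun k => F k ((T φ)^[m k] x) - F k ((T φ)^[m k] y) - (D k x - D k y)) = fun _ => u x - u y := by
      ext k; simp only [D]; ring
    rw [h4] at h3
    have := tendsto_nhds_unique h3 tendsto_const_nhds
    linarith

end LTM

open scoped ENNReal NNReal

namespace LTM
variable {φ : ℝ → ℝ}

lemma null_of_antilip {W N : Set (ℝ × ℝ)} (hN : volume N = 0) (K : ℝ≥0) (Z : ℝ × ℝ → ℝ × ℝ)
    (hZ : ∀ p ∈ W, Z p ∈ N) (hl : ∀ p ∈ W, ∀ p' ∈ W, dist p p' ≤ K * dist (Z p) (Z p')) : volume W = 0 := by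
  have hinj : InjOn Z W := by
    intro p hp p' hp' he
    have := hl p hp p' hp'
    rw [he, dist_self, mul_zero] at this
    exact dist_le_zero.1 this
  have himg : W = Function.invFunOn Z W '' (Z '' W) := by
    rw [image_image]
    symm
    ext p
    constructor
    · rintro ⟨p', hp', rfl⟩
      have := hinj.leftInvOn_invFunOn hp'
      simp only [this]; exact hp'
    · intro hp
      exact ⟨p, hp, hinj.leftInvOn_invFunOn hp⟩
  have hlip : LipschitzOnWith K (Function.invFunOn Z W) (Z '' W) := by
    refine LipschitzOnWith.of_dist_le_mul ?_
    rintro _ ⟨p, hp, rfl⟩ _ ⟨p', hp', rfl⟩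
    rw [hinj.leftInvOn_invFunOn hp, hinj.leftInvOn_invFunOn hp']
    exact hl p hp p' hp'
  have h1 := hlip.hausdorffMeasure_image_le (d := 2) (by norm_num)
  rw [← himg, hausdorffMeasure_prod_real] at h1
  have h2 : volume (Z '' W) = 0 := measure_mono_null (by rintro _ ⟨p, hp, rfl⟩; exact hZ p hp) hN
  rw [h2, mul_zero] at h1
  exact le_antisymm h1 bot_le

lemma per_null {S : Set ℝ} (hp : ∀ w, (w + 1 ∈ S) = (w ∈ S)) (h0 : nu S = 0) (hS : MeasurableSet S) : volume S = 0 := by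
  have hper : Function.Periodic (· ∈ S) 1 := hp
  have h1 : S ⊆ ⋃ n : ℤ, (fun w : ℝ => w - n) ⁻¹' (S ∩ Ico 0 1) := by
    intro w hw
    refine mem_iUnion.2 ⟨⌊w⌋, ?_⟩
    simp only [mem_preimage]
    rw [Int.self_sub_floor]
    refine ⟨?_, Int.fract_nonneg _, Int.fract_lt_one _⟩
    have := hper.sub_int_mul_eq (x := w) ⌊w⌋
    rw [mul_one, Int.self_sub_floor] at this
    exact (eq_iff_iff.1 this).2 hw
  refine measure_mono_null h1 (measure_iUnion_null fun n => ?_)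
  simp only [sub_eq_add_neg]
  rw [measure_preimage_add_right]
  rw [nu, Measure.restrict_apply hS] at h0
  exact h0

lemma ae_line {G : Set (ℝ × ℝ)} (hG : MeasurableSet G) (hp : WPer (· ∈ G)) (h0 : mu G = 0) :
    ∀ᵐ t ∂nu, volume {w | (t, w) ∈ G} = 0 := by
  rw [mu, Measure.measure_prod_null hG] at h0
  filter_upwards [h0] with t ht
  exact per_null (S := {w | (t,w) ∈ G}) (fun w => hp t w) ht (measurable_prodMk_left hG)

lemma strip_null {G : Set (ℝ × ℝ)} (hG : MeasurableSet G) (hp : WPer (· ∈ G)) (h0 : mu G = 0) :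
    volume {z : ℝ × ℝ | z.1 ∈ Ico (0:ℝ) 1 ∧ z ∈ G} = 0 := by
  have hm : MeasurableSet {z : ℝ × ℝ | z.1 ∈ Ico (0:ℝ) 1 ∧ z ∈ G} := (measurable_fst measurableSet_Ico).inter hG
  rw [Measure.volume_eq_prod, Measure.measure_prod_null hm]
  have := ae_line hG hp h0
  rw [nu, ae_restrict_iff' measurableSet_Ico] at this
  filter_upwards [this] with t ht
  by_cases h1 : t ∈ Ico (0:ℝ) 1
  · exact measure_mono_null (fun w hw => hw.2) (ht h1)
  · have : (Prod.mk t ⁻¹' {z : ℝ × ℝ | z.1 ∈ Ico (0:ℝ) 1 ∧ z ∈ G}) = ∅ := by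
      ext w; simp only [mem_preimage, mem_ofPred_eq, h1, false_and, mem_empty_iff_false]
    rw [this]; simp

lemma leaf_lip (h : Hyp φ) {σ : ℝ} (hσ : σ = 1 ∨ σ = -1) {x : ℝ × ℝ} {τ τ' : ℝ} {d d' : ℕ → ℝ}
    (hd : Dec (psi φ σ x) τ d) (hd' : Dec (psi φ σ x) τ' d') :
    |d 1 - d' 1| ≤ |τ - τ'| ∧ |(τ - d 1) - (τ' - d' 1)| ≤ |τ - τ'| := by
  rcases le_total τ τ' with hle | hle
  · have := dec_compare _ (psi_mono h hσ x) hd hd' hle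
    rw [abs_of_nonpos (by linarith : τ - τ' ≤ 0)]
    constructor <;> rw [abs_le] <;> constructor <;> linarith
  · have := dec_compare _ (psi_mono h hσ x) hd' hd hle
    rw [abs_of_nonneg (by linarith : 0 ≤ τ - τ')]
    constructor <;> rw [abs_le] <;> constructor <;> linarith

lemma leaf_gap {ε c q : ℝ} (h : Hyp φ) (hc : Cst φ ε c q) {L : ℝ} (hL0 : 0 ≤ L)
    (hL : ∀ a b a' b', a ∈ Icc (0:ℝ) 1 → b ∈ Icc (0:ℝ) 1 → a' ∈ Icc (0:ℝ) 1 →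
      b' ∈ Icc (0:ℝ) 1 → a < b → a' < b' →
      (φ b' - φ a') / (b' - a') ≤ (φ b - φ a) / (b - a) + L * (|a - a'| + |b - b'|))
    {σ : ℝ} (hσ : σ = 1 ∨ σ = -1) {r : ℝ} (hr0 : 0 < r) (hr : r ≤ ε / 2) {κ : ℝ}
    {x y : ℝ × ℝ} (hxy : x.1 = y.1)
    (gx : good φ ε q σ r x) (gy : good φ ε q σ r y) (Dx : Dle φ ε q κ x) (Dy : Dle φ ε q κ y)
    {τ τ' : ℝ} (hτ : τ ≤ r / 2) {d d' : ℕ → ℝ} (hd : Dec (psi φ σ x) τ d) (hd' : Dec (psi φ σ y) τ' d') :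
    |x.2 - y.2| ≤ 2 * Real.exp (2 * L * κ) * (|(lpt σ x τ (d 1)).2 - (lpt σ y τ' (d' 1)).2| + |τ - τ'|) := by
  have hτ0 : 0 ≤ τ := hd.zero ▸ hd.nonneg 0
  obtain ⟨d2, hd2⟩ := exists_leaf h hσ y hτ0
  have h1 : |x.2 - y.2| ≤ 2 * Real.exp (2 * L * κ) * |(lpt σ x τ (d 1)).2 - (lpt σ y τ (d2 1)).2| := by
    rcases lt_trichotomy x.2 y.2 with hl | hl | hl
    · have := gap h hc hL0 hL hσ hr0 hr hxy hl gx gy Dx Dy hτ hd hd2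
      rw [abs_sub_comm x.2, abs_of_pos (by linarith), abs_sub_comm]
      exact this.trans (mul_le_mul_of_nonneg_left (le_abs_self _) (by positivity))
    · rw [hl, sub_self, abs_zero]; positivity
    · have := gap h hc hL0 hL hσ hr0 hr hxy.symm hl gy gx Dy Dx hτ hd2 hd
      rw [abs_of_pos (by linarith)]
      exact this.trans (mul_le_mul_of_nonneg_left (le_abs_self _) (by positivity))
  have h2 := (leaf_lip h hσ hd' hd2).2
  refine h1.trans (mul_le_mul_of_nonneg_left ?_ (by positivity))
  have h3 : |(lpt σ y τ' (d' 1)).2 - (lpt σ y τ (d2 1)).2| ≤ |τ - τ'| := by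
    have hσa : |σ| = 1 := by rcases hσ with rfl | rfl <;> simp
    have : (lpt σ y τ' (d' 1)).2 - (lpt σ y τ (d2 1)).2 = -(σ * ((τ' - d' 1) - (τ - d2 1))) / 2 := by
      simp only [lpt]; ring
    rw [this, abs_div, abs_neg, abs_mul, hσa, one_mul, abs_two]
    rw [abs_sub_comm τ' τ] at h2
    have := abs_nonneg ((τ' - d' 1) - (τ - d2 1))
    linarith
  calc _ = |((lpt σ x τ (d 1)).2 - (lpt σ y τ' (d' 1)).2) + ((lpt σ y τ' (d' 1)).2 - (lpt σ y τ (d2 1)).2)| := by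
        congr 1; ring
    _ ≤ _ := abs_add_le _ _
    _ ≤ _ := by gcongr

/-- crossing configuration -/
def Cross (φ : ℝ → ℝ) (σ r : ℝ) (A B z : ℝ × ℝ) : Prop :=
  ∃ τ d d', 0 ≤ τ ∧ τ ≤ r / 2 ∧ Dec (psi φ σ A) τ d ∧ Dec (psi φ σ (R φ B)) τ d' ∧
    z = lpt σ A τ (d 1) ∧ R φ z = lpt σ (R φ B) τ (d' 1)

lemma exists_cross (h : Hyp φ) {ε c q : ℝ} (hc : Cst φ ε c q) {σ : ℝ} (hσ : σ = 1 ∨ σ = -1) {r : ℝ} (hr0 : 0 < r)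
    (hr : r ≤ ε / 2) {A B : ℝ × ℝ} (hAB : A.1 = B.1) (hU : A.1 ∈ Icc ε (1-ε)) (h1 : 0 < σ * (A.2 - B.2))
    (h2 : σ * (A.2 - B.2) < c * r / 2) : ∃ z, Cross φ σ r A B z := by
  choose D hD using fun τ : ℝ => exists_leaf h hσ A (le_max_right τ 0 : 0 ≤ max τ 0)
  choose D' hD' using fun τ : ℝ => exists_leaf h hσ (R φ B) (le_max_right τ 0 : 0 ≤ max τ 0)
  have hmx : ∀ a b : ℝ, |max a 0 - max b 0| ≤ |a - b| := fun a b => abs_max_sub_max_le_abs a b 0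
  have hcD : Continuous (fun τ => D τ 1) := by
    refine LipschitzWith.continuous (K := 1) (LipschitzWith.of_dist_le_mul fun a b => ?_)
    rw [Real.dist_eq, Real.dist_eq, NNReal.coe_one, one_mul]
    exact ((leaf_lip h hσ (hD a) (hD b)).1).trans (hmx a b)
  have hcD' : Continuous (fun τ => D' τ 1) := by
    refine LipschitzWith.continuous (K := 1) (LipschitzWith.of_dist_le_mul fun a b => ?_)
    rw [Real.dist_eq, Real.dist_eq, NNReal.coe_one, one_mul]
    exact ((leaf_lip h hσ (hD' a) (hD' b)).1).trans (hmx a b)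
  have hφ := h.cont
  let Φ : ℝ → ℝ := fun τ => (τ - D τ 1) / 2 + (τ - D' τ 1) / 2 + σ * (φ (A.1 + σ * τ) - φ A.1)
  have hΦ : Continuous Φ := by fun_prop
  have hε := hc.εpos
  have d0 : ∀ τ, 0 ≤ τ → D τ 1 ≤ τ := fun τ hτ => by
    have := dec_le (hD τ) 1; rwa [max_eq_left hτ] at this
  have d0' : ∀ τ, 0 ≤ τ → D' τ 1 ≤ τ := fun τ hτ => by
    have := dec_le (hD' τ) 1; rwa [max_eq_left hτ] at this
  have hΦ0 : Φ 0 ≤ σ * (A.2 - B.2) := by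
    have := (hD 0).nonneg 1
    have := (hD' 0).nonneg 1
    simp only [Φ, mul_zero, add_zero, sub_self]; linarith
  have hΦr : σ * (A.2 - B.2) ≤ Φ (r/2) := by
    have a1 := d0 (r/2) (by linarith)
    have a2 := d0' (r/2) (by linarith)
    have a3 : c * (r/2) ≤ σ * (φ (A.1 + σ * (r/2)) - φ A.1) := by
      rcases hσ with rfl | rfl
      · have := hc.low A.1 (A.1 + 1 * (r/2)) (by linarith [hU.1]) (by linarith) (by linarith [hU.2])
        linarith
      · have := hc.low (A.1 + -1 * (r/2)) A.1 (by linarith [hU.1]) (by linarith) (by linarith [hU.2])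
        linarith
    simp only [Φ]; linarith
  obtain ⟨τ, hτ, he⟩ := intermediate_value_Icc (by linarith : (0:ℝ) ≤ r/2) hΦ.continuousOn ⟨hΦ0, hΦr⟩
  have hd := hD τ
  have hd' := hD' τ
  rw [max_eq_left hτ.1] at hd hd'
  refine ⟨lpt σ A τ (D τ 1), τ, D τ, D' τ, hτ.1, hτ.2, hd, hd', rfl, ?_⟩
  have hσ2 : σ * σ = 1 := by rcases hσ with rfl | rfl <;> norm_num
  simp only [Φ] at he
  have he2 : A.2 - B.2 = σ * ((τ - D τ 1) / 2 + (τ - D' τ 1) / 2) + (φ (A.1 + σ * τ) - φ A.1) := by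
    have := congrArg (fun y => σ * y) he
    simp only [mul_add, ← mul_assoc, hσ2, one_mul] at this
    linarith
  simp only [lpt, R, ← hAB]
  ext
  · rfl
  · simp only; linarith

lemma cross_eq (h : Hyp φ) {ε c q : ℝ} (hc : Cst φ ε c q) {u : ℝ × ℝ → ℝ} {G1 G2 : Set (ℝ × ℝ)}
    (hG1 : ∀ (σ : ℝ) (x : ℝ × ℝ) (τ : ℝ) (d : ℕ → ℝ), (σ = 1 ∨ σ = -1) → τ ≤ 1 → Dec (psi φ σ x) τ d →
        (∀ n, tt φ (n+1) x + σ * d (n+1) ∈ Ico (0:ℝ) 1) → x ∈ G1 → lpt σ x τ (d 1) ∈ G1 →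
        u x = u (lpt σ x τ (d 1)))
    (hG2 : ∀ (σ : ℝ) (x : ℝ × ℝ) (τ : ℝ) (d : ℕ → ℝ), (σ = 1 ∨ σ = -1) → τ ≤ 1 → Dec (psi φ σ x) τ d →
        (∀ n, tt φ (n+1) x + σ * d (n+1) ∈ Ico (0:ℝ) 1) → x ∈ G2 → lpt σ x τ (d 1) ∈ G2 →
        u (R φ x) = u (R φ (lpt σ x τ (d 1))))
    {σ : ℝ} (hσ : σ = 1 ∨ σ = -1) {r : ℝ} (hr0 : 0 < r)
    (hr : r ≤ ε / 2) {A B z : ℝ × ℝ} (hz : Cross φ σ r A B z) (gA : good φ ε q σ r A)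
    (gB : good φ ε q σ r (R φ B)) (hA : A ∈ G1 ∩ R φ ⁻¹' G2) (hB : B ∈ G1 ∩ R φ ⁻¹' G2)
    (hzG : z ∈ G1 ∩ R φ ⁻¹' G2) : u A = u B := by
  obtain ⟨τ, d, d', h0, h1, hd, hd', e1, e2⟩ := hz
  have hε := hc.εlt
  have k1 := hG1 σ A τ d hσ (by linarith) hd (good_mem hc hσ hr gA hd (by linarith)) hA.1 (e1 ▸ hzG.1)
  have hz2 : R φ z ∈ G2 := hzG.2
  have k2 := hG2 σ (R φ B) τ d' hσ (by linarith) hd' (good_mem hc hσ hr gB hd' (by linarith)) hB.2 (e2 ▸ hz2)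
  rw [R_R, ← e2, R_R] at k2
  rw [k1, k2, e1]

lemma cross_null {ε c q : ℝ} (h : Hyp φ) (hc : Cst φ ε c q)
    {σ : ℝ} (hσ : σ = 1 ∨ σ = -1) {r : ℝ} (hr0 : 0 < r) (hr : r ≤ ε / 2) {κ : ℝ}
    {N : Set (ℝ × ℝ)} (hN : volume N = 0) {t : ℝ} (a b : ℝ × ℝ → ℝ)
    (hab : ∀ p p', dist p p' ≤ max |a p - a p'| |b p - b p'|) :
    volume {p | good φ ε q σ r (t, a p) ∧ good φ ε q σ r (R φ (t, b p)) ∧ Dle φ ε q κ (t, a p) ∧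
      Dle φ ε q κ (R φ (t, b p)) ∧ ∃ z, Cross φ σ r (t, a p) (t, b p) z ∧ z ∈ N} = 0 := by
  classical
  obtain ⟨L, hL0, hL⟩ := h.slope
  obtain ⟨K, hK, hl⟩ := h.lip
  set W := {p | good φ ε q σ r (t, a p) ∧ good φ ε q σ r (R φ (t, b p)) ∧ Dle φ ε q κ (t, a p) ∧
      Dle φ ε q κ (R φ (t, b p)) ∧ ∃ z, Cross φ σ r (t, a p) (t, b p) z ∧ z ∈ N} with hW
  have hch : ∀ p, ∃ z, p ∈ W → Cross φ σ r (t, a p) (t, b p) z ∧ z ∈ N := by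
    intro p
    by_cases hp : p ∈ W
    · obtain ⟨-, -, -, -, z, hz⟩ := hp
      exact ⟨z, fun _ => hz⟩
    · exact ⟨0, fun hp' => absurd hp' hp⟩
  choose Z hZ using hch
  set E := 2 * Real.exp (2 * L * κ) with hE
  have hE0 : 0 ≤ E := by positivity
  refine null_of_antilip hN ⟨E * (2 + K), by positivity⟩ Z (fun p hp => (hZ p hp).2) ?_
  intro p hp p' hp'
  obtain ⟨τ, d, d', h0, h1, hd, hd', e1, e2⟩ := (hZ p hp).1
  obtain ⟨τ', D, D', h0', h1', hD, hD', E1, E2⟩ := (hZ p' hp').1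
  obtain ⟨g1, g2, k1, k2, -⟩ := hp
  obtain ⟨g1', g2', k1', k2', -⟩ := hp'
  have la := leaf_gap h hc hL0 hL hσ hr0 hr (x := (t, a p)) (y := (t, a p')) rfl g1 g1' k1 k1' h1 hd hD
  have lb := leaf_gap h hc hL0 hL hσ hr0 hr (x := R φ (t, b p)) (y := R φ (t, b p')) rfl g2 g2' k2 k2' h1 hd' hD'
  rw [← e1, ← E1] at la
  rw [← e2, ← E2] at lb
  have hσa : |σ| = 1 := by rcases hσ with rfl | rfl <;> simp
  have hτ : |τ - τ'| = |(Z p).1 - (Z p').1| := by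
    rw [e1, E1]; simp only [lpt]
    rw [show t + σ * τ - (t + σ * τ') = σ * (τ - τ') by ring, abs_mul, hσa, one_mul]
  have m1 : |(Z p).1 - (Z p').1| ≤ dist (Z p) (Z p') := le_max_left _ _
  have m2 : |(Z p).2 - (Z p').2| ≤ dist (Z p) (Z p') := le_max_right _ _
  rw [hτ] at la lb
  have m3 : |(R φ (Z p)).2 - (R φ (Z p')).2| ≤ (1 + K) * dist (Z p) (Z p') := by
    have : (R φ (Z p)).2 - (R φ (Z p')).2 = (φ (Z p).1 - φ (Z p').1) - ((Z p).2 - (Z p').2) := by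
      simp only [R]; ring
    rw [this]
    refine (abs_sub _ _).trans ?_
    have := hl (Z p).1 (Z p').1
    have := mul_le_mul_of_nonneg_left m1 hK
    linarith
  have hb : |(R φ (t, b p)).2 - (R φ (t, b p')).2| = |b p - b p'| := by
    simp only [R]; rw [show φ t - b p - (φ t - b p') = -(b p - b p') by ring, abs_neg]
  rw [hb] at lb
  have hd0 : 0 ≤ dist (Z p) (Z p') := dist_nonneg
  refine (hab p p').trans (max_le ?_ ?_)
  · refine la.trans ?_
    change _ ≤ E * (2 + K) * dist (Z p) (Z p')
    rw [mul_assoc E]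
    refine mul_le_mul_of_nonneg_left ?_ hE0
    nlinarith
  · refine lb.trans ?_
    change _ ≤ E * (2 + K) * dist (Z p) (Z p')
    rw [mul_assoc E]
    refine mul_le_mul_of_nonneg_left ?_ hE0
    nlinarith

end LTM

open scoped ENNReal NNReal

namespace LTM
variable {φ : ℝ → ℝ}

def NB (φ : ℝ → ℝ) (ε q r : ℝ) (x y : ℝ × ℝ) : Prop :=
  (good φ ε q 1 r y ∧ good φ ε q 1 r (R φ x)) ∨ (good φ ε q (-1) r x ∧ good φ ε q (-1) r (R φ y))

lemma not_Bad {ε q r s : ℝ} {x : ℝ × ℝ} (hU : x.1 ∈ Icc ε (1-ε)) (hB : x ∉ Bad φ ε q r s) :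
    NB φ ε q r x (up s x) := by
  by_contra hc
  apply hB
  unfold NB at hc
  push Not at hc
  refine ⟨hU, ?_, ?_⟩
  · by_contra h1; push Not at h1; exact hc.1 h1.1 h1.2
  · by_contra h1; push Not at h1; exact hc.2 h1.1 h1.2

lemma pair_null (h : Hyp φ) {ε c q : ℝ} (hc : Cst φ ε c q) {u : ℝ × ℝ → ℝ} {G1 G2 : Set (ℝ × ℝ)}
    (hG1 : ∀ (σ : ℝ) (x : ℝ × ℝ) (τ : ℝ) (d : ℕ → ℝ), (σ = 1 ∨ σ = -1) → τ ≤ 1 → Dec (psi φ σ x) τ d →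
        (∀ n, tt φ (n+1) x + σ * d (n+1) ∈ Ico (0:ℝ) 1) → x ∈ G1 → lpt σ x τ (d 1) ∈ G1 →
        u x = u (lpt σ x τ (d 1)))
    (hG2 : ∀ (σ : ℝ) (x : ℝ × ℝ) (τ : ℝ) (d : ℕ → ℝ), (σ = 1 ∨ σ = -1) → τ ≤ 1 → Dec (psi φ σ x) τ d →
        (∀ n, tt φ (n+1) x + σ * d (n+1) ∈ Ico (0:ℝ) 1) → x ∈ G2 → lpt σ x τ (d 1) ∈ G2 →
        u (R φ x) = u (R φ (lpt σ x τ (d 1))))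
    (hN : volume {z : ℝ × ℝ | z.1 ∈ Ico (0:ℝ) 1 ∧ z ∈ (G1 ∩ R φ ⁻¹' G2)ᶜ} = 0)
    {r : ℝ} (hr0 : 0 < r) (hr : r ≤ ε / 2) {t : ℝ} (hU : t ∈ Icc ε (1-ε)) {S : Set ℝ} (hS : volume S = 0)
    (hSV : ∀ w, w ∉ S → (t, w) ∈ G1 ∩ R φ ⁻¹' G2 ∧ (∃ κ : ℕ, Dle φ ε q κ (t, w)) ∧ ∃ κ : ℕ, Dle φ ε q κ (R φ (t, w))) :
    volume {p : ℝ × ℝ | p.2 - p.1 ∈ Ioo 0 (c * r / 2) ∧ u (t, p.1) ≠ u (t, p.2) ∧ NB φ ε q r (t, p.1) (t, p.2)} = 0 := by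
  set N := {z : ℝ × ℝ | z.1 ∈ Ico (0:ℝ) 1 ∧ z ∈ (G1 ∩ R φ ⁻¹' G2)ᶜ} with hNd
  let W : ℝ → (ℝ × ℝ → ℝ) → (ℝ × ℝ → ℝ) → ℕ → Set (ℝ × ℝ) := fun σ a b κ =>
    {p | good φ ε q σ r (t, a p) ∧ good φ ε q σ r (R φ (t, b p)) ∧ Dle φ ε q κ (t, a p) ∧
      Dle φ ε q κ (R φ (t, b p)) ∧ ∃ z, Cross φ σ r (t, a p) (t, b p) z ∧ z ∈ N}
  have main : ∀ (σ : ℝ) (a b : ℝ × ℝ → ℝ) (p : ℝ × ℝ), (σ = 1 ∨ σ = -1) → good φ ε q σ r (t, a p) →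
      good φ ε q σ r (R φ (t, b p)) → a p ∉ S → b p ∉ S → 0 < σ * (a p - b p) → σ * (a p - b p) < c * r / 2 →
      u (t, a p) ≠ u (t, b p) → ∃ κ, p ∈ W σ a b κ := by
    intro σ a b p hσ g1 g2 s1 s2 hp1 hp2 hne
    obtain ⟨v1, ⟨κ1, hk1⟩, -⟩ := hSV _ s1
    obtain ⟨v2, -, ⟨κ2, hk2⟩⟩ := hSV _ s2
    obtain ⟨z, hz⟩ := exists_cross h hc hσ hr0 hr (A := (t, a p)) (B := (t, b p)) rfl hU hp1 hp2
    refine ⟨max κ1 κ2, g1, g2, fun n => (hk1 n).trans (by exact_mod_cast le_max_left _ _),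
      fun n => (hk2 n).trans (by exact_mod_cast le_max_right _ _), z, hz, ?_⟩
    by_contra hzN
    have hz1 : z.1 ∈ Ico (0:ℝ) 1 := by
      obtain ⟨τ, d, d', h0, h1, -, -, e1, -⟩ := hz
      have hε := hc.εpos
      rw [e1]; simp only [lpt]
      rcases hσ with rfl | rfl
      · exact ⟨by linarith [hU.1], by linarith [hU.2]⟩
      · exact ⟨by linarith [hU.1], by linarith [hU.2]⟩
    have hzG : z ∈ G1 ∩ R φ ⁻¹' G2 := by
      by_contra hzG; exact hzN ⟨hz1, hzG⟩
    exact hne (cross_eq h hc hG1 hG2 hσ hr0 hr hz g1 g2 v1 v2 hzG)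
  have hsub : {p : ℝ × ℝ | p.2 - p.1 ∈ Ioo 0 (c * r / 2) ∧ u (t, p.1) ≠ u (t, p.2) ∧ NB φ ε q r (t, p.1) (t, p.2)} ⊆
      (S ×ˢ univ ∪ univ ×ˢ S) ∪ ((⋃ κ, W 1 Prod.snd Prod.fst κ) ∪ ⋃ κ, W (-1) Prod.fst Prod.snd κ) := by
    rintro p ⟨hp1, hp2, hp3⟩
    by_contra hcon
    simp only [mem_union, mem_prod, mem_univ, and_true, true_and, not_or, mem_iUnion, not_exists] at hcon
    obtain ⟨⟨s1, s2⟩, w1, w2⟩ := hcon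
    rcases hp3 with ⟨g1, g2⟩ | ⟨g1, g2⟩
    · obtain ⟨κ, hκ⟩ := main 1 Prod.snd Prod.fst p (Or.inl rfl) g1 g2 s2 s1 (by linarith [hp1.1]) (by linarith [hp1.2]) hp2.symm
      exact w1 κ hκ
    · obtain ⟨κ, hκ⟩ := main (-1) Prod.fst Prod.snd p (Or.inr rfl) g1 g2 s1 s2 (by linarith [hp1.1]) (by linarith [hp1.2]) hp2
      exact w2 κ hκ
  refine measure_mono_null hsub (measure_union_null (measure_union_null ?_ ?_) (measure_union_null ?_ ?_))
  · rw [Measure.volume_eq_prod, Measure.prod_prod, hS, zero_mul]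
  · rw [Measure.volume_eq_prod, Measure.prod_prod, hS, mul_zero]
  · refine measure_iUnion_null fun κ => cross_null h hc (Or.inl rfl) hr0 hr hN _ _ fun p p' => ?_
    rw [Prod.dist_eq, Real.dist_eq, Real.dist_eq, max_comm]
  · refine measure_iUnion_null fun κ => cross_null h hc (Or.inr rfl) hr0 hr hN _ _ fun p p' => ?_
    rw [Prod.dist_eq, Real.dist_eq, Real.dist_eq]

lemma shift_null (h : Hyp φ) {ε c p : ℝ} (hp0 : 0 ≤ p) (hp1 : p < 1) (hc : Cst φ ε c (p^2))
    {u : ℝ × ℝ → ℝ} (hu : Measurable u) (hb : ∀ x, |u x| ≤ 1) (hp : WPer u)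
    (hinv : ∀ᵐ x ∂mu, u (T φ x) = u x) {r : ℝ} (hr0 : 0 < r) (hr : r ≤ ε / 2) :
    ∀ᵐ s : ℝ, s ∈ Ioo 0 (c * r / 2) →
      mu {x | x.1 ∈ Icc ε (1-ε) ∧ u x ≠ u (up s x)} ≤ mu (Bad φ ε (p^2) r s) := by
  obtain ⟨G1, m1, w1, n1, hG1⟩ := hopf h hu hb hp hinv
  obtain ⟨G2, m2, w2, n2, hG2⟩ := hopf h (u := fun x => u (R φ x)) (hu.comp (meas_R h)) (fun x => hb _)
    (hp.comp_R (φ := φ)) (inv_R h hu hp hinv)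
  have w1' : ∀ t w, ((t, w + 1) ∈ G1) = ((t, w) ∈ G1) := w1
  have w2' : ∀ t w, (R φ (t, w + 1) ∈ G2) = (R φ (t, w) ∈ G2) := w2.comp_R (φ := φ)
  have hGm : MeasurableSet (G1 ∩ R φ ⁻¹' G2)ᶜ := (m1.inter (meas_R h m2)).compl
  have hGw : WPer (· ∈ (G1 ∩ R φ ⁻¹' G2)ᶜ) := by
    intro t w
    simp only [mem_compl_iff, mem_inter_iff, mem_preimage, w1' t w, w2' t w]
  have w2c : WPer (· ∈ G2ᶜ) := by
    intro t w
    have : ((t, w + 1) ∈ G2) = ((t, w) ∈ G2) := w2 t w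
    simp only [mem_compl_iff, this]
  have hG0 : mu (G1 ∩ R φ ⁻¹' G2)ᶜ = 0 := by
    rw [compl_inter]
    refine measure_union_null n1 ?_
    rw [← preimage_compl, mu_R h m2.compl w2c]; exact n2
  have hN := strip_null hGm hGw hG0
  -- bad Dle set
  let D0 : Set (ℝ × ℝ) := {x | x.1 ∈ Icc ε (1-ε) ∧ ¬ ∃ κ : ℕ, Dle φ ε (p^2) κ x}
  have hD0m : MeasurableSet D0 := by
    refine (measurable_fst measurableSet_Icc).inter (MeasurableSet.compl (s := {x | ∃ κ : ℕ, Dle φ ε (p^2) κ x}) ?_)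
    have : {x | ∃ κ : ℕ, Dle φ ε (p^2) κ x} = ⋃ κ : ℕ, {x | Dle φ ε (p^2) κ x} := by ext x; simp
    rw [this]
    exact MeasurableSet.iUnion fun κ => meas_Dle h _ _ _
  have hD0w : WPer (· ∈ D0) := by
    intro t w
    have : ∀ κ : ℕ, Dle φ ε (p^2) κ (t, w+1) = Dle φ ε (p^2) κ (t,w) := fun κ => wper_Dle _ _ _ t w
    simp only [D0, mem_ofPred_eq, this]
  have hD00 : mu D0 = 0 := by
    have := ae_D h hc.εpos hp0 hp1
    rw [measure_eq_zero_iff_ae_notMem]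
    filter_upwards [this] with x hx hx2
    exact hx2.2 (hx hx2.1)
  have hD01 : mu (R φ ⁻¹' D0) = 0 := by rw [mu_R h hD0m hD0w, hD00]
  have l1 := ae_line hGm hGw hG0
  have l2 := ae_line hD0m hD0w hD00
  have l3 := ae_line (meas_R h hD0m) (hD0w.comp_R (φ := φ)) hD01
  let P : ℝ × ℝ → ℝ → Prop := fun x s => ¬ (s ∈ Ioo 0 (c * r / 2) ∧ x.1 ∈ Icc ε (1-ε) ∧ u x ≠ u (up s x) ∧
    NB φ ε (p^2) r x (up s x))
  have hPm : MeasurableSet {z : (ℝ × ℝ) × ℝ | P z.1 z.2} := by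
    have hup : Measurable (fun z : (ℝ × ℝ) × ℝ => up z.2 z.1) := by unfold up; fun_prop
    have hR := meas_R h
    refine MeasurableSet.compl ?_
    refine (measurable_snd measurableSet_Ioo).inter (((measurable_fst.comp measurable_fst) measurableSet_Icc).inter
      ((measurableSet_eq_fun (hu.comp measurable_fst) (hu.comp hup)).compl.inter
      (MeasurableSet.union (MeasurableSet.inter ?_ ?_) (MeasurableSet.inter ?_ ?_))))
    · exact hup (meas_good h ε (p^2) 1 r)
    · exact (hR.comp measurable_fst) (meas_good h ε (p^2) 1 r)
    · exact measurable_fst (meas_good h ε (p^2) (-1) r)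
    · exact (hR.comp hup) (meas_good h ε (p^2) (-1) r)
  have hsect : ∀ᵐ t ∂nu, ∀ᵐ w ∂nu, ∀ᵐ s : ℝ, P (t, w) s := by
    filter_upwards [l1, l2, l3] with t k1 k2 k3
    by_cases hU : t ∈ Icc ε (1-ε)
    swap
    · exact ae_of_all _ fun w => ae_of_all _ fun s hs => hU hs.2.1
    have := pair_null h hc hG1 hG2 hN hr0 hr hU (measure_union_null k1 (measure_union_null k2 k3)) (by
      intro w hw
      simp only [mem_union, mem_ofPred_eq, not_or, D0, mem_preimage, R_fst, not_and, not_not] at hw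
      obtain ⟨a1, a2, a3⟩ := hw
      exact ⟨by simpa using a1, a2 hU, a3 hU⟩)
    have hmp := measurePreserving_prod_add (volume : Measure ℝ) (volume : Measure ℝ)
    rw [← Measure.volume_eq_prod] at hmp
    have h3 := hmp.quasiMeasurePreserving.preimage_null this
    have h4 : ∀ᵐ z : ℝ × ℝ, P (t, z.1) z.2 := by
      rw [ae_iff]
      refine measure_mono_null ?_ h3
      rintro ⟨w, s⟩ hz
      simp only [P, mem_ofPred_eq, not_not] at hz
      obtain ⟨b1, b2, b3, b4⟩ := hz
      refine ⟨by simpa using b1, b3, b4⟩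
    rw [Measure.volume_eq_prod] at h4
    have h5 := Measure.ae_ae_of_ae_prod h4
    exact ae_restrict_of_ae h5
  have hmu : ∀ᵐ x ∂mu, ∀ᵐ s : ℝ, P x s := by
    rw [mu, Measure.ae_prod_iff_ae_ae]
    · exact hsect
    · have := measurable_measure_prodMk_left (ν := (volume : Measure ℝ)) hPm.compl
      exact this (measurableSet_singleton 0)
  rw [Measure.ae_ae_comm hPm] at hmu
  filter_upwards [hmu] with s hs hsI
  refine measure_mono_ae ?_
  filter_upwards [hs] with x hx hx2
  by_contra hB
  exact hx ⟨hsI, hx2.1, hx2.2, not_Bad hx2.1 hB⟩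

end LTM

open scoped ENNReal NNReal

namespace LTM
variable {φ : ℝ → ℝ}

lemma int_up (a : ℝ) (F : ℝ × ℝ → ℝ≥0∞) (hF : Measurable F) (hp : WPer F) :
    ∫⁻ x, F (up a x) ∂mu = ∫⁻ x, F x ∂mu := by
  rw [mu_eq (fun x => F (up a x)) (hF.comp (meas_up a)), mu_eq _ hF]
  congr 1; ext t
  exact nu_shift (fun w => F (t, w)) (hp t) a

lemma small_shift (h : Hyp φ) {ε : ℝ} (hSm : Sm φ ε) {u : ℝ × ℝ → ℝ} (hu : Measurable u) (hb : ∀ x, |u x| ≤ 1)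
    (hp : WPer u) (hinv : ∀ᵐ x ∂mu, u (T φ x) = u x) {δ η : ℝ} (hδ : 0 < δ) (hη : 0 < η) :
    ∃ s, 0 < s ∧ s < η ∧ mu {x | x.1 ∈ Icc ε (1-ε) ∧ u x ≠ u (up s x)} ≤ ENNReal.ofReal (δ * s) := by
  have hε := hSm.pos
  obtain ⟨c, hc0, hcl⟩ := h.low (ε/2) (by linarith)
  have hq : 0 < 1 / (1 + 2 * c) := by positivity
  set p := Real.sqrt (1 / (1 + 2 * c)) with hpd
  have hp2 : p^2 = 1 / (1 + 2 * c) := Real.sq_sqrt hq.le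
  have hp0 : 0 < p := Real.sqrt_pos.2 hq
  have hC : Cst φ ε c (p^2) := ⟨hε, by linarith [hSm.lt], hc0, hcl, by rw [hp2]; field_simp⟩
  have hp1 : p < 1 := by
    have := hC.qlt
    nlinarith
  obtain ⟨r₀, hr₀, hbad⟩ := bad_small h hSm hp0 hp1 (A := c) hc0.le (δ := δ * c / 4) (by positivity)
  set r := min (min r₀ (ε/2)) (η / c) with hr
  have hr0 : 0 < r := by positivity
  have hr1 : r ≤ r₀ := (min_le_left _ _).trans (min_le_left _ _)
  have hr2 : r ≤ ε / 2 := (min_le_left _ _).trans (min_le_right _ _)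
  have hr3 : c * r ≤ η := by
    have : r ≤ η / c := min_le_right _ _
    rw [le_div_iff₀ hc0] at this; linarith
  have hs := shift_null h hp0.le hp1 hC hu hb hp hinv hr0 hr2
  have hcr : 0 < c * r := by positivity
  have hne : ∃ s ∈ Ioo (c * r / 4) (c * r / 2), s ∈ Ioo 0 (c * r / 2) →
      mu {x | x.1 ∈ Icc ε (1-ε) ∧ u x ≠ u (up s x)} ≤ mu (Bad φ ε (p^2) r s) := by
    by_contra hcon
    push Not at hcon
    have h1 : volume (Ioo (c * r / 4) (c * r / 2)) = 0 := by
      refine measure_mono_null ?_ (ae_iff.1 hs)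
      intro s hs1
      simp only [mem_ofPred_eq]
      intro hs2
      obtain ⟨a1, a2⟩ := hcon s hs1
      exact absurd (hs2 a1) (not_le.2 a2)
    rw [Real.volume_Ioo, ENNReal.ofReal_eq_zero] at h1
    linarith
  obtain ⟨s, hs1, hs2⟩ := hne
  have hs0 : 0 < s := by linarith [hs1.1]
  refine ⟨s, hs0, by linarith [hs1.2], (hs2 ⟨hs0, hs1.2⟩).trans ((hbad r hr0 hr1 s hs0 (by linarith [hs1.2])).trans ?_)⟩
  refine ENNReal.ofReal_le_ofReal ?_
  nlinarith [hs1.1]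

lemma vert_inv (h : Hyp φ) {ε : ℝ} (hSm : Sm φ ε) {u : ℝ × ℝ → ℝ} (hu : Measurable u) (h0 : ∀ x, 0 ≤ u x)
    (h1 : ∀ x, u x ≤ 1) (hp : WPer u) (hinv : ∀ᵐ x ∂mu, u (T φ x) = u x) {a : ℝ} (ha : 0 ≤ a) :
    ∀ᵐ x ∂mu, x.1 ∈ Icc ε (1-ε) → u x = u (up a x) := by
  classical
  have hb : ∀ x, |u x| ≤ 1 := fun x => by rw [abs_of_nonneg (h0 x)]; exact h1 x
  let SU : Set (ℝ × ℝ) := {x | x.1 ∈ Icc ε (1-ε)}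
  have hSU : MeasurableSet SU := measurable_fst measurableSet_Icc
  let K : ℝ → ℝ × ℝ → ℝ≥0∞ := fun b => SU.indicator (fun x => ‖u x - u (up b x)‖ₑ)
  have hKm : ∀ b, Measurable (K b) := fun b => by
    have := hu.comp (meas_up b)
    refine Measurable.indicator ?_ hSU
    exact (hu.sub this).enorm
  have hKp : ∀ b, WPer (K b) := by
    intro b t w
    have e1 := hp t w
    have e2 : u (up b (t, w+1)) = u (up b (t, w)) := (hp.comp_up b) t w
    by_cases hx : (t, w) ∈ SU
    · have hx' : (t, w+1) ∈ SU := hx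
      simp only [K, indicator_of_mem hx, indicator_of_mem hx', e1, e2]
    · have hx' : (t, w+1) ∉ SU := hx
      simp only [K, indicator_of_notMem hx, indicator_of_notMem hx']
  let Dl : ℝ → ℝ≥0∞ := fun b => ∫⁻ x, K b x ∂mu
  have upadd : ∀ a b x, up (a+b) x = up b (up a x) := by intro a b x; simp only [up, add_assoc]
  have hsubadd : ∀ a b, Dl (a+b) ≤ Dl a + Dl b := by
    intro a b
    have e : Dl b = ∫⁻ x, K b (up a x) ∂mu := (int_up a _ (hKm b) (hKp b)).symm
    rw [e, ← lintegral_add_left (hKm a)]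
    refine lintegral_mono fun x => ?_
    by_cases hx : x ∈ SU
    · have hx' : up a x ∈ SU := hx
      simp only [K, indicator_of_mem hx, indicator_of_mem hx', upadd]
      have := enorm_add_le (u x - u (up a x)) (u (up a x) - u (up b (up a x)))
      rwa [sub_add_sub_cancel] at this
    · simp only [K, indicator_of_notMem hx, zero_le]
  have hD0 : Dl 0 = 0 := by
    have : K 0 = fun _ => 0 := by
      ext x
      have : up 0 x = x := by simp [up]
      by_cases hx : x ∈ SU
      · simp only [K, indicator_of_mem hx, this, sub_self, enorm_zero]
      · simp only [K, indicator_of_notMem hx]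
    simp only [Dl, this, lintegral_zero]
  have hmul : ∀ (n : ℕ) s, Dl (n * s) ≤ n * Dl s := by
    intro n s
    induction n with
    | zero => simp [hD0]
    | succ n ih =>
      push_cast
      rw [add_mul, add_mul, one_mul, one_mul]
      exact (hsubadd _ _).trans (by gcongr)
  have hDs : ∀ s, Dl s ≤ mu {x | x.1 ∈ Icc ε (1-ε) ∧ u x ≠ u (up s x)} := by
    intro s
    have hm : MeasurableSet {x : ℝ × ℝ | x.1 ∈ Icc ε (1-ε) ∧ u x ≠ u (up s x)} :=
      hSU.inter (measurableSet_eq_fun hu (hu.comp (meas_up s))).compl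
    rw [ind_set _ hm]
    refine lintegral_mono fun x => ?_
    by_cases hx : x ∈ SU
    · by_cases hx2 : u x = u (up s x)
      · simp only [K, indicator_of_mem hx, hx2, sub_self, enorm_zero, zero_le]
      · have hx3 : x ∈ {x : ℝ × ℝ | x.1 ∈ Icc ε (1-ε) ∧ u x ≠ u (up s x)} := ⟨hx, hx2⟩
        simp only [K, indicator_of_mem hx, indicator_of_mem hx3, Pi.one_apply]
        rw [Real.enorm_eq_ofReal_abs, ← ENNReal.ofReal_one]
        refine ENNReal.ofReal_le_ofReal ?_
        rw [abs_le]
        constructor <;> linarith [h0 x, h1 x, h0 (up s x), h1 (up s x)]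
    · simp only [K, indicator_of_notMem hx, zero_le]
  have hcont : ∀ η : ℝ, 0 < η → ∃ ρ > 0, ∀ b, 0 ≤ b → b < ρ → Dl b ≤ 3 * ENNReal.ofReal η := by
    intro η hη
    obtain ⟨F, hFc, hFu, hFp, hFi⟩ := approx hu hb hp (η := ENNReal.ofReal η) (by simpa using hη)
    obtain ⟨ρ, hρ, hF⟩ := Metric.uniformContinuous_iff.1 hFu η hη
    refine ⟨ρ, hρ, fun b hb0 hbρ => ?_⟩
    have hm1 : Measurable (fun x => ‖u x - F x‖ₑ) := (hu.sub hFc.measurable).enorm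
    have hp1 : WPer (fun x => ‖u x - F x‖ₑ) := by
      intro t w; simp only [hp t w, hFp t w]
    have e2 : ∫⁻ x, ‖u (up b x) - F (up b x)‖ₑ ∂mu ≤ ENNReal.ofReal η :=
      (int_up b _ hm1 hp1).le.trans hFi
    calc Dl b ≤ ∫⁻ x, (‖u x - F x‖ₑ + ENNReal.ofReal η + ‖u (up b x) - F (up b x)‖ₑ) ∂mu := by
          refine lintegral_mono fun x => ?_
          refine (indicator_le_self' (fun _ _ => zero_le) x).trans ?_
          have hd : dist x (up b x) < ρ := by
            rw [Prod.dist_eq]; simp only [up, dist_self]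
            rw [Real.dist_eq, sub_add_cancel_left, abs_neg, abs_of_nonneg hb0, max_eq_right hb0]; exact hbρ
          have h3 : ‖F x - F (up b x)‖ₑ ≤ ENNReal.ofReal η := by
            rw [Real.enorm_eq_ofReal_abs]
            exact ENNReal.ofReal_le_ofReal (hF hd).le
          have h4 : u x - u (up b x) = (u x - F x) + (F x - F (up b x)) + (-(u (up b x) - F (up b x))) := by ring
          rw [h4]
          refine (enorm_add_le _ _).trans ?_
          rw [enorm_neg]
          gcongr
          refine (enorm_add_le _ _).trans ?_
          gcongr
      _ = ∫⁻ x, ‖u x - F x‖ₑ ∂mu + ENNReal.ofReal η + ∫⁻ x, ‖u (up b x) - F (up b x)‖ₑ ∂mu := by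
          have hm2 : Measurable (fun x => ‖u x - F x‖ₑ + ENNReal.ofReal η) := hm1.add measurable_const
          rw [lintegral_add_left hm2, lintegral_add_left hm1, lintegral_const, measure_univ, mul_one]
      _ ≤ ENNReal.ofReal η + ENNReal.ofReal η + ENNReal.ofReal η := by gcongr
      _ = _ := by ring
  have hfin : Dl a = 0 := by
    refine le_antisymm ?_ bot_le
    have key : ∀ η : ℝ, 0 < η → Dl a ≤ ENNReal.ofReal (4 * η) := by
      intro η hη
      obtain ⟨ρ, hρ, hD⟩ := hcont η hη
      obtain ⟨s, hs0, hsρ, hs⟩ := small_shift h hSm hu hb hp hinv (δ := η / (a + 1)) (by positivity) hρ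
      set n := ⌊a / s⌋₊ with hn
      have n1 : (n:ℝ) * s ≤ a := by
        have := Nat.floor_le (div_nonneg ha hs0.le); rwa [le_div_iff₀ hs0] at this
      have n2 : a < (n + 1) * s := by
        have := Nat.lt_floor_add_one (a / s); rwa [div_lt_iff₀ hs0] at this
      have hd1 := hD (a - n * s) (by linarith) (by linarith)
      have hd2 := hsubadd (n * s) (a - n * s)
      rw [add_sub_cancel] at hd2
      have hd3 : Dl (n * s) ≤ ENNReal.ofReal η := by
        refine (hmul n s).trans ((mul_le_mul_right ((hDs s).trans hs) _).trans ?_)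
        rw [← ENNReal.ofReal_natCast, ← ENNReal.ofReal_mul (by positivity)]
        refine ENNReal.ofReal_le_ofReal ?_
        have e5 : (n:ℝ) * (η / (a+1) * s) = η * (n * s / (a+1)) := by ring
        rw [e5]
        have e6 : n * s / (a+1) ≤ 1 := by rw [div_le_one (by linarith)]; linarith
        nlinarith
      refine hd2.trans ((add_le_add hd3 hd1).trans (le_of_eq ?_))
      rw [ENNReal.ofReal_mul (by norm_num)]
      norm_num
      ring
    have ht : Tendsto (fun η : ℝ => ENNReal.ofReal (4 * η)) (nhdsWithin 0 (Ioi 0)) (nhds 0) := by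
      have : Tendsto (fun η : ℝ => ENNReal.ofReal (4 * η)) (nhds 0) (nhds (ENNReal.ofReal (4 * 0))) :=
        (ENNReal.continuous_ofReal.comp (continuous_const.mul continuous_id)).tendsto 0
      rw [mul_zero, ENNReal.ofReal_zero] at this
      exact this.mono_left nhdsWithin_le_nhds
    exact ge_of_tendsto ht (eventually_nhdsWithin_of_forall fun η hη => key η hη)
  have h3 := (lintegral_eq_zero_iff (hKm a)).1 hfin
  filter_upwards [h3] with x hx hxU
  have hx' : x ∈ SU := hxU
  simp only [K, indicator_of_mem hx', Pi.zero_apply] at hx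
  have := enorm_eq_zero.1 hx
  linarith

lemma vert_inv' (h : Hyp φ) {u : ℝ × ℝ → ℝ} (hu : Measurable u) (h0 : ∀ x, 0 ≤ u x)
    (h1 : ∀ x, u x ≤ 1) (hp : WPer u) (hinv : ∀ᵐ x ∂mu, u (T φ x) = u x) {a : ℝ} (ha : 0 ≤ a) :
    ∀ᵐ x ∂mu, u x = u (up a x) := by
  obtain ⟨ε₀, hε₀, hS⟩ := exists_Sm h
  have hall : ∀ᵐ x ∂mu, ∀ n : ℕ, x.1 ∈ Icc (ε₀ / (n+1)) (1 - ε₀ / (n+1)) → u x = u (up a x) := by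
    rw [ae_all_iff]
    intro n
    refine vert_inv h (hS _ (by positivity) ?_) hu h0 h1 hp hinv ha
    exact div_le_self hε₀.le (by linarith [(Nat.cast_nonneg n : (0:ℝ) ≤ n)])
  have hne : ∀ᵐ x ∂mu, x.1 ≠ 0 := by
    have : mu (({0} : Set ℝ) ×ˢ univ) = 0 := by
      rw [mu, Measure.prod_prod]; simp [nu]
    rw [measure_eq_zero_iff_ae_notMem] at this
    filter_upwards [this] with x hx hx0
    exact hx ⟨hx0, mem_univ _⟩
  filter_upwards [hall, hne, ae_mem] with x hx hx0 hxm
  have hpos : 0 < x.1 := lt_of_le_of_ne hxm.1.1 (Ne.symm hx0)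
  have hlt : x.1 < 1 := hxm.1.2
  set m := min x.1 (1 - x.1) with hm
  have hm0 : 0 < m := lt_min hpos (by linarith)
  obtain ⟨n, hn⟩ := exists_nat_gt (ε₀ / m)
  have : ε₀ / (n+1) ≤ m := by
    rw [div_lt_iff₀ hm0] at hn
    rw [div_le_iff₀ (by positivity)]
    nlinarith
  refine hx n ⟨this.trans (min_le_left _ _), ?_⟩
  have := this.trans (min_le_right _ _)
  linarith

end LTM

open scoped ENNReal NNReal

namespace LTM
variable {φ : ℝ → ℝ}

lemma const (h : Hyp φ) {u : ℝ × ℝ → ℝ} (hu : Measurable u) (h0 : ∀ x, 0 ≤ u x)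
    (h1 : ∀ x, u x ≤ 1) (hp : WPer u) (hinv : ∀ᵐ x ∂mu, u (T φ x) = u x) :
    ∃ C : ℝ≥0∞, ∀ᵐ x ∂mu, ENNReal.ofReal (u x) = C := by
  let v : ℝ × ℝ → ℝ≥0∞ := fun x => ENNReal.ofReal (u x)
  have hv : Measurable v := hu.ennreal_ofReal
  have hvp : WPer v := by intro t w; simp only [v, hp t w]
  let H : ℝ → ℝ≥0∞ := fun t => ∫⁻ w, v (t, w) ∂nu
  have hH : Measurable H := hv.lintegral_prod_right'
  have s1 : ∀ᵐ a ∂nu, ∀ᵐ x ∂mu, v x = v (up a x) := by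
    rw [nu, ae_restrict_iff' measurableSet_Ico]
    refine ae_of_all _ fun a ha => ?_
    filter_upwards [vert_inv' h hu h0 h1 hp hinv ha.1] with x hx
    simp only [v, hx]
  have s2 : ∀ᵐ x ∂mu, ∀ᵐ a ∂nu, v x = v (up a x) := by
    refine (Measure.ae_ae_comm ?_).1 s1
    refine measurableSet_eq_fun (hv.comp measurable_snd) (hv.comp ?_)
    unfold up
    fun_prop
  have s3 : ∀ᵐ x ∂mu, v x = H x.1 := by
    filter_upwards [s2] with x hx
    have e1 : ∫⁻ a, v x ∂nu = ∫⁻ a, v (x.1, a + x.2) ∂nu := by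
      refine lintegral_congr_ae ?_
      filter_upwards [hx] with a ha
      rw [ha, up, add_comm]
    rw [lintegral_const, measure_univ, mul_one] at e1
    rw [e1]
    exact nu_shift (fun w => v (x.1, w)) (hvp x.1) x.2
  have s4 : ∀ᵐ x ∂mu, v (T φ x) = H (T φ x).1 := by
    have hA : MeasurableSet {x : ℝ × ℝ | ¬ v x = H x.1} :=
      (measurableSet_eq_fun hv (hH.comp measurable_fst)).compl
    have hAp : WPer (· ∈ {x : ℝ × ℝ | ¬ v x = H x.1}) := by
      intro t w
      simp only [mem_ofPred_eq, hvp t w]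
    have := mu_iter h 1 hA hAp
    rw [ae_iff.1 s3] at this
    exact this
  have s5 : ∀ᵐ x ∂mu, H (Int.fract (x.1 + 2 * x.2)) = H x.1 := by
    filter_upwards [s3, s4, hinv] with x h3 h4 h5
    have h6 : v (T φ x) = v x := by simp only [v, h5]
    rw [← h3, ← h6, h4]; rfl
  have s6 : ∀ᵐ t ∂nu, ∀ᵐ w ∂nu, H (Int.fract (t + 2 * w)) = H t := Measure.ae_ae_of_ae_prod s5
  refine ⟨∫⁻ a, H (Int.fract a) ∂nu, ?_⟩
  have s7 : ∀ᵐ t ∂nu, H t = ∫⁻ a, H (Int.fract a) ∂nu := by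
    filter_upwards [s6] with t ht
    let S : Set ℝ := {w | ¬ H (Int.fract (t + 2 * w)) = H t}
    have hS : MeasurableSet S := by
      refine (measurableSet_eq_fun (hH.comp (measurable_fract.comp ?_)) measurable_const).compl
      fun_prop
    have hSp : ∀ w, (w + 1 ∈ S) = (w ∈ S) := by
      intro w
      have e : t + 2 * (w+1) = t + 2 * w + (2:ℤ) := by push_cast; ring
      simp only [S, mem_ofPred_eq, e, Int.fract_add_intCast]
    have hS0 := per_null hSp (ae_iff.1 ht) hS
    have hS1 : volume ((fun x => (1/2:ℝ) * x) ⁻¹' S) = 0 := by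
      rw [Real.volume_preimage_mul_left (by norm_num), hS0, mul_zero]
    have hS2 : ∀ᵐ a ∂nu, H (Int.fract (a + t)) = H t := by
      rw [nu]
      refine ae_restrict_of_ae ?_
      rw [measure_eq_zero_iff_ae_notMem] at hS1
      filter_upwards [hS1] with a ha
      simp only [S, mem_preimage, mem_ofPred_eq, not_not] at ha
      rw [← ha]; congr 2; ring
    have e1 : ∫⁻ a, H t ∂nu = ∫⁻ a, H (Int.fract (a + t)) ∂nu := by
      refine lintegral_congr_ae ?_
      filter_upwards [hS2] with a ha
      rw [ha]
    rw [lintegral_const, measure_univ, mul_one] at e1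
    rw [e1]
    exact nu_shift (fun a => H (Int.fract a)) (fun a => by simp) t
  have s8 : ∀ᵐ x ∂mu, H x.1 = ∫⁻ a, H (Int.fract a) ∂nu := by
    have : Measure.QuasiMeasurePreserving Prod.fst mu nu := Measure.quasiMeasurePreserving_fst
    exact this.ae s7
  filter_upwards [s3, s8] with x h3 h8
  rw [← h8, ← h3]

lemma zero_one (h : Hyp φ) {A : Set (ℝ × ℝ)} (hA : MeasurableSet A) (hp : WPer (· ∈ A))
    (hinv : ∀ᵐ x ∂mu, T φ x ∈ A ↔ x ∈ A) : (∀ᵐ x ∂mu, x ∈ A) ∨ (∀ᵐ x ∂mu, x ∉ A) := by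
  classical
  let u : ℝ × ℝ → ℝ := A.indicator 1
  have u1 : ∀ x ∈ A, u x = 1 := fun x hx => indicator_of_mem hx _
  have u0 : ∀ x, x ∉ A → u x = 0 := fun x hx => indicator_of_notMem hx _
  have hp' : ∀ t w, ((t, w+1) ∈ A) = ((t, w) ∈ A) := hp
  obtain ⟨C, hC⟩ := const h (u := u) (measurable_one.indicator hA)
    (fun x => by by_cases hx : x ∈ A <;> simp [u1, u0, hx])
    (fun x => by by_cases hx : x ∈ A <;> simp [u1, u0, hx])
    (by
      intro t w
      by_cases hx : (t,w) ∈ A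
      · rw [u1 _ hx, u1 _ (by rwa [hp'])]
      · rw [u0 _ hx, u0 _ (by rwa [hp'])])
    (by
      filter_upwards [hinv] with x hx
      by_cases hx' : x ∈ A
      · rw [u1 _ hx', u1 _ (hx.2 hx')]
      · rw [u0 _ hx', u0 _ (fun h => hx' (hx.1 h))])
  by_cases hC1 : C = 1
  · left
    filter_upwards [hC] with x hx
    by_contra hxA
    rw [u0 x hxA, hC1] at hx
    simp at hx
  · right
    filter_upwards [hC] with x hx hxA
    rw [u1 x hxA] at hx
    exact hC1 (by rw [← hx]; simp)

end LTM

open scoped ENNReal NNReal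

namespace LTM
variable {φ : ℝ → ℝ}

noncomputable def cl (t : ℝ) : ℝ := max 0 (min t 1)
lemma cl_mem (t : ℝ) : cl t ∈ Icc (0:ℝ) 1 :=
  ⟨le_max_left _ _, max_le zero_le_one (min_le_right _ _)⟩
lemma cl_eq {t : ℝ} (ht : t ∈ Icc (0:ℝ) 1) : cl t = t := by
  rw [cl, min_eq_left ht.2, max_eq_right ht.1]
lemma cl_mono : Monotone cl := fun a b hab => max_le_max le_rfl (min_le_min hab le_rfl)
lemma cl_lip (a b : ℝ) : |cl a - cl b| ≤ |a - b| := by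
  unfold cl
  have h1 : |max 0 (min a 1) - max 0 (min b 1)| ≤ |min a 1 - min b 1| := by
    simpa using abs_max_sub_max_le_max (0:ℝ) (min a 1) 0 (min b 1)
  have h2 : |min a 1 - min b 1| ≤ |a - b| := by
    simpa using abs_min_sub_min_le_max a (1:ℝ) b 1
  exact h1.trans h2

lemma mk_hyp {ψ : ℝ → ℝ} (hψ : ContDiffOn ℝ 2 ψ (Icc 0 1))
    (hp : ∀ t ∈ Ioo (0:ℝ) 1, 0 < derivWithin ψ (Icc 0 1) t) : Hyp (fun t => ψ (cl t)) := by
  have hud : UniqueDiffOn ℝ (Icc (0:ℝ) 1) := uniqueDiffOn_Icc zero_lt_one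
  have hd1 : ContDiffOn ℝ 1 (derivWithin ψ (Icc 0 1)) (Icc 0 1) := hψ.derivWithin hud (by norm_num)
  have hdiff : DifferentiableOn ℝ ψ (Icc 0 1) := hψ.differentiableOn (by norm_num)
  have hcD : ContinuousOn (derivWithin ψ (Icc 0 1)) (Icc 0 1) := hd1.continuousOn
  have hderiv : ∀ t ∈ Ioo (0:ℝ) 1, HasDerivAt ψ (derivWithin ψ (Icc 0 1) t) t := fun t ht =>
    (hdiff t (Ioo_subset_Icc_self ht)).hasDerivWithinAt.hasDerivAt (Icc_mem_nhds ht.1 ht.2)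
  have hsm : StrictMonoOn ψ (Icc 0 1) := by
    refine strictMonoOn_of_deriv_pos (convex_Icc 0 1) hψ.continuousOn ?_
    rw [interior_Icc]
    intro t ht
    rw [(hderiv t ht).deriv]; exact hp t ht
  have lipgen : ∀ χ : ℝ → ℝ, ContDiffOn ℝ 1 χ (Icc 0 1) → ∃ K, 0 ≤ K ∧ ∀ a ∈ Icc (0:ℝ) 1, ∀ b ∈ Icc (0:ℝ) 1,
      |χ a - χ b| ≤ K * |a - b| := by
    intro χ hχ
    have hc := (hχ.derivWithin (m := 0) hud (by norm_num)).continuousOn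
    obtain ⟨K, hK⟩ := isCompact_Icc.exists_bound_of_continuousOn hc
    refine ⟨K, (norm_nonneg _).trans (hK 0 ⟨le_rfl, zero_le_one⟩), fun a ha b hb => ?_⟩
    exact (convex_Icc (0:ℝ) 1).norm_image_sub_le_of_norm_derivWithin_le (hχ.differentiableOn (by norm_num)) hK hb ha
  refine ⟨fun a b hab => hsm.monotoneOn (cl_mem a) (cl_mem b) (cl_mono hab), ?_, ?_, ?_, ?_⟩
  · intro a ha b hb hab
    simp only [cl_eq ha, cl_eq hb]; exact hsm ha hb hab
  · obtain ⟨K, hK0, hK⟩ := lipgen ψ (hψ.of_le (by norm_num))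
    refine ⟨K, hK0, fun a b => (hK _ (cl_mem a) _ (cl_mem b)).trans ?_⟩
    have := cl_lip a b
    gcongr
  · obtain ⟨L, hL0, hL⟩ := lipgen _ hd1
    refine ⟨L, hL0, ?_⟩
    intro a b a' b' ha hb ha' hb' hab hab'
    simp only [cl_eq ha, cl_eq hb, cl_eq ha', cl_eq hb']
    have hba : 0 < b - a := by linarith
    have hba' : 0 < b' - a' := by linarith
    have aff : ∀ p q s : ℝ, p ∈ Icc (0:ℝ) 1 → q ∈ Icc (0:ℝ) 1 → s ∈ Icc (0:ℝ) 1 → p + s * (q - p) ∈ Icc (0:ℝ) 1 := by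
      intro p q s hp hq hs
      constructor <;> nlinarith [hp.1, hp.2, hq.1, hq.2, hs.1, hs.2]
    have aff' : ∀ p q s : ℝ, p ∈ Icc (0:ℝ) 1 → q ∈ Icc (0:ℝ) 1 → p < q → s ∈ Ioo (0:ℝ) 1 → p + s * (q - p) ∈ Ioo (0:ℝ) 1 := by
      intro p q s hp hq hpq hs
      constructor <;> nlinarith [hp.1, hp.2, hq.1, hq.2, hs.1, hs.2, mul_pos hs.1 (sub_pos.2 hpq), mul_pos (sub_pos.2 hs.2) (sub_pos.2 hpq)]
    have hcomp : ∀ p q : ℝ, p ∈ Icc (0:ℝ) 1 → q ∈ Icc (0:ℝ) 1 → ContinuousOn (fun s => ψ (p + s * (q - p)) / (q - p)) (Icc 0 1) := by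
      intro p q hp hq
      refine ContinuousOn.div_const ?_ _
      exact hψ.continuousOn.comp (by fun_prop) (fun s hs => aff p q s hp hq hs)
    have hder : ∀ p q s : ℝ, p ∈ Icc (0:ℝ) 1 → q ∈ Icc (0:ℝ) 1 → p < q → s ∈ Ioo (0:ℝ) 1 →
        HasDerivAt (fun s => ψ (p + s * (q - p)) / (q - p)) (derivWithin ψ (Icc 0 1) (p + s * (q - p))) s := by
      intro p q s hp hq hpq hs
      have e1 : HasDerivAt (fun s => p + s * (q - p)) (q - p) s := by
        simpa using ((hasDerivAt_id s).mul_const (q - p)).const_add p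
      have e2 := ((hderiv _ (aff' p q s hp hq hpq hs)).comp s e1).div_const (q - p)
      have : q - p ≠ 0 := by linarith
      rw [mul_div_assoc, div_self this, mul_one] at e2
      exact e2
    obtain ⟨s, hs, hs2⟩ := exists_hasDerivAt_eq_slope (fun s => ψ (a' + s * (b' - a')) / (b' - a') - ψ (a + s * (b - a)) / (b - a))
      (fun s => derivWithin ψ (Icc 0 1) (a' + s * (b' - a')) - derivWithin ψ (Icc 0 1) (a + s * (b - a))) zero_lt_one
      ((hcomp a' b' ha' hb').sub (hcomp a b ha hb))
      (fun s hs => (hder a' b' s ha' hb' hab' hs).sub (hder a b s ha hb hab hs))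
    simp only [one_mul, add_sub_cancel, zero_mul, add_zero, sub_zero, div_one] at hs2
    have hsI := Ioo_subset_Icc_self hs
    have h3 := hL _ (aff a' b' s ha' hb' hsI) _ (aff a b s ha hb hsI)
    have h4 : |a' + s * (b' - a') - (a + s * (b - a))| ≤ |a - a'| + |b - b'| := by
      have : a' + s * (b' - a') - (a + s * (b - a)) = (1 - s) * (a' - a) + s * (b' - b) := by ring
      rw [this]
      refine (abs_add_le _ _).trans ?_
      rw [abs_mul, abs_mul, abs_of_pos hs.1, abs_of_pos (sub_pos.2 hs.2), abs_sub_comm a' a, abs_sub_comm b' b]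
      nlinarith [hs.1, hs.2, abs_nonneg (a - a'), abs_nonneg (b - b')]
    have h5 := (le_abs_self _).trans (h3.trans (mul_le_mul_of_nonneg_left h4 hL0))
    rw [hs2] at h5
    have e1 : (ψ b' - ψ a') / (b' - a') = ψ b' / (b' - a') - ψ a' / (b' - a') := sub_div _ _ _
    have e2 : (ψ b - ψ a) / (b - a) = ψ b / (b - a) - ψ a / (b - a) := sub_div _ _ _
    linarith
  · intro ε hε
    by_cases hne : ε ≤ 1 - ε
    · have hsub : Icc ε (1 - ε) ⊆ Ioo 0 1 := fun x hx => ⟨by linarith [hx.1], by linarith [hx.2]⟩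
      obtain ⟨m, hm, hmin⟩ := isCompact_Icc.exists_isMinOn (nonempty_Icc.2 hne)
        (hcD.mono (hsub.trans Ioo_subset_Icc_self))
      refine ⟨_, hp m (hsub hm), fun a b ha hab hb => ?_⟩
      have ha' : a ∈ Icc ε (1-ε) := ⟨ha, hab.trans hb⟩
      have hb' : b ∈ Icc ε (1-ε) := ⟨ha.trans hab, hb⟩
      rw [cl_eq (Ioo_subset_Icc_self (hsub ha')), cl_eq (Ioo_subset_Icc_self (hsub hb'))]
      refine (convex_Icc ε (1-ε)).mul_sub_le_image_sub_of_le_deriv (f := ψ)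
        (hψ.continuousOn.mono (hsub.trans Ioo_subset_Icc_self)) ?_ ?_ a ha' b hb' hab
      · intro x hx
        exact (hderiv x (hsub (interior_subset hx))).differentiableAt.differentiableWithinAt
      · intro x hx
        rw [(hderiv x (hsub (interior_subset hx))).deriv]
        exact hmin (interior_subset hx)
    · exact ⟨1, one_pos, fun a b ha hab hb => absurd (ha.trans (hab.trans hb)) hne⟩

noncomputable def pr (g : ℝ) (x : ℝ × ℝ) : ℝ × ℝ := (x.1, g * Int.fract x.2)

lemma meas_pr (g : ℝ) : Measurable (pr g) := by
  unfold pr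
  exact measurable_fst.prodMk ((measurable_fract.comp measurable_snd).const_mul g)

lemma map_pr {g : ℝ} (hg : 0 < g) : torusMeasure g = mu.map (pr g) := by
  have e1 : mu.map (pr g) = mu.map (Prod.map id (fun w => g * w)) := by
    refine Measure.map_congr ?_
    filter_upwards [ae_mem] with x hx
    simp only [pr, Prod.map, id, Int.fract_eq_self.2 hx.2]
  have hm : Measurable (fun w : ℝ => g * w) := by fun_prop
  have e2 : nu.map (fun w => g * w) = (ENNReal.ofReal g)⁻¹ • volume.restrict (Ico 0 g) := by
    have hpre : (fun w => g * w) ⁻¹' (Ico 0 g) = Ico (0:ℝ) 1 := by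
      ext w
      simp only [mem_preimage, mem_Ico]
      constructor
      · rintro ⟨h1, h2⟩; constructor
        · exact nonneg_of_mul_nonneg_right h1 hg
        · nlinarith
      · rintro ⟨h1, h2⟩; constructor
        · positivity
        · nlinarith
    rw [nu, ← hpre, ← Measure.restrict_map hm measurableSet_Ico, Real.map_volume_mul_left hg.ne',
      Measure.restrict_smul, abs_of_pos (inv_pos.2 hg), ENNReal.ofReal_inv_of_pos hg]
  rw [e1, mu, ← Measure.map_prod_map _ _ measurable_id hm, e2, Measure.map_id, Measure.prod_smul_right, nu,
    Measure.prod_restrict]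
  rfl

theorem main (f : ℝ → ℝ) (g : ℝ) (hg : 0 < g)
    (hreg : ∃ F : ℝ → ℝ, ContDiffOn ℝ 3 F (Set.Icc (0 : ℝ) 1) ∧
      (∀ t ∈ Set.Ioo (0 : ℝ) 1, f t = F t) ∧
      derivWithin F (Set.Icc (0 : ℝ) 1) 0 ≠ derivWithin F (Set.Icc (0 : ℝ) 1) 1)
    (hpos : ∀ t ∈ Set.Ioo (0 : ℝ) 1, 0 < deriv (deriv f) t) :
    Ergodic (limitTorusMap f g) (torusMeasure g) := by
  obtain ⟨F, hF, hfF, -⟩ := hreg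
  have hud : UniqueDiffOn ℝ (Icc (0:ℝ) 1) := uniqueDiffOn_Icc zero_lt_one
  set D := derivWithin F (Icc 0 1) with hD
  have hDc : ContDiffOn ℝ 2 D (Icc 0 1) := hF.derivWithin hud (by norm_num)
  have hfD : ∀ t ∈ Ioo (0:ℝ) 1, deriv f t = D t := by
    intro t ht
    have e : f =ᶠ[nhds t] F := by
      filter_upwards [Ioo_mem_nhds ht.1 ht.2] with x hx using hfF x hx
    rw [e.deriv_eq, hD, derivWithin_of_mem_nhds (Icc_mem_nhds ht.1 ht.2)]
  have hfD2 : ∀ t ∈ Ioo (0:ℝ) 1, deriv (deriv f) t = derivWithin D (Icc 0 1) t := by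
    intro t ht
    have e : deriv f =ᶠ[nhds t] D := by
      filter_upwards [Ioo_mem_nhds ht.1 ht.2] with x hx using hfD x hx
    rw [e.deriv_eq, derivWithin_of_mem_nhds (Icc_mem_nhds ht.1 ht.2)]
  have hH : Hyp (fun t => (fun s => (2 / g) * D s) (cl t)) := by
    refine mk_hyp (contDiffOn_const.mul hDc) ?_
    intro t ht
    rw [derivWithin_const_mul_field, ← hfD2 t ht]
    have := hpos t ht
    positivity
  set φ : ℝ → ℝ := (fun t => (fun s => (2 / g) * D s) (cl t)) with hφ
  have hφf : ∀ t ∈ Ioo (0:ℝ) 1, φ t = 2 * deriv f t / g := by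
    intro t ht
    simp only [hφ, cl_eq (Ioo_subset_Icc_self ht), hfD t ht]; ring
  have hM : Measurable (limitTorusMap f g) := by
    have h1 := measurable_deriv f
    have h2 : Measurable (fun p : ℝ × ℝ => Int.fract (p.1 + 2 * p.2 / g)) :=
      measurable_fract.comp (by fun_prop)
    unfold limitTorusMap
    refine h2.prodMk ((measurable_fract.comp ?_).const_mul g)
    exact (measurable_snd.add ((h1.comp h2).const_mul 2)).div_const g
  have hne : ∀ᵐ x ∂mu, (T φ x).1 ≠ 0 := by
    have hm0 : MeasurableSet {x : ℝ × ℝ | x.1 = 0} := measurable_fst (measurableSet_singleton 0)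
    have e0 : mu {x : ℝ × ℝ | x.1 = 0} = 0 := by
      have : {x : ℝ × ℝ | x.1 = 0} = ({0} : Set ℝ) ×ˢ univ := by ext x; simp
      rw [this, mu, Measure.prod_prod]; simp [nu]
    have e1 := mu_iter hH 1 hm0 (fun _ _ => rfl)
    rw [e0, measure_eq_zero_iff_ae_notMem] at e1
    exact e1
  have hconj : ∀ᵐ x ∂mu, limitTorusMap f g (pr g x) = pr g (T φ x) := by
    filter_upwards [hne, ae_mem] with x hx hxm
    have e1 : Int.fract x.2 = x.2 := Int.fract_eq_self.2 hxm.2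
    have e2 : x.1 + 2 * (g * x.2) / g = x.1 + 2 * x.2 := by field_simp
    have e3 : Int.fract (x.1 + 2 * x.2) ∈ Ioo (0:ℝ) 1 :=
      ⟨lt_of_le_of_ne (Int.fract_nonneg _) (Ne.symm hx), Int.fract_lt_one _⟩
    simp only [limitTorusMap, pr, T, e1, e2, hφf _ e3]
    congr 3
    field_simp
  refine ⟨⟨hM, ?_⟩, ⟨?_⟩⟩
  · rw [map_pr hg, Measure.map_map hM (meas_pr g), Measure.map_congr (f := limitTorusMap f g ∘ pr g) (g := pr g ∘ T φ) hconj]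
    ext s hs
    rw [Measure.map_apply ((meas_pr g).comp (meas_T hH)) hs, Measure.map_apply (meas_pr g) hs]
    refine mu_iter hH 1 (meas_pr g hs) ?_
    intro t w
    simp only [mem_preimage, pr, Int.fract_add_one]
  · intro s hs hinv
    have := zero_one hH (meas_pr g hs) (by intro t w; simp only [mem_preimage, pr, Int.fract_add_one]) (by
      filter_upwards [hconj] with x hx
      rw [mem_preimage, mem_preimage, ← hx]
      exact iff_of_eq (congrArg (fun S => pr g x ∈ S) hinv))
    rw [eventuallyConst_set, map_pr hg]
    rcases this with h | h
    · exact Or.inl ((ae_map_iff (meas_pr g).aemeasurable hs).2 h)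
    · exact Or.inr ((ae_map_iff (meas_pr g).aemeasurable hs.compl).2 h)

end LTM

/-- If the wall motion `f` satisfies `f̈(t) > 0` for all `t ∈ (0,1)`, then the limit map
`F̃∞` is ergodic with respect to the normalized Lebesgue measure on the torus. -/
theorem ergodic_limitTorusMap_of_ddf_pos (f : ℝ → ℝ) (g : ℝ) (hg : 0 < g)
    (hper : ∀ t, f (t + 1) = f t)
    (hreg : ∃ F : ℝ → ℝ, ContDiffOn ℝ 3 F (Set.Icc (0 : ℝ) 1) ∧
      (∀ t ∈ Set.Ioo (0 : ℝ) 1, f t = F t) ∧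
      derivWithin F (Set.Icc (0 : ℝ) 1) 0 ≠ derivWithin F (Set.Icc (0 : ℝ) 1) 1)
    (hpos : ∀ t ∈ Set.Ioo (0 : ℝ) 1, 0 < deriv (deriv f) t) :
    Ergodic (limitTorusMap f g) (torusMeasure g) := by
  exact LTM.main f g hg hreg hpos
end

section
/- Distortion control along unstable curves: let g > 0 and let f be a 1-periodic wall motion, C³ on (0,1), with 0 < k_min ≤ f̈ ≤ k_max and |f'''| ≤ D on (0,1). Let W be an unstable curve parametrized as v = ψ(t), t ∈ I, where ψ is C² with ψ'(t) ∈ [2k_min, 2k_max + g/2] and |ψ''| ≤ K, and suppose frac(t + 2ψ(t)/g) ∈ (0,1) for all t ∈ I (W does not meet the singularity set S⁺). Define the Jacobian of F̃∞ along W by J_W(t) = ‖M(k₁(t))·(1, ψ'(t))‖ / ‖(1, ψ'(t))‖, where M(k) = [[1, 2/g], [2k, 1 + 4k/g]] and k₁(t) = f̈(frac(t + 2ψ(t)/g)). Then there is a constant C, depending only on g, k_min, k_max, D and K, such that |log J_W(x) − log J_W(y)| ≤ C |x − y| for all x, y ∈ I. -/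
open Set

/-- The Jacobian of the limit map `F̃∞` along an unstable curve `v = ψ(t)`:
`J_W(t) = ‖M(k₁(t))·(1, ψ'(t))‖ / ‖(1, ψ'(t))‖` where `M(k) = [[1, 2/g], [2k, 1+4k/g]]`
and `k₁(t) = f̈(frac(t + 2ψ(t)/g))`. -/
noncomputable def unstableJacobian (g : ℝ) (f ψ : ℝ → ℝ) (t : ℝ) : ℝ :=
  Real.sqrt ((1 + 2 / g * deriv ψ t) ^ 2 +
      (2 * deriv (deriv f) (Int.fract (t + 2 * ψ t / g)) +
        (1 + 4 * deriv (deriv f) (Int.fract (t + 2 * ψ t / g)) / g) * deriv ψ t) ^ 2) /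
    Real.sqrt (1 + (deriv ψ t) ^ 2)

lemma dist_log_sqrt {A B : ℝ} (hA : 1 ≤ A) (hB : 1 ≤ B) :
    |Real.log (Real.sqrt A) - Real.log (Real.sqrt B)| ≤ |A - B| / 2 := by
  have key : ∀ {A B : ℝ}, 1 ≤ A → 1 ≤ B → Real.log A - Real.log B ≤ |A - B| := by
    intro A B hA hB
    rw [← Real.log_div (by positivity) (by positivity)]
    have h1 := Real.log_le_sub_one_of_pos (x := A / B) (by positivity)
    have h2 : A / B - 1 = (A - B) / B := by field_simp
    have h3 : (A - B) / B ≤ |A - B| := by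
      rw [div_le_iff₀ (by positivity)]
      nlinarith [le_abs_self (A - B), abs_nonneg (A - B)]
    linarith
  rw [Real.log_sqrt (by positivity), Real.log_sqrt (by positivity)]
  have h1 := key hA hB
  have h2 := key hB hA
  rw [abs_sub_comm B A] at h2
  rw [abs_le]
  constructor <;> linarith

lemma dist_sq {a b m e : ℝ} (ha : 0 ≤ a) (hb : 0 ≤ b) (ham : a ≤ m) (hbm : b ≤ m)
    (h : |a - b| ≤ e) : |a ^ 2 - b ^ 2| ≤ 2 * m * e := by
  have : a ^ 2 - b ^ 2 = (a + b) * (a - b) := by ring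
  rw [this, abs_mul, abs_of_nonneg (by positivity : 0 ≤ a + b)]
  exact mul_le_mul (by linarith) h (abs_nonneg _) (by linarith)

lemma dist_floor {θ : ℝ → ℝ} {I : Set ℝ} (hI : Convex ℝ I) (hθ : Continuous θ)
    (h : ∀ t ∈ I, Int.fract (θ t) ∈ Set.Ioo (0 : ℝ) 1) {x y : ℝ} (hx : x ∈ I) (hy : y ∈ I) :
    ⌊θ x⌋ = ⌊θ y⌋ := by
  have key : ∀ x ∈ I, ∀ y ∈ I, ⌊θ y⌋ ≤ ⌊θ x⌋ := by
    intro x hx y hy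
    by_contra! hlt
    have h1 : θ x ≤ (⌊θ y⌋ : ℝ) := (Int.floor_lt.mp hlt).le
    have h2 : (⌊θ y⌋ : ℝ) ≤ θ y := Int.floor_le _
    obtain ⟨t, ht, hte⟩ := hI.isPreconnected.intermediate_value hx hy hθ.continuousOn ⟨h1, h2⟩
    have := (h t ht).1
    rw [hte, Int.fract_intCast] at this
    exact lt_irrefl _ this
  exact le_antisymm (key y hy x hx) (key x hx y hy)

/-- Distortion control along unstable curves: there is a constant `C` depending only on
`g, k_min, k_max, D, K` such that for every wall motion `f` (1-periodic, `C³` on `(0,1)`,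
with `0 < k_min ≤ f̈ ≤ k_max` and `|f'''| ≤ D` there) and every unstable curve `v = ψ(t)`,
`t ∈ I`, with `ψ' ∈ [2k_min, 2k_max + g/2]` and `|ψ''| ≤ K` on `I`, avoiding the
singularity set `S⁺`, one has `|log J_W(x) − log J_W(y)| ≤ C |x − y|` on `I`. -/
theorem distortion_control_unstable_curve (g kmin kmax D K : ℝ)
    (hg : 0 < g) (hkmin : 0 < kmin) (hkk : kmin ≤ kmax) (hD : 0 ≤ D) (hK : 0 ≤ K) :
    ∃ C : ℝ, 0 < C ∧
      ∀ (f ψ : ℝ → ℝ) (I : Set ℝ), Convex ℝ I →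
        (∀ t, f (t + 1) = f t) →
        ContDiffOn ℝ 3 f (Set.Ioo (0 : ℝ) 1) →
        (∀ t ∈ Set.Ioo (0 : ℝ) 1,
          kmin ≤ deriv (deriv f) t ∧ deriv (deriv f) t ≤ kmax ∧
            |deriv (deriv (deriv f)) t| ≤ D) →
        ContDiff ℝ 2 ψ →
        (∀ t ∈ I, deriv ψ t ∈ Set.Icc (2 * kmin) (2 * kmax + g / 2)) →
        (∀ t ∈ I, |deriv (deriv ψ) t| ≤ K) →
        (∀ t ∈ I, Int.fract (t + 2 * ψ t / g) ∈ Set.Ioo (0 : ℝ) 1) →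
        ∀ x ∈ I, ∀ y ∈ I,
          |Real.log (unstableJacobian g f ψ x) - Real.log (unstableJacobian g f ψ y)| ≤
            C * |x - y| := by
  have hkM : 0 < kmax := lt_of_lt_of_le hkmin hkk
  obtain ⟨P, hP⟩ : ∃ P, P = 2 * kmax + g / 2 := ⟨_, rfl⟩
  have hP0 : 0 < P := by rw [hP]; positivity
  obtain ⟨L, hL⟩ : ∃ L, L = D * (1 + 2 * P / g) := ⟨_, rfl⟩
  have hL0 : 0 ≤ L := by rw [hL]; positivity
  obtain ⟨Ca, hCa⟩ : ∃ Ca, Ca = 2 * (1 + 2 / g * P) * (2 / g * K) := ⟨_, rfl⟩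
  obtain ⟨Cb, hCb⟩ : ∃ Cb, Cb = 2 * (2 * kmax + (1 + 4 * kmax / g) * P) *
    ((2 + 4 * P / g) * L + (1 + 4 * kmax / g) * K) := ⟨_, rfl⟩
  have hCa0 : 0 ≤ Ca := by rw [hCa]; positivity
  have hCb0 : 0 ≤ Cb := by rw [hCb]; positivity
  refine ⟨Ca + Cb + 2 * P * K + 1, by positivity, ?_⟩
  intro f ψ I hI _ hf hfb hψ hψ1 hψ2 hfr x hx y hy
  have hψd : Differentiable ℝ ψ := hψ.differentiable (by norm_num)
  have hψdd : Differentiable ℝ (deriv ψ) := by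
    have : ContDiff ℝ 1 (deriv ψ) := by
      have h2 : ContDiff ℝ (1 + 1) ψ := by
        convert hψ using 1
        norm_num
      exact (contDiff_succ_iff_deriv.mp h2).2.2
    exact this.differentiable (by norm_num)
  have hpos : ∀ t ∈ I, 0 ≤ deriv ψ t ∧ deriv ψ t ≤ P := fun t ht =>
    ⟨by have := (hψ1 t ht).1; linarith, by rw [hP]; exact (hψ1 t ht).2⟩
  have hfdd : DifferentiableOn ℝ (deriv (deriv f)) (Set.Ioo 0 1) := by
    have h2 : ContDiffOn ℝ 2 (deriv f) (Set.Ioo 0 1) :=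
      hf.deriv_of_isOpen isOpen_Ioo (by norm_num)
    have h1 : ContDiffOn ℝ 1 (deriv (deriv f)) (Set.Ioo 0 1) :=
      h2.deriv_of_isOpen isOpen_Ioo (by norm_num)
    exact h1.differentiableOn (by norm_num)
  have hdp : |deriv ψ x - deriv ψ y| ≤ K * |x - y| := by
    have := hI.norm_image_sub_le_of_norm_deriv_le (f := deriv ψ) (C := K)
      (fun t _ => hψdd t) hψ2 hy hx
    simpa [Real.norm_eq_abs] using this
  have hdψ : |ψ x - ψ y| ≤ P * |x - y| := by
    have := hI.norm_image_sub_le_of_norm_deriv_le (f := ψ) (C := P)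
      (fun t _ => hψd t) (fun t ht => by
        rw [Real.norm_eq_abs, abs_of_nonneg (hpos t ht).1]; exact (hpos t ht).2) hy hx
    simpa [Real.norm_eq_abs] using this
  have hθc : Continuous (fun t => t + 2 * ψ t / g) := by
    have := hψd.continuous
    fun_prop
  have hfl := dist_floor hI hθc hfr hx hy
  have hux := hfr x hx
  have huy := hfr y hy
  have hdu : |Int.fract (x + 2 * ψ x / g) - Int.fract (y + 2 * ψ y / g)| ≤
      (1 + 2 * P / g) * |x - y| := by
    have e : Int.fract (x + 2 * ψ x / g) - Int.fract (y + 2 * ψ y / g)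
        = (x - y) + 2 / g * (ψ x - ψ y) := by
      unfold Int.fract
      rw [hfl]
      ring
    rw [e]
    refine (abs_add_le _ _).trans ?_
    rw [abs_mul, abs_of_pos (by positivity : 0 < 2 / g)]
    have := mul_le_mul_of_nonneg_left hdψ (by positivity : 0 ≤ 2 / g)
    calc _ ≤ |x - y| + 2 / g * (P * |x - y|) := by linarith
      _ = _ := by ring
  unfold unstableJacobian
  obtain ⟨hpx0, hpxP⟩ := hpos x hx
  obtain ⟨hpy0, hpyP⟩ := hpos y hy
  obtain ⟨hkx1, hkx2, -⟩ := hfb _ hux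
  obtain ⟨hky1, hky2, -⟩ := hfb _ huy
  have hdk : |deriv (deriv f) (Int.fract (x + 2 * ψ x / g)) -
      deriv (deriv f) (Int.fract (y + 2 * ψ y / g))| ≤ L * |x - y| := by
    have := (convex_Ioo (0 : ℝ) 1).norm_image_sub_le_of_norm_deriv_le (f := deriv (deriv f))
      (C := D) (fun t ht => hfdd.differentiableAt (isOpen_Ioo.mem_nhds ht))
      (fun t ht => (hfb t ht).2.2) huy hux
    simp only [Real.norm_eq_abs] at this
    refine this.trans ?_
    rw [hL, mul_assoc]
    exact mul_le_mul_of_nonneg_left hdu hD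
  generalize deriv (deriv f) (Int.fract (x + 2 * ψ x / g)) = k at *
  generalize deriv (deriv f) (Int.fract (y + 2 * ψ y / g)) = l at *
  generalize deriv ψ x = p at *
  generalize deriv ψ y = q at *
  have hk0 : 0 ≤ k := by linarith
  have hl0 : 0 ≤ l := by linarith
  have hr0 : 0 ≤ |x - y| := abs_nonneg _
  generalize |x - y| = r at *
  have hA : ∀ a b : ℝ, 0 ≤ a → 1 ≤ (1 + 2 / g * a) ^ 2 + b ^ 2 := by
    intro a b ha
    have : 0 ≤ 2 / g * a := by positivity
    nlinarith [sq_nonneg b]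
  have hB : ∀ a : ℝ, 1 ≤ 1 + a ^ 2 := fun a => by nlinarith [sq_nonneg a]
  have hs : ∀ a : ℝ, 1 ≤ a → Real.sqrt a ≠ 0 := fun a ha =>
    (Real.sqrt_pos.mpr (by linarith)).ne'
  rw [Real.log_div (hs _ (hA _ _ hpx0)) (hs _ (hB _)),
    Real.log_div (hs _ (hA _ _ hpy0)) (hs _ (hB _))]
  have h1 := dist_log_sqrt (hA p (2 * k + (1 + 4 * k / g) * p) hpx0)
    (hA q (2 * l + (1 + 4 * l / g) * q) hpy0)
  have h2 := dist_log_sqrt (hB p) (hB q)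
  have h3 : |p ^ 2 - q ^ 2| ≤ 2 * P * (K * r) := dist_sq hpx0 hpy0 hpxP hpyP hdp
  have h4 : |(1 + 2 / g * p) ^ 2 - (1 + 2 / g * q) ^ 2| ≤
      2 * (1 + 2 / g * P) * (2 / g * (K * r)) := by
    apply dist_sq (by positivity) (by positivity) (by gcongr) (by gcongr)
    have : 1 + 2 / g * p - (1 + 2 / g * q) = 2 / g * (p - q) := by ring
    rw [this, abs_mul, abs_of_pos (by positivity : 0 < 2 / g)]
    gcongr
  have h5 : |(2 * k + (1 + 4 * k / g) * p) ^ 2 - (2 * l + (1 + 4 * l / g) * q) ^ 2| ≤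
      2 * (2 * kmax + (1 + 4 * kmax / g) * P) *
        ((2 + 4 * P / g) * (L * r) + (1 + 4 * kmax / g) * (K * r)) := by
    apply dist_sq (by positivity) (by positivity) (by gcongr) (by gcongr)
    have : 2 * k + (1 + 4 * k / g) * p - (2 * l + (1 + 4 * l / g) * q) =
      (2 + 4 * p / g) * (k - l) + (1 + 4 * l / g) * (p - q) := by ring
    rw [this]
    refine (abs_add_le _ _).trans ?_
    rw [abs_mul, abs_mul, abs_of_nonneg (by positivity : 0 ≤ 2 + 4 * p / g),
      abs_of_nonneg (by positivity : 0 ≤ 1 + 4 * l / g)]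
    gcongr
  have e4 : 2 * (1 + 2 / g * P) * (2 / g * (K * r)) = Ca * r := by rw [hCa]; ring
  have e5 : 2 * (2 * kmax + (1 + 4 * kmax / g) * P) *
        ((2 + 4 * P / g) * (L * r) + (1 + 4 * kmax / g) * (K * r)) = Cb * r := by rw [hCb]; ring
  rw [e4] at h4
  rw [e5] at h5
  have e3 : 1 + p ^ 2 - (1 + q ^ 2) = p ^ 2 - q ^ 2 := by ring
  rw [e3] at h2
  have h6 := abs_add_le ((1 + 2 / g * p) ^ 2 - (1 + 2 / g * q) ^ 2)
    ((2 * k + (1 + 4 * k / g) * p) ^ 2 - (2 * l + (1 + 4 * l / g) * q) ^ 2)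
  rw [sub_add_sub_comm] at h6
  have h7 : 0 ≤ Ca * r := by positivity
  have h8 : 0 ≤ Cb * r := by positivity
  have h9 : 0 ≤ P * K * r := by positivity
  have e10 : (Ca + Cb + 2 * P * K + 1) * r = Ca * r + Cb * r + 2 * (P * K * r) + r := by ring
  have e11 : 2 * P * (K * r) = 2 * (P * K * r) := by ring
  rw [e10]
  rw [e11] at h3
  rw [sub_sub_sub_comm]
  refine (abs_sub _ _).trans ?_
  linarith
end
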